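/- arXiv:1710.00799 — 2 statements merged into one kernel-verified Lean document; each statement's English description precedes it below -/
import Mathlib

section
/- For every constant ε > 0 there exists a positive constant L = L(ε) such that the following holds. Let p₁ = p₁(n) satisfy log n/(3n) ≤ p₁ ≤ 10·(log n)²/n, and for each n let G'' be a graph on at least n − 2n/(log n)² and at most n vertices such that: the maximum degree of G'' is at most (log n)³, every vertex of G'' has degree at least (1/2 + ε/5)·n·p₁, and every two distinct vertices of G'' have at most 2 common neighbours. Call a vertex u of G'' degenerate with respect to a partition V(G'') = A ∪ B if deg_{G''}(u, A) < (1/2 + ε/7)·|A|·p₁ or deg_{G''}(u, B) < (1/2 + ε/7)·|B|·p₁. Then, for a uniformly random partition of V(G'') into two parts A and B whose sizes differ by at most 1, asymptotically almost surely every vertex v ∈ V(G'') has fewer than L degenerate vertices in N²_{G''}(v). -/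
open MeasureTheory Filter ENNReal

namespace RGP

noncomputable section

variable {V : Type*}

/-- The degree of a vertex. -/
def deg (G : SimpleGraph V) (v : V) : ℕ := (G.neighborSet v).ncard

/-- `N^ℓ_G(v)`: vertices at distance at most `ℓ` from `v`, excluding `v`. -/
def nbhd (G : SimpleGraph V) (ℓ : ℕ) (v : V) : Set V :=
  {u | u ≠ v ∧ ∃ p : G.Walk v u, p.length ≤ ℓ}

/-- `TINY_{p,δ}(G)`. -/
def TINY (G : SimpleGraph V) (p δ : ℝ) : Set V :=
  {v | (deg G v : ℝ) < δ * (Nat.card V) * p}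

/-- `ATYP_{p,δ}(G)`. -/
def ATYP (G : SimpleGraph V) (p δ : ℝ) : Set V :=
  {v | (deg G v : ℝ) < (1 - δ) * (Nat.card V) * p ∨ (1 + δ) * (Nat.card V) * p < (deg G v : ℝ)}

/-- Edge density `|E| / C(n,2)`. -/
def density (G : SimpleGraph V) : ℝ :=
  (G.edgeSet.ncard : ℝ) / ((Nat.card V).choose 2 : ℕ)

/-- A matching covering all but at most one vertex. -/
def HasNearPerfectMatching (G : SimpleGraph V) : Prop :=
  ∃ M : G.Subgraph, M.IsMatching ∧ (M.vertsᶜ).ncard ≤ 1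

/-- Hamiltonicity (for finite vertex types). -/
def IsHam [Finite V] (G : SimpleGraph V) : Prop :=
  letI := Classical.decEq V; letI := Fintype.ofFinite V; G.IsHamiltonian

/-- `α`-resilience with respect to a property `P`. -/
def Resilient (G : SimpleGraph V) (α : ℝ) (P : SimpleGraph V → Prop) : Prop :=
  ∀ H : SimpleGraph V, H ≤ G → (∀ v, (deg H v : ℝ) ≤ α * (deg G v : ℝ)) → P (G \ H)

/-- `(α, δt, Kt, δa, Ka)`-resilience with respect to a property `P`. -/
def StrongResilient (G : SimpleGraph V) (α δt : ℝ) (Kt : ℕ) (δa : ℝ) (Ka : ℕ)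
    (P : SimpleGraph V → Prop) : Prop :=
  ∀ H : SimpleGraph V, H ≤ G →
    (∀ v ∈ TINY G (density G) δt, (deg H v : ℝ) ≤ (deg G v : ℝ) - Kt) →
    (∀ v, v ∈ ATYP G (density G) δa → v ∉ TINY G (density G) δt →
      (deg H v : ℝ) ≤ (deg G v : ℝ) - Ka) →
    (∀ v, v ∉ TINY G (density G) δt → v ∉ ATYP G (density G) δa →
      (deg H v : ℝ) ≤ α * (deg G v : ℝ)) →
    P (G \ H)

/-! ### The random graph process -/

/-- Potential edges of the complete graph on `Fin n`. -/
abbrev EdgeType (n : ℕ) := {e : Sym2 (Fin n) // ¬ e.IsDiag}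

/-- A sample point of the random graph process: a uniformly random ordering of the edges. -/
abbrev ProcessSpace (n : ℕ) := Fin (Fintype.card (EdgeType n)) ≃ EdgeType n

instance (n : ℕ) : MeasurableSpace (ProcessSpace n) := ⊤

/-- The uniform measure on orderings of the edges of `K_n`. -/
def processMeasure (n : ℕ) : Measure (ProcessSpace n) :=
  (Fintype.card (ProcessSpace n) : ℝ≥0∞)⁻¹ • Measure.sum (fun σ => Measure.dirac σ)

/-- The graph `G_m` of the process: the first `m` edges in the random ordering. -/
def processGraph {n : ℕ} (σ : ProcessSpace n) (m : ℕ) : SimpleGraph (Fin n) :=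
  SimpleGraph.fromEdgeSet {e | ∃ i : Fin (Fintype.card (EdgeType n)), (i : ℕ) < m ∧ (σ i : Sym2 (Fin n)) = e}

/-! ### The binomial random graph G(n,p) -/

abbrev GnpSpace (n : ℕ) := EdgeType n → Bool

/-- The Bernoulli product weight of an outcome. -/
def gnpWeight {n : ℕ} (p : ℝ) (ω : GnpSpace n) : ℝ≥0∞ :=
  ∏ e : EdgeType n, (if ω e then ENNReal.ofReal p else ENNReal.ofReal (1 - p))

/-- The `G(n,p)` probability measure. -/
def gnp (n : ℕ) (p : ℝ) : Measure (GnpSpace n) :=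
  Measure.sum (fun ω => gnpWeight p ω • Measure.dirac ω)

/-- The graph determined by an outcome of `G(n,p)`. -/
def gnpGraph {n : ℕ} (ω : GnpSpace n) : SimpleGraph (Fin n) :=
  SimpleGraph.fromEdgeSet {e | ∃ h : ¬ e.IsDiag, ω ⟨e, h⟩ = true}

/-- Joint distribution of two independent binomial random graphs. -/
def gnp2 (n : ℕ) (p₀ p' : ℝ) : Measure (GnpSpace n × GnpSpace n) :=
  Measure.sum (fun ω : GnpSpace n × GnpSpace n =>
    (gnpWeight p₀ ω.1 * gnpWeight p' ω.2) • Measure.dirac ω)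

/-! ### The 2-core -/

/-- The vertex set of the 2-core: the largest set every vertex of which has
at least two neighbours inside the set. -/
def coreSet (G : SimpleGraph V) : Set V :=
  ⋃₀ {S : Set V | ∀ v ∈ S, 2 ≤ ((G.neighborSet v) ∩ S).ncard}

/-- The 2-core of a graph, as a graph on the corresponding vertex subset. -/
def twoCore (G : SimpleGraph V) : SimpleGraph (coreSet G) := G.induce (coreSet G)


instance {α : Type*} : MeasurableSpace (Finset α) := ⊤

/-- The uniform probability measure on a finite set of outcomes. -/
def unifOn {β : Type*} [MeasurableSpace β] (s : Finset β) : Measure β :=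
  (s.card : ℝ≥0∞)⁻¹ • ∑ b ∈ s, Measure.dirac b

/-- `deg_G(v, X)`: the number of neighbours of `v` inside `X`. -/
def degIn (G : SimpleGraph V) (v : V) (X : Set V) : ℕ := (G.neighborSet v ∩ X).ncard

/-- Exponential-moment (Chernoff) bound for the number of subsets of `V` that meet `U` in at
most `τ` elements. -/
theorem card_filter_inter_le [Fintype V] [DecidableEq V] (U : Finset V) (τ : ℝ) {l : ℝ}
    (hl : 0 ≤ l) :
    ((Finset.univ.filter fun A : Finset V => ((U ∩ A).card : ℝ) ≤ τ).card : ℝ) ≤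
      2 ^ Fintype.card V * Real.exp (l * τ - (l / 2 - l ^ 2 / 8) * U.card) := by
  have hgen : ∑ A : Finset V, Real.exp (-l) ^ (U ∩ A).card =
      2 ^ Fintype.card V * ((1 + Real.exp (-l)) / 2) ^ U.card := by
    have h := Finset.prod_one_add (f := fun w : V => if w ∈ U then Real.exp (-l) else 1)
      (Finset.univ : Finset V)
    rw [Finset.powerset_univ] at h
    have h1 : ∀ A : Finset V, (∏ w ∈ A, if w ∈ U then Real.exp (-l) else 1) =
        Real.exp (-l) ^ (U ∩ A).card := fun A => by
      rw [Finset.prod_ite, Finset.prod_const, Finset.prod_const_one, mul_one,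
        Finset.filter_mem_eq_inter, Finset.inter_comm]
    simp only [h1] at h
    rw [← h]
    have h2 : ∀ w : V, (1 + if w ∈ U then Real.exp (-l) else (1 : ℝ)) =
        2 * if w ∈ U then (1 + Real.exp (-l)) / 2 else 1 := fun w => by
      split_ifs <;> ring
    simp only [h2]
    rw [Finset.prod_mul_distrib, Finset.prod_const, Finset.prod_ite, Finset.prod_const,
      Finset.prod_const_one, mul_one, Finset.filter_mem_eq_inter, Finset.univ_inter]
    rfl
  have hbase : (1 + Real.exp (-l)) / 2 ≤ Real.exp (-(l / 2 - l ^ 2 / 8)) := by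
    have h := Real.cosh_le_exp_half_sq (l / 2)
    have h3 : (1 + Real.exp (-l)) / 2 = Real.exp (-(l / 2)) * Real.cosh (l / 2) := by
      rw [Real.cosh_eq, mul_div_assoc', mul_add, ← Real.exp_add, ← Real.exp_add]
      ring_nf
      rw [Real.exp_zero]
      ring
    rw [h3, show -(l / 2 - l ^ 2 / 8) = -(l / 2) + (l / 2) ^ 2 / 2 by ring, Real.exp_add]
    gcongr
  calc ((Finset.univ.filter fun A : Finset V => ((U ∩ A).card : ℝ) ≤ τ).card : ℝ)
      = ∑ A ∈ Finset.univ.filter (fun A : Finset V => ((U ∩ A).card : ℝ) ≤ τ), (1 : ℝ) := by simp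
    _ ≤ ∑ A ∈ Finset.univ.filter (fun A : Finset V => ((U ∩ A).card : ℝ) ≤ τ),
          Real.exp (l * τ) * Real.exp (-l) ^ (U ∩ A).card := by
        refine Finset.sum_le_sum fun A hA => ?_
        rw [Finset.mem_filter] at hA
        rw [← Real.exp_nat_mul, ← Real.exp_add]
        apply Real.one_le_exp
        nlinarith [hA.2]
    _ ≤ ∑ A : Finset V, Real.exp (l * τ) * Real.exp (-l) ^ (U ∩ A).card :=
        Finset.sum_le_sum_of_subset_of_nonneg (Finset.filter_subset _ _)
          fun _ _ _ => by positivity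
    _ = Real.exp (l * τ) * (2 ^ Fintype.card V * ((1 + Real.exp (-l)) / 2) ^ U.card) := by
        rw [← Finset.mul_sum, hgen]
    _ ≤ Real.exp (l * τ) *
          (2 ^ Fintype.card V * Real.exp (-(l / 2 - l ^ 2 / 8)) ^ U.card) := by
        gcongr
    _ = _ := by
        rw [← Real.exp_nat_mul, mul_left_comm, ← Real.exp_add]
        congr 2
        ring

/-- A Bonferroni-type bound for sets with pairwise intersections of size at most two. -/
theorem mul_le_card_biUnion_add_sq {ι : Type*} [DecidableEq V] (N : ι → Finset V)
    (S : Finset ι) {d : ℝ} (hd : ∀ i ∈ S, d ≤ (N i).card)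
    (hN : ∀ i ∈ S, ∀ j ∈ S, i ≠ j → (N i ∩ N j).card ≤ 2) :
    S.card * d ≤ (S.biUnion N).card + (S.card : ℝ) ^ 2 := by
  classical
  induction S using Finset.induction_on with
  | empty => simp
  | insert a S ha ih =>
    have ih' := ih (fun i hi => hd i (Finset.mem_insert_of_mem hi)) fun i hi j hj =>
      hN i (Finset.mem_insert_of_mem hi) j (Finset.mem_insert_of_mem hj)
    have h1 : (N a ∩ S.biUnion N).card ≤ S.card * 2 := by
      rw [Finset.inter_biUnion]
      refine Finset.card_biUnion_le_card_mul _ _ _ fun j hj => ?_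
      exact hN a (Finset.mem_insert_self _ _) j (Finset.mem_insert_of_mem hj)
        (fun h => ha (h ▸ hj))
    have h2 := Finset.card_union_add_card_inter (N a) (S.biUnion N)
    have h3 := hd a (Finset.mem_insert_self _ _)
    rw [Finset.biUnion_insert, Finset.card_insert_of_notMem ha]
    have h1' : ((N a ∩ S.biUnion N).card : ℝ) ≤ S.card * 2 := by exact_mod_cast h1
    have h2' : ((N a ∪ S.biUnion N).card : ℝ) + (N a ∩ S.biUnion N).card =
        (N a).card + (S.biUnion N).card := by exact_mod_cast h2
    push_cast
    nlinarith

theorem ncard_nbhd_two_le [Finite V] (G : SimpleGraph V) {D : ℕ} (hD : ∀ v, deg G v ≤ D)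
    (v : V) : (nbhd G 2 v).ncard ≤ D + D * D := by
  classical
  have := Fintype.ofFinite V
  have hdeg : ∀ w, (G.neighborFinset w).card ≤ D := fun w => by
    rw [← Set.ncard_coe_finset, SimpleGraph.coe_neighborFinset]
    exact hD w
  have hsub : nbhd G 2 v ⊆
      ((G.neighborFinset v ∪ (G.neighborFinset v).biUnion fun w => G.neighborFinset w :
        Finset V) : Set V) := by
    rintro u ⟨huv, p, hp⟩
    simp only [Finset.coe_union, Finset.coe_biUnion, SimpleGraph.coe_neighborFinset,
      Set.mem_union, Set.mem_iUnion, SimpleGraph.mem_neighborSet, exists_prop]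
    match p, hp with
    | .nil, _ => exact absurd rfl huv
    | .cons h .nil, _ => exact Or.inl h
    | .cons h (.cons h' .nil), _ => exact Or.inr ⟨_, h, h'⟩
    | .cons _ (.cons _ (.cons _ _)), hp =>
      simp only [SimpleGraph.Walk.length_cons] at hp
      omega
  calc (nbhd G 2 v).ncard ≤ _ := Set.ncard_le_ncard hsub (Finset.finite_toSet _)
    _ = _ := Set.ncard_coe_finset _
    _ ≤ _ := Finset.card_union_le _ _
    _ ≤ D + D * D := by
      refine Nat.add_le_add (hdeg v) ((Finset.card_biUnion_le_card_mul _ _ _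
        fun w _ => hdeg w).trans (Nat.mul_le_mul_right _ (hdeg v)))

/-- Few vertex subsets `A` are such that some second neighbourhood contains `K` vertices, each
having fewer than `T` neighbours in `A`. -/
theorem card_filter_exists_le_ncard_degIn_lt [Fintype V] (G : SimpleGraph V) {D : ℕ}
    (hD : ∀ v, deg G v ≤ D) {d : ℝ} (hd : ∀ v, d ≤ deg G v)
    (hco : ∀ u v, u ≠ v → (G.neighborSet u ∩ G.neighborSet v).ncard ≤ 2)
    (T : ℝ) (K : ℕ) {l : ℝ} (hl : 0 ≤ l) (hl4 : l ≤ 4)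
    [DecidablePred fun A : Finset V =>
      ∃ v, K ≤ {u | u ∈ nbhd G 2 v ∧ (degIn G u ↑A : ℝ) < T}.ncard] :
    ((Finset.univ.filter fun A : Finset V =>
      ∃ v, K ≤ {u | u ∈ nbhd G 2 v ∧ (degIn G u ↑A : ℝ) < T}.ncard).card : ℝ) ≤
      Fintype.card V * (D + D * D : ℝ) ^ K *
        (2 ^ Fintype.card V * Real.exp (K * (l * T - (l / 2 - l ^ 2 / 8) * (d - K)))) := by
  classical
  set B : ℝ := 2 ^ Fintype.card V * Real.exp (K * (l * T - (l / 2 - l ^ 2 / 8) * (d - K)))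
    with hB
  let F : Finset V → Finset (Finset V) := fun S => Finset.univ.filter fun A : Finset V =>
    ((S.biUnion (fun u => G.neighborFinset u) ∩ A).card : ℝ) ≤ K * T
  have hF : ∀ S : Finset V, S.card = K → ((F S).card : ℝ) ≤ B := fun S hS => by
    refine (card_filter_inter_le _ _ hl).trans ?_
    have h := mul_le_card_biUnion_add_sq (fun u => G.neighborFinset u) S (d := d)
      (fun u _ => by
        rw [← Set.ncard_coe_finset, SimpleGraph.coe_neighborFinset]
        exact hd u)
      (fun u _ v _ huv => by
        rw [← Set.ncard_coe_finset, Finset.coe_inter, SimpleGraph.coe_neighborFinset,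
          SimpleGraph.coe_neighborFinset]
        exact hco u v huv)
    rw [hS] at h
    rw [hB]
    gcongr
    have h0 : 0 ≤ l / 2 - l ^ 2 / 8 := by nlinarith
    nlinarith
  let C : V → Finset (Finset V) := fun v =>
    Finset.powersetCard K (Set.toFinite (nbhd G 2 v)).toFinset
  have hC : ∀ v, ((C v).card : ℝ) ≤ (D + D * D : ℝ) ^ K := fun v => by
    have h1 : (C v).card ≤ (D + D * D) ^ K := by
      rw [Finset.card_powersetCard, ← Set.ncard_eq_toFinset_card _ _]
      exact (Nat.choose_le_pow _ _).trans (Nat.pow_le_pow_left (ncard_nbhd_two_le G hD v) _)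
    exact_mod_cast h1
  have hsub : (Finset.univ.filter fun A : Finset V =>
      ∃ v, K ≤ {u | u ∈ nbhd G 2 v ∧ (degIn G u ↑A : ℝ) < T}.ncard) ⊆
      Finset.univ.biUnion fun v => (C v).biUnion F := by
    intro A hA
    obtain ⟨v, hv⟩ := (Finset.mem_filter.1 hA).2
    rw [Set.ncard_eq_toFinset_card _ (Set.toFinite _)] at hv
    obtain ⟨S, hS, hSK⟩ := Finset.exists_subset_card_eq hv
    have hS' : ∀ u ∈ S, u ∈ nbhd G 2 v ∧ (degIn G u ↑A : ℝ) < T := fun u hu => by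
      simpa using hS hu
    simp only [Finset.mem_biUnion, Finset.mem_univ, true_and]
    refine ⟨v, S, Finset.mem_powersetCard.2 ⟨fun u hu => by simpa using (hS' u hu).1, hSK⟩,
      Finset.mem_filter.2 ⟨Finset.mem_univ _, ?_⟩⟩
    calc ((S.biUnion (fun u => G.neighborFinset u) ∩ A).card : ℝ)
        ≤ ((∑ u ∈ S, (G.neighborFinset u ∩ A).card : ℕ) : ℝ) := by
          rw [Finset.biUnion_inter]
          exact_mod_cast Finset.card_biUnion_le
      _ ≤ ∑ u ∈ S, T := by
          push_cast
          refine Finset.sum_le_sum fun u hu => ?_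
          rw [← Set.ncard_coe_finset, Finset.coe_inter, SimpleGraph.coe_neighborFinset]
          exact (hS' u hu).2.le
      _ = K * T := by rw [Finset.sum_const, hSK, nsmul_eq_mul]
  calc _ ≤ ((Finset.univ.biUnion fun v => (C v).biUnion F).card : ℝ) := by
        exact_mod_cast Finset.card_le_card hsub
    _ ≤ ∑ v : V, ∑ S ∈ C v, ((F S).card : ℝ) := by
        have h : (Finset.univ.biUnion fun v => (C v).biUnion F).card ≤
            ∑ v : V, ∑ S ∈ C v, (F S).card :=
          Finset.card_biUnion_le.trans (Finset.sum_le_sum fun v _ => Finset.card_biUnion_le)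
        exact_mod_cast h
    _ ≤ ∑ v : V, ∑ S ∈ C v, B := Finset.sum_le_sum fun v _ => Finset.sum_le_sum fun S hS =>
        hF S (Finset.mem_powersetCard.1 hS).2
    _ ≤ ∑ _v : V, (D + D * D : ℝ) ^ K * B := by
        refine Finset.sum_le_sum fun v _ => ?_
        rw [Finset.sum_const, nsmul_eq_mul]
        have : 0 ≤ B := by positivity
        gcongr
        exact hC v
    _ = _ := by
        rw [Finset.sum_const, nsmul_eq_mul, Finset.card_univ, mul_assoc]

theorem two_pow_le_succ_mul_card_bisections (V : Type*) [Fintype V] :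
    2 ^ Fintype.card V ≤ (Fintype.card V + 1) *
      (Finset.univ.filter (fun A : Finset V =>
        ((2 * A.card : ℤ) - (Fintype.card V : ℤ)).natAbs ≤ 1)).card := by
  have h1 : 2 ^ Fintype.card V ≤
      (Fintype.card V + 1) * (Fintype.card V).choose (Fintype.card V / 2) := by
    rw [← Nat.sum_range_choose]
    refine (Finset.sum_le_card_nsmul _ _ _ fun i _ => Nat.choose_le_middle i _).trans ?_
    simp
  refine h1.trans (Nat.mul_le_mul_left _ ?_)
  rw [← Finset.card_univ, ← Finset.card_powersetCard]
  refine Finset.card_le_card fun A hA => ?_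
  have h2 := (Finset.mem_powersetCard.1 hA).2
  have h3 := Finset.card_univ (α := V)
  simp only [Finset.mem_filter, Finset.mem_univ, true_and]
  omega

theorem unifOn_apply {β : Type*} (s : Finset (Finset β)) (E : Set (Finset β))
    [DecidablePred (· ∈ E)] :
    unifOn s E = (s.card : ℝ≥0∞)⁻¹ * (s.filter (· ∈ E)).card := by
  simp only [unifOn, Measure.smul_apply, Measure.finsetSum_apply, smul_eq_mul]
  congr 1
  rw [Finset.card_filter]
  push_cast
  refine Finset.sum_congr rfl fun b _ => ?_
  rw [Measure.dirac_apply' _ MeasurableSpace.measurableSet_top]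
  simp [Set.indicator_apply]

/-- The uniform measure of an event is at least one minus any bound for the proportion of
outcomes outside it. -/
theorem one_sub_ofReal_le_unifOn {β : Type*} {s : Finset (Finset β)} (hs : s.Nonempty)
    (E : Set (Finset β)) [DecidablePred (· ∈ E)] {r : ℝ}
    (hr : ((s.filter (· ∉ E)).card : ℝ) ≤ r * s.card) :
    1 - ENNReal.ofReal r ≤ unifOn s E := by
  have hs0 : (s.card : ℝ≥0∞) ≠ 0 := by exact_mod_cast hs.card_pos.ne'
  have hsum := Finset.card_filter_add_card_filter_not (s := s) (· ∈ E)
  rw [unifOn_apply, tsub_le_iff_right]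
  have h1 : ((s.filter (· ∉ E)).card : ℝ≥0∞) ≤ ENNReal.ofReal r * s.card := by
    have hspos : (0 : ℝ) < s.card := by exact_mod_cast hs.card_pos
    have hr0 : 0 ≤ r := nonneg_of_mul_nonneg_left ((Nat.cast_nonneg _).trans hr) hspos
    rw [← ENNReal.ofReal_natCast, ← ENNReal.ofReal_natCast, ← ENNReal.ofReal_mul hr0]
    exact ENNReal.ofReal_le_ofReal hr
  calc (1 : ℝ≥0∞) = (s.card : ℝ≥0∞)⁻¹ * s.card :=
        (ENNReal.inv_mul_cancel hs0 (ENNReal.natCast_ne_top _)).symm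
    _ = (s.card : ℝ≥0∞)⁻¹ * ((s.filter (· ∈ E)).card + (s.filter (· ∉ E)).card) := by
        rw [← hsum]
        push_cast
        rfl
    _ ≤ (s.card : ℝ≥0∞)⁻¹ * ((s.filter (· ∈ E)).card + ENNReal.ofReal r * s.card) := by
        gcongr
    _ = _ := by
        rw [mul_add, mul_left_comm, ENNReal.inv_mul_cancel hs0 (ENNReal.natCast_ne_top _),
          mul_one]

theorem unifOn_le_one {β : Type*} (s : Finset (Finset β)) (E : Set (Finset β)) :
    unifOn s E ≤ 1 := by
  classical
  rw [unifOn_apply]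
  calc (s.card : ℝ≥0∞)⁻¹ * (s.filter (· ∈ E)).card ≤ (s.card : ℝ≥0∞)⁻¹ * s.card := by
        gcongr
        exact Finset.filter_subset _ _
    _ ≤ 1 := ENNReal.inv_mul_le_one _

/-- Finite version of the main result: in a random bisection, with explicit probability, no second
neighbourhood contains `2 * K` degenerate vertices. -/
theorem one_sub_le_unifOn_bisections [Fintype V] (G : SimpleGraph V) {D : ℕ}
    (hD : ∀ v, deg G v ≤ D) {ε l p : ℝ} {n : ℕ} (hε : 0 < ε)
    (hl : l * (1 / 2 + ε / 5) = 4 * ε / 35) (hp : 0 ≤ p) (hp1 : p ≤ 1)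
    (hn : Fintype.card V ≤ n) (hd : ∀ v, (1 / 2 + ε / 5) * n * p ≤ deg G v)
    (hco : ∀ u v, u ≠ v → (G.neighborSet u ∩ G.neighborSet v).ncard ≤ 2) (K : ℕ) :
    1 - ENNReal.ofReal (2 * (n + 1) * n * (D + D * D) ^ K *
        Real.exp (K * (l * (1 / 2 + ε / 7) / 2 + l * K / 2 - l * ε / 70 * (n * p)))) ≤
      unifOn (Finset.univ.filter (fun A : Finset V =>
          ((2 * A.card : ℤ) - (Fintype.card V : ℤ)).natAbs ≤ 1))
        {A : Finset V | ∀ v : V,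
          ({u | u ∈ nbhd G 2 v ∧
              ((degIn G u ↑A : ℝ) < (1 / 2 + ε / 7) * A.card * p ∨
                (degIn G u (↑A : Set V)ᶜ : ℝ) <
                  (1 / 2 + ε / 7) * ((Fintype.card V : ℝ) - A.card) * p)}).ncard < 2 * K} := by
  classical
  have hl0 : 0 ≤ l := by
    by_contra h
    push Not at h
    nlinarith
  have hl4 : l ≤ 4 := by
    by_contra h
    push Not at h
    nlinarith
  set T : ℝ := (1 / 2 + ε / 7) * ((n + 1) / 2) * p with hT
  set P : Finset V → Prop := fun A =>
    ∃ v, K ≤ {u | u ∈ nbhd G 2 v ∧ (degIn G u ↑A : ℝ) < T}.ncard with hP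
  set s := Finset.univ.filter (fun A : Finset V =>
    ((2 * A.card : ℤ) - (Fintype.card V : ℤ)).natAbs ≤ 1) with hs
  have hcount := card_filter_exists_le_ncard_degIn_lt G hD hd hco T K hl0 hl4
  have hcompl : (Finset.univ.filter fun A : Finset V => P Aᶜ).card =
      (Finset.univ.filter P).card :=
    Finset.card_bij' (fun A _ => Aᶜ) (fun A _ => Aᶜ) (by simp) (by simp) (by simp) (by simp)
  have hbis := two_pow_le_succ_mul_card_bisections V
  rw [← hs] at hbis
  have hs0 : s.Nonempty := by
    rw [Finset.nonempty_iff_ne_empty]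
    intro h
    rw [h] at hbis
    simp at hbis
  have hbis' : (2 : ℝ) ^ Fintype.card V ≤ (n + 1) * s.card := by
    have h : (2 : ℝ) ^ Fintype.card V ≤ (Fintype.card V + 1) * s.card := by exact_mod_cast hbis
    refine h.trans ?_
    gcongr
  have hexp : l * T - (l / 2 - l ^ 2 / 8) * ((1 / 2 + ε / 5) * n * p - K) ≤
      l * (1 / 2 + ε / 7) / 2 + l * K / 2 - l * ε / 70 * (n * p) := by
    have h1 : l ^ 2 / 8 * ((1 / 2 + ε / 5) * n * p) = l / 8 * (4 * ε / 35) * (n * p) := by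
      rw [← hl]; ring
    have h2 : 0 ≤ l * (1 / 2 + ε / 7) / 2 * (1 - p) :=
      mul_nonneg (by positivity) (by linarith)
    have h3 : 0 ≤ l ^ 2 / 8 * (K : ℝ) := by positivity
    rw [hT]
    nlinarith [mul_nonneg hl0 (hp), mul_nonneg hl0 hε.le]
  refine one_sub_ofReal_le_unifOn hs0 _ ?_
  have hsub : s.filter (· ∉ {A : Finset V | ∀ v : V,
          ({u | u ∈ nbhd G 2 v ∧
              ((degIn G u ↑A : ℝ) < (1 / 2 + ε / 7) * A.card * p ∨
                (degIn G u (↑A : Set V)ᶜ : ℝ) <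
                  (1 / 2 + ε / 7) * ((Fintype.card V : ℝ) - A.card) * p)}).ncard < 2 * K}) ⊆
      Finset.univ.filter P ∪ Finset.univ.filter fun A : Finset V => P Aᶜ := by
    intro A hA
    obtain ⟨hAs, hA⟩ := Finset.mem_filter.1 hA
    have hAs := (Finset.mem_filter.1 hAs).2
    simp only [Set.mem_ofPred_eq, not_forall, not_lt] at hA
    obtain ⟨v, hv⟩ := hA
    have hn' : (Fintype.card V : ℝ) ≤ n := by exact_mod_cast hn
    have ha1 : (A.card : ℝ) ≤ (n + 1) / 2 := by
      have h : 2 * A.card ≤ Fintype.card V + 1 := by omega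
      have h' : (2 * A.card : ℝ) ≤ Fintype.card V + 1 := by exact_mod_cast h
      linarith
    have ha2 : (Fintype.card V : ℝ) - A.card ≤ (n + 1) / 2 := by
      have h : Fintype.card V ≤ 2 * A.card + 1 := by omega
      have h' : (Fintype.card V : ℝ) ≤ 2 * A.card + 1 := by exact_mod_cast h
      linarith
    have hle : 2 * K ≤ {u | u ∈ nbhd G 2 v ∧ (degIn G u ↑A : ℝ) < T}.ncard +
        {u | u ∈ nbhd G 2 v ∧ (degIn G u ↑Aᶜ : ℝ) < T}.ncard := by
      refine hv.trans ((Set.ncard_le_ncard ?_ (Set.toFinite _)).trans (Set.ncard_union_le _ _))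
      rintro u ⟨hu, h | h⟩
      · refine Or.inl ⟨hu, h.trans_le ?_⟩
        rw [hT]
        gcongr
      · refine Or.inr ⟨hu, ?_⟩
        rw [Finset.coe_compl]
        refine h.trans_le ?_
        rw [hT]
        gcongr
    simp only [Finset.mem_union, Finset.mem_filter, Finset.mem_univ, true_and, hP]
    by_contra! h
    have := h.1 v
    have := h.2 v
    omega
  have hn0 : (0 : ℝ) ≤ Fintype.card V := Nat.cast_nonneg _
  calc _ ≤ ((Finset.univ.filter P ∪
          Finset.univ.filter fun A : Finset V => P Aᶜ).card : ℝ) := by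
        exact_mod_cast Finset.card_le_card hsub
    _ ≤ (Finset.univ.filter P).card + (Finset.univ.filter fun A : Finset V => P Aᶜ).card := by
        exact_mod_cast Finset.card_union_le _ _
    _ = 2 * (Finset.univ.filter P).card := by rw [hcompl]; ring
    _ ≤ 2 * (n * (D + D * D : ℝ) ^ K * ((n + 1) * s.card *
          Real.exp (K * (l * (1 / 2 + ε / 7) / 2 + l * K / 2 - l * ε / 70 * (n * p))))) := by
        refine mul_le_mul_of_nonneg_left (hcount.trans ?_) zero_le_two
        gcongr
    _ = _ := by ring

theorem statement_11 (ε : ℝ) (hε : 0 < ε) :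
    ∃ L : ℕ, 0 < L ∧
      ∀ (p₁ : ℕ → ℝ) (Vt : ℕ → Type) [∀ n, Fintype (Vt n)]
        (G : ∀ n : ℕ, SimpleGraph (Vt n)),
        (∀ n : ℕ, Real.log n / (3 * n) ≤ p₁ n) →
        (∀ n : ℕ, p₁ n ≤ 10 * (Real.log n) ^ 2 / n) →
        (∀ n : ℕ, (n : ℝ) - 2 * n / (Real.log n) ^ 2 ≤ Fintype.card (Vt n)) →
        (∀ n : ℕ, Fintype.card (Vt n) ≤ n) →
        (∀ (n : ℕ) (v : Vt n), (deg (G n) v : ℝ) ≤ (Real.log n) ^ 3) →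
        (∀ (n : ℕ) (v : Vt n), (1 / 2 + ε / 5) * n * p₁ n ≤ (deg (G n) v : ℝ)) →
        (∀ (n : ℕ) (u v : Vt n), u ≠ v →
          ((G n).neighborSet u ∩ (G n).neighborSet v).ncard ≤ 2) →
        Tendsto (fun n : ℕ =>
          unifOn (Finset.univ.filter (fun A : Finset (Vt n) =>
              ((2 * A.card : ℤ) - (Fintype.card (Vt n) : ℤ)).natAbs ≤ 1))
            {A : Finset (Vt n) | ∀ v : Vt n,
              ({u | u ∈ nbhd (G n) 2 v ∧
                  ((degIn (G n) u ↑A : ℝ) < (1 / 2 + ε / 7) * A.card * p₁ n ∨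
                    (degIn (G n) u (↑A : Set (Vt n))ᶜ : ℝ) <
                      (1 / 2 + ε / 7) * ((Fintype.card (Vt n) : ℝ) - A.card) * p₁ n)}).ncard
                < L})
          atTop (nhds 1) := by
  obtain ⟨l, hl⟩ : ∃ l : ℝ, l * (1 / 2 + ε / 5) = 4 * ε / 35 :=
    ⟨4 * ε / 35 / (1 / 2 + ε / 5), div_mul_cancel₀ _ (by positivity)⟩
  have hl0 : 0 < l := by
    by_contra h
    push Not at h
    nlinarith
  obtain ⟨K, hK⟩ := exists_nat_ge (3 / (l * ε / 210))
  have hc : 0 < l * ε / 210 := by positivity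
  rw [div_le_iff₀ hc] at hK
  have hK0 : 0 < K := by
    rcases Nat.eq_zero_or_pos K with rfl | h
    · norm_num at hK
    · exact h
  refine ⟨2 * K, by omega, ?_⟩
  intro p₁ Vt _ G hp hp' _ hcard hmax hmin hco
  set C : ℝ := l * (1 / 2 + ε / 7) / 2 + l * K / 2 with hC
  have hlog : ∀ k : ℕ, Tendsto (fun n : ℕ => Real.log n ^ k / n) atTop (nhds 0) := fun k =>
    ((Real.isLittleO_pow_log_id_atTop (n := k)).tendsto_div_nhds_zero).comp
      tendsto_natCast_atTop_atTop
  have hr : Tendsto (fun n : ℕ => ENNReal.ofReal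
      (4 * 2 ^ K * Real.exp (K * C) * (Real.log n ^ (6 * K) / n))) atTop (nhds 0) := by
    have h := (hlog (6 * K)).const_mul (4 * 2 ^ K * Real.exp (K * C))
    rw [mul_zero] at h
    simpa using ENNReal.tendsto_ofReal h
  have hlow := ENNReal.Tendsto.sub (tendsto_const_nhds (x := (1 : ℝ≥0∞)) (f := atTop)) hr
    (Or.inl ENNReal.one_ne_top)
  rw [tsub_zero] at hlow
  refine tendsto_of_tendsto_of_tendsto_of_le_of_le' hlow tendsto_const_nhds ?_
    (Eventually.of_forall fun n => unifOn_le_one _ _)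
  have hp1 : ∀ᶠ n : ℕ in atTop, p₁ n ≤ 1 := by
    have h := (hlog 2).const_mul 10
    rw [mul_zero] at h
    filter_upwards [h.eventually (gt_mem_nhds one_pos)] with n hn
    refine (hp' n).trans ?_
    rw [mul_div_assoc]
    exact hn.le
  filter_upwards [hp1, eventually_ge_atTop 3] with n hpn hn3
  have hn3' : (3 : ℝ) ≤ n := by exact_mod_cast hn3
  have hn0 : (0 : ℝ) < n := by linarith
  have hlog1 : 1 ≤ Real.log n := by
    rw [Real.le_log_iff_exp_le hn0]
    linarith [Real.exp_one_lt_d9]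
  have hp0 : 0 ≤ p₁ n := le_trans (by positivity) (hp n)
  refine le_trans ?_ (one_sub_le_unifOn_bisections (G n) (D := ⌊Real.log n ^ 3⌋₊)
    (fun v => Nat.le_floor (hmax n v)) hε hl hp0 hpn (hcard n) (hmin n) (hco n) K)
  refine tsub_le_tsub_left (ENNReal.ofReal_le_ofReal ?_) _
  set D : ℝ := (⌊Real.log n ^ 3⌋₊ : ℝ) with hD
  have hD0 : 0 ≤ D := Nat.cast_nonneg _
  have hD1 : D ≤ Real.log n ^ 3 := Nat.floor_le (by positivity)
  have hDD : D + D * D ≤ 2 * Real.log n ^ 6 := by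
    have h1 : (1 : ℝ) ≤ Real.log n ^ 3 := one_le_pow₀ hlog1
    nlinarith
  have hnp : Real.log n / 3 ≤ n * p₁ n := by
    have h := mul_le_mul_of_nonneg_left (hp n) hn0.le
    refine le_trans (le_of_eq ?_) h
    field_simp
  have hexp : Real.exp (K * (C - l * ε / 70 * (n * p₁ n))) ≤ Real.exp (K * C) / n ^ 3 := by
    have h1 : (n : ℝ) ^ 3 = Real.exp (3 * Real.log n) := by
      rw [mul_comm, Real.exp_mul, Real.exp_log hn0]
      norm_cast
    rw [h1, ← Real.exp_sub]
    refine Real.exp_le_exp.2 ?_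
    have h2 : (K : ℝ) * (l * ε / 70) * (Real.log n / 3) ≤ K * (l * ε / 70) * (n * p₁ n) := by
      gcongr
    have h3 := mul_le_mul_of_nonneg_right hK (zero_le_one.trans hlog1)
    nlinarith
  calc 2 * ((n : ℝ) + 1) * n * (D + D * D) ^ K * Real.exp (K * (C - l * ε / 70 * (n * p₁ n)))
      ≤ 2 * ((n : ℝ) + n) * n * (2 * Real.log n ^ 6) ^ K * (Real.exp (K * C) / n ^ 3) := by
        gcongr
        linarith
    _ = 4 * 2 ^ K * Real.exp (K * C) * (Real.log n ^ (6 * K) / n) := by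
        rw [mul_pow, ← pow_mul]
        field_simp
        ring

end
end RGP
end

section
/- Let ε > 0 be a constant and consider the random graph process {G_i} on n vertices. There exist positive constants δ_t(ε), δ_a(ε), and K(ε) such that asymptotically almost surely, for every integer m ≥ ((1+ε)/4)·n·log n, the graph obtained from G_m by deleting all isolated vertices is (1/2 − ε, δ_t, 1, δ_a, K)-resilient with respect to containing a perfect matching. -/
open MeasureTheory Filter ENNReal

namespace RGP

noncomputable section

variable {V : Type*}

section Core
open scoped Classical
open Finset

/-- Ordered count of adjacent pairs in `X × Y`. -/
noncomputable def pairCount (G : SimpleGraph V) (X Y : Finset V) : ℕ :=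
  #{p ∈ X ×ˢ Y | G.Adj p.1 p.2}

theorem pairCount_eq_sum (G : SimpleGraph V) (X Y : Finset V) :
    pairCount G X Y = ∑ x ∈ X, #{y ∈ Y | G.Adj x y} := by
  unfold pairCount
  simp only [card_filter, sum_product]

theorem pairCount_mono (G : SimpleGraph V) {X X' Y Y' : Finset V} (hX : X ⊆ X') (hY : Y ⊆ Y') :
    pairCount G X Y ≤ pairCount G X' Y' :=
  card_le_card (filter_subset_filter _ (product_subset_product hX hY))

variable {ι : Type*} [Fintype V]

/-- A host graph `G` with a subgraph `G'` living on `W`, where `T` are the tiny vertices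
and `A ⊇ T` all the exceptional ones. -/
structure RobustPair (G G' : SimpleGraph V) (W A T : Finset V) (ε c c₀ D : ℝ) (C : ℕ) : Prop where
  le : G' ≤ G
  mem_of_adj : ∀ u v, G'.Adj u v → u ∈ W
  card_W : (1 - c) * Fintype.card V ≤ #W
  card_A : (#A : ℝ) ≤ c * Fintype.card V
  T_subset : T ⊆ A
  tiny : ∀ v ∈ T, ∃ w, G'.Adj v w
  atyp : ∀ v ∈ A, v ∉ T → 8 * C + 1 ≤ #{w | G'.Adj v w}
  typ_del : ∀ v ∈ W, v ∉ A → (#{w | G.Adj v w ∧ ¬ G'.Adj v w} : ℝ) ≤ (1 / 2 - ε / 2) * D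
  typ : ∀ v ∈ W, v ∉ A → D / 4 + 1 ≤ (#{w | G'.Adj v w} : ℝ)
  dense : ∀ X Y : Finset V, Disjoint X Y → c * Fintype.card V ≤ #X → c * Fintype.card V ≤ #Y →
    (1 - ε / 4) * (D / Fintype.card V * (#X * #Y)) ≤ pairCount G X Y
  sparse : ∀ Z : Finset V, (#Z : ℝ) ≤ c₀ * Fintype.card V → (pairCount G Z Z : ℝ) ≤ D / 32 * #Z
  verySparse : ∀ Z : Finset V, #Z ≤ (8 * C + 1) * #A → pairCount G Z Z ≤ C * #Z
  tiny_adj : ∀ u ∈ T, ∀ v ∈ T, ¬ G.Adj u v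
  tiny_two : ∀ u ∈ T, ∀ v ∈ T, u ≠ v → ∀ a, G.Adj u a → G.Adj a v → False
  tiny_four : ∀ u ∈ T, ∀ v ∈ T, ∀ a b c, [u, a, b, c, v].Nodup →
    G.Adj u a → G.Adj a b → G.Adj b c → G.Adj c v → False

variable {G G' : SimpleGraph V} {W A T : Finset V} {ε c c₀ D : ℝ} {C : ℕ}

theorem RobustPair.card_le_of_separated (h : RobustPair G G' W A T ε c c₀ D C) (hε : 0 < ε)
    (hε' : ε ≤ 1 / 2) (hD : 0 < D) (hc : 0 < c) (hV : 0 < Fintype.card V)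
    {X Y : Finset V} (hX : X ⊆ W) (hXY : Disjoint X Y)
    (hno : ∀ x ∈ X, ∀ y ∈ Y, ¬ G'.Adj x y) (hXc : 2 * c * Fintype.card V ≤ #X)
    (hYc : c * Fintype.card V ≤ #Y) :
    (#Y : ℝ) ≤ (1 / 2 - ε / 4) * Fintype.card V := by
  set n : ℝ := (Fintype.card V : ℝ) with hn
  have hn0 : 0 < n := by rw [hn]; exact_mod_cast hV
  have hX' : (#X : ℝ) ≤ #(X \ A) + #A := by
    exact_mod_cast (card_le_card_sdiff_add_card (s := X) (t := A))
  have hXA : c * n ≤ #(X \ A) := by linarith [h.card_A]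
  have h1 := h.dense (X \ A) Y (disjoint_of_subset_left sdiff_subset hXY) hXA hYc
  rw [← hn] at h1
  have h2 : (pairCount G (X \ A) Y : ℝ) ≤ #(X \ A) * ((1 / 2 - ε / 2) * D) := by
    rw [pairCount_eq_sum]; push_cast
    rw [← nsmul_eq_mul]
    apply sum_le_card_nsmul
    intro x hx
    rw [Finset.mem_sdiff] at hx
    refine le_trans ?_ (h.typ_del x (hX hx.1) hx.2)
    norm_cast
    apply card_le_card
    intro y hy
    simp only [mem_filter, mem_univ, true_and] at hy ⊢
    exact ⟨hy.2, hno x hx.1 y hy.1⟩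
  have hpos : 0 < (#(X \ A) : ℝ) := lt_of_lt_of_le (by positivity) hXA
  have h3 : (#(X \ A) * D) * ((1 - ε / 4) * (#Y / n)) ≤ (#(X \ A) * D) * (1 / 2 - ε / 2) := by
    calc _ = (1 - ε / 4) * (D / n * (#(X \ A) * #Y)) := by ring
      _ ≤ _ := h1.trans h2
      _ = _ := by ring
  have h4 := le_of_mul_le_mul_left h3 (by positivity)
  have h5 : (#Y : ℝ) / n ≤ 1 / 2 - ε / 4 := by
    by_contra! hcon
    nlinarith
  rwa [div_le_iff₀ hn0] at h5

variable {S : Finset V} {f : V → ι}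

theorem RobustPair.card_image_le_of_giant (h : RobustPair G G' W A T ε c c₀ D C)
    (hD : 0 < D) (hC : 0 < C)
    (hf : ∀ u ∈ W \ S, ∀ v ∈ W \ S, G'.Adj u v → f u = f v) (l : ι)
    (hsize : (#{v ∈ W \ S | f v ≠ l} : ℝ) + #S ≤ c₀ * Fintype.card V) :
    #((W \ S).image f) ≤ #S + 1 := by
  set U : Finset V := {v ∈ W \ S | f v ≠ l} with hU
  have hUW : ∀ v ∈ U, v ∈ W ∧ v ∉ S ∧ f v ≠ l := by
    intro v hv; simp only [hU, mem_filter, Finset.mem_sdiff] at hv; tauto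
  have hmem : ∀ v ∈ U, ∀ w, G'.Adj v w → w ∉ S → w ∈ U := by
    intro v hv w hvw hw
    have h1 := hUW v hv
    have hwW := h.mem_of_adj w v hvw.symm
    simp only [hU, mem_filter, Finset.mem_sdiff]
    refine ⟨⟨hwW, hw⟩, ?_⟩
    rw [← hf v (by simp [h1]) w (by simp [hw, hwW]) hvw]; exact h1.2.2
  set T0 : Finset V := {v ∈ U | v ∈ T ∧ ∀ w, G'.Adj v w → w ∈ S} with hT0
  have hT0' : ∀ v ∈ T0, v ∈ U ∧ v ∈ T ∧ ∀ w, G'.Adj v w → w ∈ S := by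
    intro v hv; simpa only [hT0, mem_filter] using hv
  choose! φ hφ using h.tiny
  set St := T0.image φ with hSt
  have hStS : St ⊆ S := by
    intro x hx
    obtain ⟨v, hv, rfl⟩ := mem_image.1 hx
    exact (hT0' v hv).2.2 _ (hφ v (hT0' v hv).2.1)
  have hStc : #St = #T0 := by
    apply card_image_of_injOn
    intro u hu v hv huv
    by_contra hne
    have hu := (hT0' u hu).2.1
    have hv := (hT0' v hv).2.1
    refine h.tiny_two u hu v hv hne (φ u) (h.le (hφ u hu)) ?_
    rw [show φ u = φ v from huv]
    exact (h.le (hφ v hv)).symm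
  set S' := S \ St with hS'
  have hScard : #S = #S' + #T0 := by
    rw [← hStc, hS', card_sdiff_add_card_eq_card hStS]
  set U' := U \ T0 with hU'
  set NT := U' \ T with hNT
  have hex : ∀ v, v ∈ U' ∩ T → ∃ w, G'.Adj v w ∧ w ∈ NT ∧ f v = f w := by
    intro v hv
    simp only [hU', mem_inter, Finset.mem_sdiff] at hv
    obtain ⟨⟨hvU, hvT0⟩, hvT⟩ := hv
    have : ∃ w, G'.Adj v w ∧ w ∉ S := by
      by_contra! hcon
      exact hvT0 (by simp only [hT0, mem_filter]; exact ⟨hvU, hvT, hcon⟩)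
    obtain ⟨w, hvw, hwS⟩ := this
    have hwU := hmem v hvU w hvw hwS
    have hwT : w ∉ T := fun hwT => h.tiny_adj v hvT w hwT (h.le hvw)
    refine ⟨w, hvw, ?_, hf v (by simp [hUW v hvU]) w (by simp [hUW w hwU]) hvw⟩
    simp only [hNT, hU', Finset.mem_sdiff]
    exact ⟨⟨hwU, fun hw => hwT (hT0' w hw).2.1⟩, hwT⟩
  choose! ψ hψ using hex
  have hU'T : #(U' ∩ T) ≤ #NT := by
    apply card_le_card_of_injOn ψ (fun v hv => (hψ v hv).2.1)
    intro u hu v hv huv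
    by_contra hne
    refine h.tiny_two u (mem_inter.1 hu).2 v (mem_inter.1 hv).2 hne (ψ u)
      (h.le (hψ u hu).1) ?_
    rw [show ψ u = ψ v from huv]
    exact (h.le (hψ v hv).1).symm
  have hU'c : #U' ≤ 2 * #NT := by
    have : #(U' ∩ T) + #NT = #U' := card_inter_add_card_sdiff U' T
    omega
  set Y := U' ∪ S' with hY
  have hYc : #Y ≤ 2 * #NT + #S' := (card_union_le _ _).trans (by omega)
  have hNTU : ∀ v ∈ NT, v ∈ U ∧ v ∉ T0 ∧ v ∉ T := by
    intro v hv; simp only [hNT, hU', Finset.mem_sdiff] at hv; tauto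
  have hNTY : NT ⊆ Y := fun v hv => mem_union_left _ (sdiff_subset hv)
  have hdeg : ∀ v ∈ NT, #{w | G'.Adj v w} ≤ #{y ∈ Y | G'.Adj v y} + 1 := by
    intro v hv
    obtain ⟨hvU, hvT0, hvT⟩ := hNTU v hv
    have hvS := (hUW v hvU).2.1
    have hsub : ({w | G'.Adj v w} : Finset V) ⊆
        {y ∈ Y | G'.Adj v y} ∪ {y ∈ St | G'.Adj v y} := by
      intro w hw
      simp only [mem_filter, mem_univ, true_and] at hw
      simp only [mem_union, mem_filter, hw, and_true, hY, hU', hS', Finset.mem_sdiff]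
      by_cases hwS : w ∈ S
      · tauto
      · left; left
        refine ⟨hmem v hvU w hw hwS, fun hw0 => ?_⟩
        exact hvS ((hT0' w hw0).2.2 v hw.symm)
    refine (card_le_card hsub).trans ((card_union_le _ _).trans ?_)
    gcongr
    rw [card_le_one]
    intro a ha b hb
    simp only [mem_filter, hSt, mem_image] at ha hb
    obtain ⟨⟨t, ht, rfl⟩, hva⟩ := ha
    obtain ⟨⟨t', ht', rfl⟩, hvb⟩ := hb
    by_contra hne
    obtain ⟨htU, htT, htS⟩ := hT0' t ht
    obtain ⟨htU', htT', htS'⟩ := hT0' t' ht'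
    have e1 := hφ t htT
    have e2 := hφ t' htT'
    have m1 := htS _ e1
    have m2 := htS' _ e2
    have k1 := (hUW t htU).2.1
    have k2 := (hUW t' htU').2.1
    refine h.tiny_four t htT t' htT' (φ t) v (φ t') ?_ (h.le e1) (h.le hva.symm) (h.le hvb)
      (h.le e2.symm)
    simp only [List.nodup_cons, List.mem_cons, List.not_mem_nil, or_false, not_or,
      not_false_eq_true, List.nodup_nil, and_true]
    exact ⟨⟨e1.ne, ne_of_mem_of_not_mem htT hvT, (ne_of_mem_of_not_mem m2 k1).symm,
        fun hh => hne (by rw [hh])⟩,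
      ⟨ne_of_mem_of_not_mem m1 hvS, hne, ne_of_mem_of_not_mem m1 k2⟩,
      ⟨hvb.ne, (ne_of_mem_of_not_mem htT' hvT).symm⟩, e2.ne.symm⟩
  have hYsub : (#Y : ℝ) ≤ c₀ * Fintype.card V := by
    have : #Y ≤ #U + #S := (card_union_le _ _).trans
      (add_le_add (card_le_card sdiff_subset) (card_le_card sdiff_subset))
    have : (#Y : ℝ) ≤ #U + #S := by exact_mod_cast this
    linarith
  have hmonoG : ∀ v, #{y ∈ Y | G'.Adj v y} ≤ #{y ∈ Y | G.Adj v y} := by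
    intro v
    apply card_le_card
    intro y hy
    rw [mem_filter] at hy ⊢
    exact ⟨hy.1, h.le hy.2⟩
  have htyp : 8 * #(NT \ A) ≤ #Y := by
    have h1 : (#(NT \ A) : ℝ) * (D / 4) ≤ pairCount G (NT \ A) Y := by
      rw [pairCount_eq_sum]; push_cast
      rw [← nsmul_eq_mul]
      apply card_nsmul_le_sum
      intro v hv
      rw [Finset.mem_sdiff] at hv
      have a1 := h.typ v (hUW v (hNTU v hv.1).1).1 hv.2
      have a2 : (#{w | G'.Adj v w} : ℝ) ≤ #{y ∈ Y | G'.Adj v y} + 1 := by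
        exact_mod_cast hdeg v hv.1
      have a3 : (#{y ∈ Y | G'.Adj v y} : ℝ) ≤ #{y ∈ Y | G.Adj v y} := by
        exact_mod_cast hmonoG v
      linarith
    have h2 : (pairCount G (NT \ A) Y : ℝ) ≤ pairCount G Y Y := by
      exact_mod_cast pairCount_mono G (sdiff_subset.trans hNTY) subset_rfl
    have h3 := h.sparse Y hYsub
    have h4 : D * (8 * #(NT \ A)) ≤ D * #Y := by linarith
    exact_mod_cast le_of_mul_le_mul_left h4 hD
  have hatyp : 8 * #(NT ∩ A) ≤ #Y := by
    have hch : ∀ v, v ∈ NT ∩ A → ∃ N : Finset V, N ⊆ {y ∈ Y | G'.Adj v y} ∧ #N = 8 * C := by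
      intro v hv
      rw [mem_inter] at hv
      apply exists_subset_card_eq
      have := hdeg v hv.1
      have := h.atyp v hv.2 (hNTU v hv.1).2.2
      omega
    choose! N hN hNc using hch
    set Z := (NT ∩ A) ∪ (NT ∩ A).biUnion N with hZ
    have hZc : #Z ≤ (8 * C + 1) * #(NT ∩ A) := by
      refine (card_union_le _ _).trans ?_
      have := card_biUnion_le_card_mul (NT ∩ A) N (8 * C) (fun v hv => (hNc v hv).le)
      linarith
    have hZY : Z ⊆ Y := by
      apply union_subset (inter_subset_left.trans hNTY)
      apply biUnion_subset.2
      intro v hv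
      exact (hN v hv).trans (filter_subset _ _)
    have h1 := h.verySparse Z (hZc.trans (Nat.mul_le_mul_left _ (card_le_card inter_subset_right)))
    have h2 : #(NT ∩ A) * (8 * C) ≤ pairCount G Z Z := by
      refine le_trans ?_ (pairCount_mono G (subset_union_left : NT ∩ A ⊆ Z) subset_rfl)
      rw [pairCount_eq_sum, ← smul_eq_mul]
      apply card_nsmul_le_sum
      intro v hv
      rw [← hNc v hv]
      apply card_le_card
      intro y hy
      rw [mem_filter]
      exact ⟨mem_union_right _ (mem_biUnion.2 ⟨v, hv, hy⟩),
        h.le (mem_filter.1 (hN v hv hy)).2⟩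
    have h3 : C * (8 * #(NT ∩ A)) ≤ C * #Y := by
      have := Nat.mul_le_mul_left C (card_le_card hZY)
      linarith
    exact Nat.le_of_mul_le_mul_left h3 hC
  have hNTc : #NT ≤ #S' := by
    have := card_inter_add_card_sdiff NT A
    omega
  have himg : (W \ S).image f ⊆ {l} ∪ (T0.image f ∪ NT.image f) := by
    intro x hx
    obtain ⟨v, hv, rfl⟩ := mem_image.1 hx
    by_cases hvl : f v = l
    · simp [hvl]
    have hvU : v ∈ U := by rw [hU, mem_filter]; exact ⟨hv, hvl⟩
    refine mem_union_right _ ?_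
    by_cases hv0 : v ∈ T0
    · exact mem_union_left _ (mem_image_of_mem _ hv0)
    refine mem_union_right _ ?_
    have hvU' : v ∈ U' := Finset.mem_sdiff.2 ⟨hvU, hv0⟩
    by_cases hvT : v ∈ T
    · have := hψ v (mem_inter.2 ⟨hvU', hvT⟩)
      rw [this.2.2]
      exact mem_image_of_mem _ this.2.1
    · exact mem_image_of_mem _ (Finset.mem_sdiff.2 ⟨hvU', hvT⟩)
  have := card_le_card himg
  have := card_union_le {l} (T0.image f ∪ NT.image f)
  have := card_union_le (T0.image f) (NT.image f)
  have := card_image_le (s := T0) (f := f)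
  have := card_image_le (s := NT) (f := f)
  rw [card_singleton] at *
  omega

theorem RobustPair.dichotomy (h : RobustPair G G' W A T ε c c₀ D C) (hε : 0 < ε)
    (hε' : ε ≤ 1 / 2) (hD : 0 < D) (hc : 0 < c) (hV : 0 < Fintype.card V)
    (hf : ∀ u ∈ W \ S, ∀ v ∈ W \ S, G'.Adj u v → f u = f v) (P : ι → Prop)
    [DecidablePred P]
    (hX : 2 * c * Fintype.card V ≤ #{v ∈ W \ S | P (f v)})
    (hY : c * Fintype.card V ≤ #{v ∈ W \ S | ¬ P (f v)}) :
    (#{v ∈ W \ S | ¬ P (f v)} : ℝ) ≤ (1 / 2 - ε / 4) * Fintype.card V := by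
  refine h.card_le_of_separated hε hε' hD hc hV ((filter_subset _ _).trans sdiff_subset)
    (disjoint_filter_filter_not _ _ _) ?_ hX hY
  intro x hx y hy hxy
  rw [mem_filter] at hx hy
  rw [← hf x hx.1 y hy.1 hxy] at hy
  exact hy.2 hx.2

theorem RobustPair.exists_giant (h : RobustPair G G' W A T ε c c₀ D C) (hε : 0 < ε)
    (hε' : ε ≤ 1 / 2) (hD : 0 < D) (hc : 0 < c) (hV : 0 < Fintype.card V)
    (hf : ∀ u ∈ W \ S, ∀ v ∈ W \ S, G'.Adj u v → f u = f v)
    (hcs : c ≤ ε / 64) (hS : (#S : ℝ) ≤ ε / 4 * Fintype.card V) :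
    ∃ l, (#{v ∈ W \ S | f v ≠ l} : ℝ) < 2 * c * Fintype.card V := by
  set n : ℝ := (Fintype.card V : ℝ) with hn
  have hn0 : 0 < n := by rw [hn]; exact_mod_cast hV
  have ht : (1 - c) * n - ε / 4 * n ≤ #(W \ S) := by
    have : (#W : ℝ) ≤ #(W \ S) + #S := by
      exact_mod_cast (card_le_card_sdiff_add_card (s := W) (t := S))
    linarith [h.card_W]
  have hsplit : ∀ (P : ι → Prop) [DecidablePred P],
      (#{v ∈ W \ S | P (f v)} : ℝ) + #{v ∈ W \ S | ¬ P (f v)} = #(W \ S) := by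
    intro P _
    exact_mod_cast card_filter_add_card_filter_not (s := W \ S) (fun v => P (f v))
  have hcn : c * n ≤ ε / 64 * n := by gcongr
  have hεn : ε * n ≤ 1 / 2 * n := by gcongr
  have hcn0 : 0 < c * n := by positivity
  have hdich : ∀ (P : ι → Prop) [DecidablePred P], (#{v ∈ W \ S | P (f v)} : ℝ) < 2 * c * n ∨
      (#{v ∈ W \ S | ¬ P (f v)} : ℝ) < 2 * c * n := by
    intro P _
    by_contra! hcon
    have h1 := h.dichotomy hε hε' hD hc hV hf P hcon.1 (by linarith [hcon.2])
    have h2 := h.dichotomy hε hε' hD hc hV hf (fun l => ¬ P l) (by rw [← hn]; exact hcon.2) (by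
      simp only [not_not]; rw [← hn]; linarith [hcon.1])
    simp only [not_not] at h2
    have := hsplit P
    rw [← hn] at h1 h2
    nlinarith
  by_contra! hno
  have hsmall : ∀ L : Finset ι, (#{v ∈ W \ S | f v ∈ L} : ℝ) < 2 * c * n := by
    intro L
    induction L using Finset.induction_on with
    | empty => simp; positivity
    | insert a L ha ih =>
      refine (hdich (fun x => x ∈ insert a L)).resolve_right ?_
      have h1 := (hdich (fun x => x ≠ a)).resolve_left (not_lt.2 (hno a))
      have h3 : #{v ∈ W \ S | f v ∈ insert a L} ≤
          #{v ∈ W \ S | f v ∈ L} + #{v ∈ W \ S | ¬ f v ≠ a} := by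
        rw [← card_union_add_card_inter]
        refine le_add_right (card_le_card ?_)
        intro v hv
        simp only [mem_filter, mem_insert, mem_union, not_not] at hv ⊢
        tauto
      have h3' : (#{v ∈ W \ S | f v ∈ insert a L} : ℝ) ≤
          #{v ∈ W \ S | f v ∈ L} + #{v ∈ W \ S | ¬ f v ≠ a} := by exact_mod_cast h3
      have := hsplit (fun x => x ∈ insert a L)
      nlinarith
  have := hsmall ((W \ S).image f)
  rw [filter_true_of_mem (fun v hv => mem_image_of_mem f hv)] at this
  nlinarith

theorem RobustPair.card_image_le (h : RobustPair G G' W A T ε c c₀ D C) (hε : 0 < ε)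
    (hε' : ε ≤ 1 / 2) (hD : 0 < D) (hC : 0 < C) (hc : 0 < c) {c₁ : ℝ} (hc₁ : 0 < c₁)
    (hc₁' : c₁ ≤ c₀ / 2) (hc₁ε : c₁ ≤ ε / 4) (hcc₁ : c ≤ ε * c₁ / 64)
    (hn1 : 1 ≤ c * Fintype.card V) (hSW : S ⊆ W)
    (hf : ∀ u ∈ W \ S, ∀ v ∈ W \ S, G'.Adj u v → f u = f v) :
    #((W \ S).image f) ≤ #S + 1 := by
  have hV : 0 < Fintype.card V := by
    rcases Nat.eq_zero_or_pos (Fintype.card V) with h0 | h0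
    · rw [h0] at hn1; norm_num at hn1
    · exact h0
  set n : ℝ := (Fintype.card V : ℝ) with hn
  have hn0 : 0 < n := by rw [hn]; exact_mod_cast hV
  have hcε : c ≤ ε / 64 := by nlinarith
  rcases le_or_gt (#S : ℝ) (c₁ * n) with hS | hS
  · obtain ⟨l, hl⟩ := h.exists_giant (S := S) hε hε' hD hc hV hf hcε (hS.trans (by gcongr))
    refine h.card_image_le_of_giant hD hC hf l ?_
    have h1 : 2 * c ≤ c₁ := by nlinarith
    have h2 : 2 * c * n ≤ c₁ * n := by gcongr
    have h3 : c₁ * n ≤ c₀ / 2 * n := by gcongr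
    rw [← hn] at hl ⊢
    linarith
  by_contra! hcon
  set t := #(W \ S) with ht
  set L := (W \ S).image f with hL
  have htS : t + #S = #W := card_sdiff_add_card_eq_card hSW
  have hLt : #L ≤ t := Finset.card_image_le
  have htn : (t : ℝ) ≤ n := by rw [hn]; exact_mod_cast card_le_univ _
  have hfib : ∀ M : Finset ι, #{v ∈ W \ S | f v ∈ M} = ∑ l ∈ M, #{v ∈ W \ S | f v = l} := by
    intro M
    rw [card_eq_sum_card_fiberwise (s := {v ∈ W \ S | f v ∈ M}) (t := M) (f := f)
      (fun v hv => (mem_filter.1 hv).2)]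
    refine sum_congr rfl fun l hl => ?_
    congr 1; ext v; simp only [mem_filter]
    constructor
    · tauto
    · rintro ⟨h1, rfl⟩; tauto
  set Big := {l ∈ L | 2 / c₁ < (#{v ∈ W \ S | f v = l} : ℝ)} with hBig
  set Sm := {l ∈ L | ¬ 2 / c₁ < (#{v ∈ W \ S | f v = l} : ℝ)} with hSm
  have hLsplit : #Big + #Sm = #L := card_filter_add_card_filter_not _
  have hBigc : (#Big : ℝ) * (2 / c₁) ≤ n := by
    refine le_trans ?_ htn
    have h1 : (#Big : ℝ) * (2 / c₁) ≤ ∑ l ∈ Big, (#{v ∈ W \ S | f v = l} : ℝ) := by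
      rw [← nsmul_eq_mul]
      exact card_nsmul_le_sum _ _ _ (fun l hl => (mem_filter.1 hl).2.le)
    refine h1.trans ?_
    have := hfib Big
    have h2 : #{v ∈ W \ S | f v ∈ Big} ≤ t := card_le_card (filter_subset _ _)
    rw [this] at h2
    exact_mod_cast h2
  have hBigc' : (#Big : ℝ) ≤ c₁ * n / 2 := by
    rw [mul_div_assoc', div_le_iff₀ hc₁] at hBigc; linarith
  have hcon' : (#S : ℝ) + 1 < #Big + #Sm := by
    rw [← hLsplit] at hcon; exact_mod_cast hcon
  have hj := Nat.ceil_lt_add_one (a := 2 * c * n) (by positivity)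
  have hj' := Nat.le_ceil (2 * c * n)
  set j := ⌈2 * c * n⌉₊
  have h6 : 6 * c ≤ c₁ := by nlinarith
  have h6n : 6 * c * n ≤ c₁ * n := by gcongr
  have hjS : j ≤ #Sm := by
    have : (j : ℝ) ≤ #Sm := by linarith
    exact_mod_cast this
  obtain ⟨M, hMS, hMj⟩ := exists_subset_card_eq hjS
  have hX1 : (#{v ∈ W \ S | f v ∈ M} : ℝ) ≤ j * (2 / c₁) := by
    rw [hfib M]; push_cast
    rw [← hMj, ← nsmul_eq_mul]
    exact sum_le_card_nsmul _ _ _ (fun l hl => not_lt.1 (mem_filter.1 (hMS hl)).2)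
  have hX2 : (j : ℝ) ≤ #{v ∈ W \ S | f v ∈ M} := by
    rw [hfib M, ← hMj]
    norm_cast
    rw [card_eq_sum_ones]
    refine sum_le_sum fun l hl => ?_
    obtain ⟨v, hv, rfl⟩ := mem_image.1 (mem_filter.1 (hMS hl)).1
    exact card_pos.2 ⟨v, mem_filter.2 ⟨hv, rfl⟩⟩
  have hX3 : (j : ℝ) * (2 / c₁) ≤ 6 * ε / 64 * n := by
    have h1 : (j : ℝ) ≤ 3 * c * n := by linarith
    have h2 : 3 * c * n ≤ 3 * (ε * c₁ / 64) * n := by gcongr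
    calc (j : ℝ) * (2 / c₁) ≤ (3 * (ε * c₁ / 64) * n) * (2 / c₁) := by
          gcongr; exact h1.trans h2
      _ = _ := by field_simp; ring
  have hsp : (#{v ∈ W \ S | f v ∈ M} : ℝ) + #{v ∈ W \ S | ¬ f v ∈ M} = t := by
    rw [ht]
    exact_mod_cast card_filter_add_card_filter_not (s := W \ S) (fun v => f v ∈ M)
  have htl : (1 - c) * n ≤ 2 * t := by
    have h1 : #W ≤ 2 * t := by omega
    have h2 : (#W : ℝ) ≤ 2 * t := by exact_mod_cast h1
    exact h.card_W.trans h2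
  have hcn : c * n ≤ ε / 64 * n := by gcongr
  have hεn : ε * n ≤ 1 / 2 * n := by gcongr
  have hεn0 : 0 < ε * n := by positivity
  have hfin := h.dichotomy (S := S) (f := f) hε hε' hD hc hV hf (fun l => l ∈ M) (by
    rw [← hn]; linarith) (by rw [← hn]; linarith)
  rw [← hn] at hfin
  linarith

end Core

section Tutte

theorem ncard_oddComponents_le {X β : Type*} [Finite X] (K : SimpleGraph X) (g : X → β)
    (hg : ∀ x y, g x = g y → K.Reachable x y) :
    K.oddComponents.ncard ≤ (Set.range g).ncard := by
  refine Set.ncard_le_ncard_of_injOn (fun c => g c.out) (fun c _ => ⟨_, rfl⟩) ?_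
    (Set.finite_range g)
  intro c _ c' _ hcc
  rw [← c.out_eq, ← c'.out_eq]
  exact SimpleGraph.ConnectedComponent.sound (hg _ _ hcc)

/-- `G` has few components after deleting any vertex set, phrased through labellings that are
constant along the surviving edges. -/
def FewComponents (G : SimpleGraph V) : Prop :=
  ∀ (S : Set V) (f : V → Set V), (∀ u v, u ∉ S → v ∉ S → G.Adj u v → f u = f v) →
    (f '' Sᶜ).ncard ≤ S.ncard + 1

/-- `G` together with a new vertex joined to everything. -/
def addApex (G : SimpleGraph V) : SimpleGraph (Option V) where
  Adj x y := x ≠ y ∧ ∀ u v, x = some u → y = some v → G.Adj u v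
  symm := ⟨fun _ _ h => ⟨h.1.symm, fun u v hu hv => (h.2 v u hv hu).symm⟩⟩
  loopless := ⟨fun _ h => h.1 rfl⟩

theorem FewComponents.of_even [Finite V] {G : SimpleGraph V} (h : FewComponents G)
    (hV : Even (Nat.card V)) : ∃ M : G.Subgraph, M.IsPerfectMatching := by
  rw [SimpleGraph.tutte]
  intro S hS
  unfold SimpleGraph.IsTutteViolator at hS
  set K := ((⊤ : G.Subgraph).deleteVerts S).coe with hK
  let f : V → Set V := fun v => {w | ∃ hv hw, K.Reachable ⟨v, hv⟩ ⟨w, hw⟩}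
  have hmem : ∀ v, v ∈ ((⊤ : G.Subgraph).deleteVerts S).verts ↔ v ∉ S := by simp
  have h1 := h S f (by
    intro u v hu hv huv
    have hu' := (hmem u).2 hu
    have hv' := (hmem v).2 hv
    have hadj : K.Adj ⟨u, hu'⟩ ⟨v, hv'⟩ := by simp [hK, hu, hv, huv]
    ext w
    constructor
    · rintro ⟨_, hw, hr⟩; exact ⟨hv', hw, hadj.symm.reachable.trans hr⟩
    · rintro ⟨_, hw, hr⟩; exact ⟨hu', hw, hadj.reachable.trans hr⟩)
  have h2 := ncard_oddComponents_le K (fun x => f x.1) (by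
    rintro ⟨x, hx⟩ ⟨y, hy⟩ hxy
    have : y ∈ f y := ⟨hy, hy, SimpleGraph.Reachable.refl _⟩
    rw [← show f x = f y from hxy] at this
    exact this.2.2)
  have h3 : Set.range (fun x : ((⊤ : G.Subgraph).deleteVerts S).verts => f x.1) = f '' Sᶜ := by
    ext y
    simp only [Set.mem_range, Subtype.exists, Set.mem_image, Set.mem_compl_iff]
    constructor
    · rintro ⟨a, ha, rfl⟩; exact ⟨a, (hmem a).1 ha, rfl⟩
    · rintro ⟨a, ha, rfl⟩; exact ⟨a, (hmem a).2 ha, rfl⟩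
  rw [h3] at h2
  have h4 : K.oddComponents.ncard = S.ncard + 1 := by omega
  have h5 := SimpleGraph.odd_ncard_oddComponents K
  have h6 : Nat.card ((⊤ : G.Subgraph).deleteVerts S).verts + S.ncard = Nat.card V := by
    rw [Nat.card_coe_set_eq, show ((⊤ : G.Subgraph).deleteVerts S).verts = Sᶜ by ext; simp,
      add_comm]
    exact Set.ncard_add_ncard_compl S
  rw [h4] at h5
  rw [← h6] at hV
  rcases Nat.even_or_odd S.ncard with hs | hs
  · have a1 : Odd (S.ncard + 1) := hs.add_one
    exact (Nat.not_even_iff_odd.2 ((h5.1 a1).add_even hs)) hV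
  · have a1 : ¬ Odd (S.ncard + 1) := Nat.not_odd_iff_even.2 hs.add_one
    rw [h5, Nat.not_odd_iff_even] at a1
    exact (Nat.not_even_iff_odd.2 (a1.add_odd hs)) hV

theorem FewComponents.of_odd [Finite V] {G : SimpleGraph V} (h : FewComponents G)
    (hV : Odd (Nat.card V)) : ∃ M : (addApex G).Subgraph, M.IsPerfectMatching := by
  rw [SimpleGraph.tutte]
  intro S hS
  unfold SimpleGraph.IsTutteViolator at hS
  set K := ((⊤ : (addApex G).Subgraph).deleteVerts S).coe with hK
  have hmem : ∀ v, v ∈ ((⊤ : (addApex G).Subgraph).deleteVerts S).verts ↔ v ∉ S := by simp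
  by_cases hn : none ∈ S
  · let f : V → Set V := fun v => {w | ∃ hv hw, K.Reachable ⟨some v, hv⟩ ⟨some w, hw⟩}
    have h1 := h (some ⁻¹' S) f (by
      intro u v hu hv huv
      have hu' := (hmem (some u)).2 hu
      have hv' := (hmem (some v)).2 hv
      have hadj : K.Adj ⟨some u, hu'⟩ ⟨some v, hv'⟩ := by
        simp only [Set.mem_preimage] at hu hv
        have ha : (addApex G).Adj (some u) (some v) :=
          ⟨by simpa using huv.ne, by rintro a b ⟨⟩ ⟨⟩; exact huv⟩
        simp [hK, hu, hv, ha]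
      ext w
      constructor
      · rintro ⟨_, hw, hr⟩; exact ⟨hv', hw, hadj.symm.reachable.trans hr⟩
      · rintro ⟨_, hw, hr⟩; exact ⟨hu', hw, hadj.reachable.trans hr⟩)
    have hsome : ∀ x : ((⊤ : (addApex G).Subgraph).deleteVerts S).verts,
        ∃ v, some v = x.1 ∧ some v ∉ S := by
      rintro ⟨x, hx⟩
      rcases x with _ | v
      · exact absurd hn ((hmem _).1 hx)
      · exact ⟨v, rfl, (hmem _).1 hx⟩
    choose r hr hrS using hsome
    have h2 := ncard_oddComponents_le K (fun x => f (r x)) (by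
      intro x y hxy
      have hy : r y ∈ f (r y) := ⟨(hmem _).2 (hrS y), (hmem _).2 (hrS y), SimpleGraph.Reachable.refl _⟩
      rw [← show f (r x) = f (r y) from hxy] at hy
      have := hy.2.2
      convert this using 1
      · exact Subtype.ext (hr x).symm
      · exact Subtype.ext (hr y).symm)
    have h3 : Set.range (fun x => f (r x)) ⊆ f '' (some ⁻¹' S)ᶜ := by
      rintro _ ⟨x, rfl⟩
      exact ⟨r x, hrS x, rfl⟩
    have h4 := Set.ncard_le_ncard h3 (Set.toFinite _)
    have h5 : (some ⁻¹' S : Set V).ncard + 1 = S.ncard := by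
      have : S = insert none (some '' (some ⁻¹' S)) := by
        ext x
        rcases x with _ | v <;> simp [hn]
      conv_rhs => rw [this]
      rw [Set.ncard_insert_of_notMem (by simp) (Set.toFinite _),
        Set.ncard_image_of_injective _ (Option.some_injective _)]
    omega
  · have hreach : ∀ x : ((⊤ : (addApex G).Subgraph).deleteVerts S).verts,
        K.Reachable ⟨none, (hmem _).2 hn⟩ x := by
      rintro ⟨x, hx⟩
      rcases x with _ | v
      · exact SimpleGraph.Reachable.refl _
      · apply SimpleGraph.Adj.reachable
        have := (hmem _).1 hx
        have ha : (addApex G).Adj none (some v) := ⟨by simp, by rintro a b ⟨⟩⟩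
        simp [hK, hn, this, ha]
    have h2 := ncard_oddComponents_le K (fun _ => ()) (fun x y _ => (hreach x).symm.trans (hreach y))
    have h3 : (Set.range (fun _ : ((⊤ : (addApex G).Subgraph).deleteVerts S).verts => ())).ncard ≤ 1 :=
      Set.ncard_le_one_of_subsingleton _
    have h4 : S.ncard = 0 := by omega
    have h5 := SimpleGraph.odd_ncard_oddComponents K
    have h6 : K.oddComponents.ncard = 1 := by omega
    rw [h6] at h5
    have h7 := h5.1 odd_one
    rw [Nat.card_coe_set_eq, show ((⊤ : (addApex G).Subgraph).deleteVerts S).verts = Sᶜ by ext; simp]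
      at h7
    have h8 := Set.ncard_add_ncard_compl S
    rw [h4, zero_add] at h8
    rw [h8, Finite.card_option] at h7
    exact (Nat.not_even_iff_odd.2 h7) hV.add_one

theorem FewComponents.hasNearPerfectMatching [Finite V] {G : SimpleGraph V}
    (h : FewComponents G) : HasNearPerfectMatching G := by
  rcases Nat.even_or_odd (Nat.card V) with hV | hV
  · obtain ⟨M, hM⟩ := h.of_even hV
    refine ⟨M, hM.1, ?_⟩
    rw [hM.2.verts_eq_univ]; simp
  · obtain ⟨M, hM⟩ := h.of_odd hV
    rw [SimpleGraph.Subgraph.isPerfectMatching_iff] at hM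
    have hadj : ∀ u v, M.Adj (some u) (some v) → G.Adj u v :=
      fun u v huv => (M.adj_sub huv).2 u v rfl rfl
    refine ⟨⟨{v | ∃ w, M.Adj (some v) (some w)}, fun u v => M.Adj (some u) (some v),
      fun {u v} huv => hadj u v huv, fun {u v} huv => ⟨v, huv⟩, ⟨fun u v huv => huv.symm⟩⟩, ?_, ?_⟩
    · rintro v ⟨w, hw⟩
      refine ⟨w, hw, fun y hy => ?_⟩
      obtain ⟨z, _, hz⟩ := hM (some v)
      exact Option.some_injective _ ((hz _ hy).trans (hz _ hw).symm)
    · rw [Set.ncard_le_one (Set.toFinite _)]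
      have hnone : ∀ v, (¬ ∃ w, M.Adj (some v) (some w)) → M.Adj none (some v) := by
        intro v hv
        obtain ⟨z, hz, _⟩ := hM (some v)
        rcases z with _ | w
        · exact hz.symm
        · exact absurd ⟨w, hz⟩ hv
      intro a ha b hb
      obtain ⟨z, _, hz⟩ := hM none
      exact Option.some_injective _ ((hz _ (hnone a ha)).trans (hz _ (hnone b hb)).symm)

end Tutte

section Resampling
open scoped Classical
open Finset

variable {n : ℕ}

/-- The average of a function over all orderings of the edges. -/
def avg (f : ProcessSpace n → ℝ) : ℝ := (∑ σ, f σ) / Fintype.card (ProcessSpace n)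

/-- The probability of an event under a uniformly random ordering of the edges. -/
def pr (B : ProcessSpace n → Prop) : ℝ := avg (fun σ => if B σ then 1 else 0)

theorem card_processSpace_pos : 0 < (Fintype.card (ProcessSpace n) : ℝ) := by
  have : Nonempty (ProcessSpace n) := ⟨(Fintype.equivFin (EdgeType n)).symm⟩
  exact_mod_cast Fintype.card_pos

theorem avg_mono {f g : ProcessSpace n → ℝ} (h : ∀ σ, f σ ≤ g σ) : avg f ≤ avg g :=
  div_le_div_of_nonneg_right (sum_le_sum fun σ _ => h σ) card_processSpace_pos.le

theorem avg_nonneg {f : ProcessSpace n → ℝ} (h : ∀ σ, 0 ≤ f σ) : 0 ≤ avg f :=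
  div_nonneg (sum_nonneg fun σ _ => h σ) card_processSpace_pos.le

theorem avg_const_mul (a : ℝ) (f : ProcessSpace n → ℝ) : avg (fun σ => a * f σ) = a * avg f := by
  unfold avg; rw [← mul_sum, mul_div_assoc]

theorem avg_sum {κ : Type*} (s : Finset κ) (f : κ → ProcessSpace n → ℝ) :
    avg (fun σ => ∑ i ∈ s, f i σ) = ∑ i ∈ s, avg (f i) := by
  unfold avg; rw [sum_comm, sum_div]

theorem avg_one : avg (fun _ : ProcessSpace n => (1 : ℝ)) = 1 := by
  unfold avg
  rw [sum_const, card_univ, nsmul_eq_mul, mul_one, div_self card_processSpace_pos.ne']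

theorem pr_nonneg (B : ProcessSpace n → Prop) : 0 ≤ pr B :=
  avg_nonneg fun σ => by split_ifs <;> norm_num

theorem pr_mono {B B' : ProcessSpace n → Prop} (h : ∀ σ, B σ → B' σ) : pr B ≤ pr B' :=
  avg_mono fun σ => by
    by_cases h1 : B σ
    · simp [h1, h σ h1]
    · simp only [h1, if_false]; split_ifs <;> norm_num

theorem pr_or_le (B B' : ProcessSpace n → Prop) : pr (fun σ => B σ ∨ B' σ) ≤ pr B + pr B' := by
  unfold pr avg
  rw [← add_div, ← sum_add_distrib]
  refine div_le_div_of_nonneg_right (sum_le_sum fun σ _ => ?_) card_processSpace_pos.le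
  by_cases h1 : B σ <;> by_cases h2 : B' σ <;> simp [h1, h2]

theorem pr_exists_le {κ : Type*} (s : Finset κ) (B : κ → ProcessSpace n → Prop) :
    pr (fun σ => ∃ i ∈ s, B i σ) ≤ ∑ i ∈ s, pr (B i) := by
  unfold pr
  rw [← avg_sum]
  refine avg_mono fun σ => ?_
  have h0 : ∀ i ∈ s, (0 : ℝ) ≤ if B i σ then 1 else 0 := fun i _ => by split_ifs <;> norm_num
  split_ifs with h
  · obtain ⟨i, hi, hB⟩ := h
    refine le_trans ?_ (single_le_sum h0 hi)
    simp [hB]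
  · exact sum_nonneg h0

theorem pr_mul_le_avg (B : ProcessSpace n → Prop) (f : ProcessSpace n → ℝ) (a : ℝ)
    (hf : ∀ σ, 0 ≤ f σ) (h : ∀ σ, B σ → a ≤ f σ) : a * pr B ≤ avg f := by
  unfold pr
  rw [← avg_const_mul]
  refine avg_mono fun σ => ?_
  split_ifs with hB
  · simpa using h σ hB
  · simpa using hf σ

theorem processMeasure_eq (B : ProcessSpace n → Prop) :
    processMeasure n {σ | B σ} = ENNReal.ofReal (pr B) := by
  unfold processMeasure pr avg
  rw [Measure.smul_apply, Measure.sum_apply _ (MeasurableSpace.measurableSet_top), smul_eq_mul,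
    tsum_fintype, ENNReal.ofReal_div_of_pos card_processSpace_pos, ENNReal.div_eq_inv_mul,
    ENNReal.ofReal_natCast, ENNReal.ofReal_sum_of_nonneg (fun σ _ => by split_ifs <;> norm_num)]
  congr 1
  refine sum_congr rfl fun σ _ => ?_
  rw [Measure.dirac_apply' _ (MeasurableSpace.measurableSet_top)]
  by_cases h : B σ <;> simp [h]

theorem pr_not (B : ProcessSpace n → Prop) : pr (fun σ => ¬ B σ) = 1 - pr B := by
  rw [← avg_one (n := n)]
  unfold pr avg
  rw [← sub_div, ← sum_sub_distrib]
  congr 1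
  refine sum_congr rfl fun σ _ => ?_
  by_cases h : B σ <;> simp [h]

/-- Move the edge `e` to position `τ`, exchanging it with the edge found there. -/
def resample (σ : ProcessSpace n) (e : EdgeType n) (τ : Fin (Fintype.card (EdgeType n))) :
    ProcessSpace n :=
  (Equiv.swap τ (σ.symm e)).trans σ

theorem resample_symm_self (σ : ProcessSpace n) (e : EdgeType n) (τ) :
    (resample σ e τ).symm e = τ := by
  simp [resample]

theorem resample_symm_of_ne (σ : ProcessSpace n) {e a : EdgeType n} (τ) (hae : a ≠ e)
    (haτ : σ.symm a ≠ τ) : (resample σ e τ).symm a = σ.symm a := by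
  simp only [resample, Equiv.symm_trans_apply, Equiv.symm_swap]
  exact Equiv.swap_apply_of_ne_of_ne haτ (by simpa using hae)

theorem resample_resample (σ : ProcessSpace n) (e : EdgeType n) (τ) :
    resample (resample σ e τ) e (σ.symm e) = σ := by
  unfold resample
  ext i
  simp [Equiv.swap_comm τ]

theorem sum_resample (e : EdgeType n)
    (F : ProcessSpace n → Fin (Fintype.card (EdgeType n)) → ℝ) :
    ∑ σ, ∑ τ, F σ τ = ∑ σ : ProcessSpace n, ∑ τ, F (resample σ e τ) (σ.symm e) := by
  rw [← Fintype.sum_prod_type', ← Fintype.sum_prod_type']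
  let φ : ProcessSpace n × Fin (Fintype.card (EdgeType n)) →
      ProcessSpace n × Fin (Fintype.card (EdgeType n)) :=
    fun x => (resample x.1 e x.2, x.1.symm e)
  have hφ : Function.Involutive φ := by
    rintro ⟨σ, τ⟩
    simp only [φ, resample_symm_self, resample_resample]
  exact (Equiv.sum_comp hφ.toPerm (fun x => F x.1 x.2)).symm

theorem avg_indicator_mul_le (e : EdgeType n) (J : Finset (Fin (Fintype.card (EdgeType n))))
    (h : ProcessSpace n → ℝ) (a : ℝ) (hh : ∀ σ, ∀ τ ∈ J, h (resample σ e τ) ≤ a * h σ) :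
    Fintype.card (EdgeType n) * avg (fun σ => if σ.symm e ∈ J then h σ else 0)
      ≤ a * #J * avg h := by
  unfold avg
  rw [← mul_div_assoc, ← mul_div_assoc]
  refine div_le_div_of_nonneg_right ?_ card_processSpace_pos.le
  calc _ = ∑ σ : ProcessSpace n, ∑ τ : Fin (Fintype.card (EdgeType n)),
        if σ.symm e ∈ J then h σ else 0 := by
        simp only [sum_const, card_univ, Fintype.card_fin, nsmul_eq_mul, mul_sum]
    _ = ∑ σ : ProcessSpace n, ∑ τ, if τ ∈ J then h (resample σ e τ) else 0 := by
        rw [sum_resample e]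
        simp only [resample_symm_self]
    _ = ∑ σ : ProcessSpace n, ∑ τ ∈ J, h (resample σ e τ) := by
        simp only [sum_ite_mem, univ_inter]
    _ ≤ ∑ σ : ProcessSpace n, ∑ τ ∈ J, a * h σ :=
        sum_le_sum fun σ _ => sum_le_sum fun τ hτ => hh σ τ hτ
    _ = _ := by
        simp only [sum_const, nsmul_eq_mul]
        rw [mul_sum]; exact sum_congr rfl fun σ _ => by ring

theorem avg_forall_mem_le (hN : 0 < Fintype.card (EdgeType n)) (A : Finset (EdgeType n))
    (J : Finset (Fin (Fintype.card (EdgeType n)))) (g : ProcessSpace n → ℝ) (a : ℝ) (ha : 0 ≤ a)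
    (hg : ∀ σ, 0 ≤ g σ) (hh : ∀ e ∈ A, ∀ σ, ∀ τ ∈ J, g (resample σ e τ) ≤ a * g σ) :
    avg (fun σ => if ∀ e ∈ A, σ.symm e ∈ J then g σ else 0)
      ≤ (a * (#J / Fintype.card (EdgeType n))) ^ #A * avg g := by
  have hN' : (0 : ℝ) < Fintype.card (EdgeType n) := by exact_mod_cast hN
  induction A using Finset.induction_on with
  | empty => simp
  | insert e A he ih =>
    have ih := ih fun e' he' => hh e' (mem_insert_of_mem he')
    have key := avg_indicator_mul_le e J (fun σ => if ∀ e ∈ A, σ.symm e ∈ J then g σ else 0) a (by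
      intro σ τ hτ
      by_cases h1 : ∀ b ∈ A, (resample σ e τ).symm b ∈ J
      · have h2 : ∀ b ∈ A, σ.symm b ∈ J := by
          intro b hb
          by_cases hbτ : σ.symm b = τ
          · rwa [hbτ]
          · rw [← resample_symm_of_ne σ τ (ne_of_mem_of_not_mem hb he) hbτ]
            exact h1 b hb
        rw [if_pos h1, if_pos h2]
        exact hh e (mem_insert_self _ _) σ τ hτ
      · rw [if_neg h1]
        split_ifs
        · exact mul_nonneg ha (hg σ)
        · simp)
    rw [card_insert_of_notMem he, pow_succ]
    have h3 : (fun σ : ProcessSpace n => if ∀ b ∈ insert e A, σ.symm b ∈ J then g σ else 0) =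
        fun σ => if σ.symm e ∈ J then (if ∀ b ∈ A, σ.symm b ∈ J then g σ else 0) else 0 := by
      funext σ
      by_cases h1 : σ.symm e ∈ J <;> simp [h1]
    rw [h3]
    calc _ ≤ a * (#J / Fintype.card (EdgeType n)) *
          avg (fun σ => if ∀ e ∈ A, σ.symm e ∈ J then g σ else 0) := by
          rw [mul_div_assoc', div_mul_eq_mul_div, le_div_iff₀ hN', mul_comm]
          exact key
      _ ≤ a * (#J / Fintype.card (EdgeType n)) *
          ((a * (#J / Fintype.card (EdgeType n))) ^ #A * avg g) :=
          mul_le_mul_of_nonneg_left ih (by positivity)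
      _ = _ := by ring

/-- The number of edges of `F` whose position lies in `J`. -/
def hits (J : Finset (Fin (Fintype.card (EdgeType n)))) (F : Finset (EdgeType n))
    (σ : ProcessSpace n) : ℕ := #{e ∈ F | σ.symm e ∈ J}

theorem one_add_pow_hits (J) (F : Finset (EdgeType n)) (σ : ProcessSpace n) (x : ℝ) :
    (1 + x) ^ hits J F σ = ∏ e ∈ F, (1 + if σ.symm e ∈ J then x else 0) := by
  unfold hits
  rw [← prod_const, prod_filter]
  refine prod_congr rfl fun e _ => ?_
  split_ifs <;> simp

theorem avg_one_add_pow_hits_le (hN : 0 < Fintype.card (EdgeType n)) (J)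
    (F : Finset (EdgeType n)) {x : ℝ} (hx : 0 ≤ x) :
    avg (fun σ => (1 + x) ^ hits J F σ) ≤ (1 + x * (#J / Fintype.card (EdgeType n))) ^ #F := by
  simp only [one_add_pow_hits, prod_one_add]
  rw [avg_sum, ← prod_const, prod_one_add]
  refine sum_le_sum fun A _ => ?_
  rw [prod_const, mul_pow]
  have h1 : (fun σ : ProcessSpace n => ∏ e ∈ A, if σ.symm e ∈ J then x else 0) =
      fun σ => x ^ #A * (if ∀ e ∈ A, σ.symm e ∈ J then 1 else 0) := by
    funext σ
    by_cases h : ∀ e ∈ A, σ.symm e ∈ J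
    · rw [if_pos h, prod_congr rfl (fun e he => if_pos (h e he)), prod_const, mul_one]
    · rw [if_neg h, mul_zero]
      push Not at h
      obtain ⟨e, he, hJ⟩ := h
      exact prod_eq_zero he (if_neg hJ)
  rw [h1, avg_const_mul]
  gcongr
  have := avg_forall_mem_le hN A J (fun _ => 1) 1 zero_le_one (fun _ => zero_le_one) (by simp)
  rwa [avg_one, mul_one, one_mul] at this

theorem hits_add_hits_compl (J) (F : Finset (EdgeType n)) (σ : ProcessSpace n) :
    hits J F σ + hits Jᶜ F σ = #F := by
  unfold hits
  simp only [mem_compl]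
  exact card_filter_add_card_filter_not _

theorem avg_one_sub_pow_hits_le (hN : 0 < Fintype.card (EdgeType n)) (J)
    (F : Finset (EdgeType n)) {y : ℝ} (hy : 0 ≤ y) (hy1 : y < 1) :
    avg (fun σ => (1 - y) ^ hits J F σ) ≤
      Real.exp (-(y * (#J / Fintype.card (EdgeType n)) * #F)) := by
  have hN' : (0 : ℝ) < Fintype.card (EdgeType n) := by exact_mod_cast hN
  have h1y : 0 < 1 - y := by linarith
  have h1 : (fun σ : ProcessSpace n => (1 - y) ^ hits J F σ) =
      fun σ => (1 - y) ^ #F * (1 + y / (1 - y)) ^ hits Jᶜ F σ := by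
    funext σ
    rw [← hits_add_hits_compl J F σ, pow_add, mul_assoc, ← mul_pow,
      show (1 - y) * (1 + y / (1 - y)) = 1 by field_simp; ring, one_pow, mul_one]
  rw [h1, avg_const_mul]
  have h2 := avg_one_add_pow_hits_le hN Jᶜ F (x := y / (1 - y)) (by positivity)
  have h3 : (#Jᶜ : ℝ) = Fintype.card (EdgeType n) - #J := by
    rw [card_compl, Fintype.card_fin, Nat.cast_sub]
    simpa using card_le_univ J
  calc _ ≤ (1 - y) ^ #F * (1 + y / (1 - y) * (#Jᶜ / Fintype.card (EdgeType n))) ^ #F := by gcongr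
    _ = (1 - y * (#J / Fintype.card (EdgeType n))) ^ #F := by
        rw [← mul_pow, h3]; congr 1; field_simp; ring
    _ ≤ (Real.exp (-(y * (#J / Fintype.card (EdgeType n))))) ^ #F := by
        have hJ : (#J : ℝ) / Fintype.card (EdgeType n) ≤ 1 := by
          rw [div_le_one hN']
          exact_mod_cast (by simpa using card_le_univ J)
        apply pow_le_pow_left₀
        · have : (0 : ℝ) ≤ (#J : ℝ) / Fintype.card (EdgeType n) := by positivity
          nlinarith
        · exact Real.one_sub_le_exp_neg _
    _ = _ := by rw [← Real.exp_nat_mul]; congr 1; ring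

theorem pr_le_hits_le (hN : 0 < Fintype.card (EdgeType n)) (J) (F : Finset (EdgeType n))
    {x : ℝ} (hx : 0 ≤ x) (k : ℝ) :
    pr (fun σ => k ≤ hits J F σ) ≤
      Real.exp (x * (#J / Fintype.card (EdgeType n)) * #F - k * Real.log (1 + x)) := by
  have h0 : (0 : ℝ) < 1 + x := by linarith
  have h1 := pr_mul_le_avg (fun σ => k ≤ hits J F σ) (fun σ => (1 + x) ^ hits J F σ)
    (Real.exp (k * Real.log (1 + x))) (fun σ => by positivity) (by
      intro σ h
      rw [← Real.exp_log (pow_pos h0 _), Real.log_pow]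
      gcongr
      exact Real.log_nonneg (by linarith))
  have h2 : (1 + x * (#J / Fintype.card (EdgeType n))) ^ #F ≤
      Real.exp (x * (#J / Fintype.card (EdgeType n)) * #F) := by
    rw [mul_comm _ (#F : ℝ), Real.exp_nat_mul]
    apply pow_le_pow_left₀ (by positivity)
    rw [add_comm]
    exact Real.add_one_le_exp _
  rw [Real.exp_sub, le_div_iff₀ (Real.exp_pos _), mul_comm]
  exact h1.trans ((avg_one_add_pow_hits_le hN J F hx).trans h2)

theorem pr_forall_mem_and_hits_le (hN : 0 < Fintype.card (EdgeType n)) (J J')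
    (A F : Finset (EdgeType n)) (hAF : Disjoint A F) {y : ℝ} (hy : 0 ≤ y) (hy1 : y < 1) (k : ℝ) :
    pr (fun σ => (∀ e ∈ A, σ.symm e ∈ J') ∧ (hits J F σ : ℝ) ≤ k) ≤
      ((1 - y)⁻¹ * (#J' / Fintype.card (EdgeType n))) ^ #A *
      Real.exp (-(y * (#J / Fintype.card (EdgeType n)) * #F) - k * Real.log (1 - y)) := by
  have h1y : 0 < 1 - y := by linarith
  have h1 := pr_mul_le_avg (fun σ => (∀ e ∈ A, σ.symm e ∈ J') ∧ (hits J F σ : ℝ) ≤ k)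
    (fun σ => if ∀ e ∈ A, σ.symm e ∈ J' then (1 - y) ^ hits J F σ else 0)
    (Real.exp (k * Real.log (1 - y))) (fun σ => by positivity) (by
      intro σ h
      simp only [if_pos h.1]
      rw [← Real.exp_log (pow_pos h1y _), Real.log_pow]
      apply Real.exp_le_exp.2
      exact mul_le_mul_of_nonpos_right h.2 (Real.log_nonpos h1y.le (by linarith)))
  have h2 := avg_forall_mem_le hN A J' (fun σ => (1 - y) ^ hits J F σ) (1 - y)⁻¹ (by positivity)
    (fun σ => by positivity) (by
      intro e he σ τ _
      have hle : hits J F σ ≤ hits J F (resample σ e τ) + 1 := by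
        unfold hits
        have : ({a ∈ F | σ.symm a ∈ J} : Finset _) ⊆
            insert (σ τ) {a ∈ F | (resample σ e τ).symm a ∈ J} := by
          intro a ha
          rw [mem_filter] at ha
          rw [mem_insert, mem_filter]
          by_cases haτ : σ.symm a = τ
          · left; rw [← haτ]; simp
          · right
            rw [resample_symm_of_ne σ τ (fun hh => disjoint_left.1 hAF he (by rw [← hh]; exact ha.1)) haτ]
            exact ha
        exact (card_le_card this).trans (card_insert_le _ _)
      rw [← div_eq_inv_mul, le_div_iff₀ h1y, ← pow_succ]
      exact pow_le_pow_of_le_one h1y.le (by linarith) hle)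
  rw [Real.exp_sub, ← mul_div_assoc, le_div_iff₀ (Real.exp_pos _), mul_comm]
  refine h1.trans (h2.trans ?_)
  gcongr
  exact avg_one_sub_pow_hits_le hN J F hy hy1

end Resampling

section Bridge
open scoped Classical
open Finset

variable {n : ℕ}

/-- The first `m` positions of an ordering. -/
def slots (n m : ℕ) : Finset (Fin (Fintype.card (EdgeType n))) := {i | (i : ℕ) < m}

theorem mem_slots {m : ℕ} {i : Fin (Fintype.card (EdgeType n))} : i ∈ slots n m ↔ (i : ℕ) < m := by
  simp [slots]

theorem card_slots {m : ℕ} (hm : m ≤ Fintype.card (EdgeType n)) : #(slots n m) = m := by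
  unfold slots
  rw [Fin.card_filter_val_lt]
  exact min_eq_right hm

theorem card_edgeType (n : ℕ) : Fintype.card (EdgeType n) = n.choose 2 := by
  rw [Sym2.card_subtype_not_diag, Fintype.card_fin]

theorem processGraph_adj {σ : ProcessSpace n} {m : ℕ} {u v : Fin n} :
    (processGraph σ m).Adj u v ↔ ∃ h : ¬ s(u, v).IsDiag, σ.symm ⟨s(u, v), h⟩ ∈ slots n m := by
  unfold processGraph
  rw [SimpleGraph.fromEdgeSet_adj]
  constructor
  · rintro ⟨⟨i, hi, he⟩, huv⟩
    refine ⟨by simpa using huv, ?_⟩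
    rw [mem_slots]
    convert hi
    rw [Equiv.symm_apply_eq]
    exact Subtype.ext he.symm
  · rintro ⟨h, hm⟩
    exact ⟨⟨_, mem_slots.1 hm, by simp⟩, by simpa using h⟩

theorem processGraph_mono (σ : ProcessSpace n) {m m' : ℕ} (h : m ≤ m') :
    processGraph σ m ≤ processGraph σ m' := by
  intro u v
  rw [processGraph_adj, processGraph_adj]
  rintro ⟨h1, h2⟩
  exact ⟨h1, mem_slots.2 ((mem_slots.1 h2).trans_le h)⟩

/-- The edges spanned by the pairs in `P`. -/
def edgesOf (P : Finset (Fin n × Fin n)) : Finset (EdgeType n) :=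
  {e | ∃ p ∈ P, (e : Sym2 (Fin n)) = s(p.1, p.2)}

/-- Distinct pairs in `P` give distinct edges. -/
structure ProperPairs (P : Finset (Fin n × Fin n)) : Prop where
  ne : ∀ p ∈ P, p.1 ≠ p.2
  inj : ∀ p ∈ P, ∀ q ∈ P, s(p.1, p.2) = s(q.1, q.2) → p = q

theorem ProperPairs.card_filter_edgesOf {P : Finset (Fin n × Fin n)} (hP : ProperPairs P)
    (Q : EdgeType n → Prop) :
    #{e ∈ edgesOf P | Q e} = #{p ∈ P | ∃ h : ¬ s(p.1, p.2).IsDiag, Q ⟨s(p.1, p.2), h⟩} := by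
  symm
  refine card_bij (fun p hp => ⟨s(p.1, p.2), by simpa using hP.ne p (mem_filter.1 hp).1⟩) ?_ ?_ ?_
  · intro p hp
    obtain ⟨h1, h, h2⟩ := mem_filter.1 hp
    exact mem_filter.2 ⟨mem_filter.2 ⟨mem_univ _, p, h1, rfl⟩, h2⟩
  · intro p hp q hq h
    exact hP.inj p (mem_filter.1 hp).1 q (mem_filter.1 hq).1 (Subtype.ext_iff.1 h)
  · rintro ⟨e, he⟩ h
    obtain ⟨h1, h2⟩ := mem_filter.1 h
    obtain ⟨-, p, hp, rfl⟩ := mem_filter.1 h1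
    exact ⟨p, mem_filter.2 ⟨hp, he, h2⟩, rfl⟩

theorem ProperPairs.card_edgesOf {P : Finset (Fin n × Fin n)} (hP : ProperPairs P) :
    #(edgesOf P) = #P := by
  have h := hP.card_filter_edgesOf fun _ => True
  have h1 : ∀ p ∈ P, ∃ _ : ¬ s(p.1, p.2).IsDiag, True := fun p hp =>
    ⟨by simpa using hP.ne p hp, trivial⟩
  calc #(edgesOf P) = #{e ∈ edgesOf P | True} := by congr 1; ext e; simp
    _ = #P := by
      convert h.trans ?_
      congr 1; ext p; simpa using h1 p

theorem ProperPairs.hits_edgesOf {P : Finset (Fin n × Fin n)} (hP : ProperPairs P) (m : ℕ)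
    (σ : ProcessSpace n) :
    hits (slots n m) (edgesOf P) σ = #{p ∈ P | (processGraph σ m).Adj p.1 p.2} := by
  have := hP.card_filter_edgesOf fun e => σ.symm e ∈ slots n m
  simp only [← processGraph_adj] at this
  rw [← this]
  unfold hits
  congr!

theorem properPairs_product {X Y : Finset (Fin n)} (h : Disjoint X Y) : ProperPairs (X ×ˢ Y) where
  ne p hp := by
    rw [mem_product] at hp
    exact fun hh => disjoint_left.1 h hp.1 (hh ▸ hp.2)
  inj p hp q hq hpq := by
    rw [mem_product] at hp hq
    rw [Sym2.eq_iff] at hpq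
    rcases hpq with ⟨h1, h2⟩ | ⟨h1, h2⟩
    · exact Prod.ext h1 h2
    · exact absurd hq.2 (disjoint_left.1 h (h1 ▸ hp.1))

/-- The pairs of elements of `Z` in increasing order. -/
def upperPairs (Z : Finset (Fin n)) : Finset (Fin n × Fin n) := {p ∈ Z ×ˢ Z | p.1 < p.2}

theorem properPairs_upperPairs (Z : Finset (Fin n)) : ProperPairs (upperPairs Z) where
  ne p hp := (mem_filter.1 hp).2.ne
  inj p hp q hq hpq := by
    rw [Sym2.eq_iff] at hpq
    have h3 := (mem_filter.1 hp).2
    have h4 := (mem_filter.1 hq).2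
    rcases hpq with ⟨h1, h2⟩ | ⟨h1, h2⟩
    · exact Prod.ext h1 h2
    · rw [h1, h2] at h3
      exact absurd h3 h4.asymm

theorem pairCount_self_eq (G : SimpleGraph (Fin n)) (Z : Finset (Fin n)) :
    pairCount G Z Z = 2 * #{p ∈ upperPairs Z | G.Adj p.1 p.2} := by
  have h1 : ({p ∈ Z ×ˢ Z | G.Adj p.1 p.2} : Finset (Fin n × Fin n)) =
      {p ∈ upperPairs Z | G.Adj p.1 p.2} ∪ {p ∈ upperPairs Z | G.Adj p.1 p.2}.image Prod.swap := by
    ext ⟨a, b⟩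
    simp only [upperPairs, mem_filter, mem_product, mem_union, mem_image, Prod.exists,
      Prod.swap_prod_mk, Prod.mk.injEq]
    constructor
    · rintro ⟨⟨h1, h2⟩, h3⟩
      rcases lt_or_gt_of_ne h3.ne with h | h
      · exact Or.inl ⟨⟨⟨h1, h2⟩, h⟩, h3⟩
      · exact Or.inr ⟨b, a, ⟨⟨⟨h2, h1⟩, h⟩, h3.symm⟩, rfl, rfl⟩
    · rintro (⟨⟨⟨h1, h2⟩, h⟩, h3⟩ | ⟨b', a', ⟨⟨⟨h1, h2⟩, h⟩, h3⟩, rfl, rfl⟩)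
      · exact ⟨⟨h1, h2⟩, h3⟩
      · exact ⟨⟨h2, h1⟩, h3.symm⟩
  unfold pairCount
  rw [h1, card_union_of_disjoint, card_image_of_injective _ Prod.swap_injective, two_mul]
  rw [disjoint_left]
  rintro p hp hq
  obtain ⟨q, hq', rfl⟩ := mem_image.1 hq
  have h3 := (mem_filter.1 (mem_filter.1 hp).1).2
  have h4 := (mem_filter.1 (mem_filter.1 hq').1).2
  exact h3.asymm h4

theorem two_mul_card_upperPairs_le (Z : Finset (Fin n)) : 2 * #(upperPairs Z) ≤ #Z ^ 2 := by
  obtain ⟨K, hK⟩ : ∃ K : SimpleGraph (Fin n), ∀ u v, u ≠ v → K.Adj u v := ⟨⊤, fun _ _ h => h⟩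
  rw [← filter_true_of_mem (s := upperPairs Z) fun p hp => hK p.1 p.2 (mem_filter.1 hp).2.ne,
    ← pairCount_self_eq, sq, ← card_product]
  exact card_filter_le _ _

theorem neg_log_one_sub_le {y : ℝ} (h0 : 0 ≤ y) (h1 : y ≤ 1 / 3) :
    -Real.log (1 - y) ≤ y + y ^ 2 := by
  rw [neg_le, Real.le_log_iff_exp_le (by linarith), Real.exp_neg]
  have h2 := Real.quadratic_le_exp_of_nonneg (x := y + y ^ 2) (by positivity)
  rw [inv_le_comm₀ (Real.exp_pos _) (by linarith)]
  refine le_trans ?_ h2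
  rw [inv_le_iff_one_le_mul₀ (by linarith)]
  nlinarith [mul_nonneg h0 h0, pow_nonneg h0 3, pow_nonneg h0 4, mul_nonneg (mul_nonneg h0 h0) (sub_nonneg.2 h1)]

theorem sub_sq_half_le_log {x : ℝ} (h0 : 0 ≤ x) : x - x ^ 2 / 2 ≤ Real.log (1 + x) := by
  refine le_trans ?_ (Real.le_log_one_add_of_nonneg h0)
  rw [le_div_iff₀ (by linarith)]
  nlinarith [pow_nonneg h0 3]

theorem pr_hits_le_le_exp (hN : 0 < Fintype.card (EdgeType n)) (J) (F : Finset (EdgeType n))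
    {θ μ : ℝ} (h0 : 0 ≤ θ) (h1 : θ ≤ 1) (hμ : 0 ≤ μ)
    (h : (1 - θ / 4) * μ ≤ #J / Fintype.card (EdgeType n) * #F) :
    pr (fun σ => (hits J F σ : ℝ) ≤ (1 - θ) * μ) ≤ Real.exp (-(θ ^ 2 * μ / 8)) := by
  have h2 := pr_forall_mem_and_hits_le hN J J ∅ F (disjoint_empty_left _)
    (y := θ / 4) (by linarith) (by linarith) ((1 - θ) * μ)
  simp only [notMem_empty, IsEmpty.forall_iff, implies_true, true_and, card_empty, pow_zero,
    one_mul] at h2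
  refine h2.trans (Real.exp_le_exp.2 ?_)
  have h3 := neg_log_one_sub_le (y := θ / 4) (by linarith) (by linarith)
  have h4 : (1 - θ) * μ * -Real.log (1 - θ / 4) ≤ (1 - θ) * μ * (θ / 4 + (θ / 4) ^ 2) :=
    mul_le_mul_of_nonneg_left h3 (mul_nonneg (by linarith) hμ)
  have h5 := mul_le_mul_of_nonneg_left h (show 0 ≤ θ / 4 by linarith)
  have h6 : 0 ≤ θ ^ 3 * μ := by positivity
  nlinarith

theorem pr_le_hits_le_exp (hN : 0 < Fintype.card (EdgeType n)) (J) (F : Finset (EdgeType n))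
    {θ μ : ℝ} (h0 : 0 ≤ θ) (h1 : θ ≤ 1) (hμ : 0 ≤ μ)
    (h : #J / Fintype.card (EdgeType n) * #F ≤ (1 + θ / 4) * μ) :
    pr (fun σ => (1 + θ) * μ ≤ (hits J F σ : ℝ)) ≤ Real.exp (-(θ ^ 2 * μ / 8)) := by
  refine (pr_le_hits_le hN J F (x := θ / 4) (by linarith) ((1 + θ) * μ)).trans
    (Real.exp_le_exp.2 ?_)
  have h3 := sub_sq_half_le_log (x := θ / 4) (by linarith)
  have h4 := mul_le_mul_of_nonneg_left h3 (show 0 ≤ (1 + θ) * μ by positivity)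
  have h5 := mul_le_mul_of_nonneg_left h (show 0 ≤ θ / 4 by linarith)
  have h6 : 0 ≤ θ ^ 2 * (1 - θ) * μ := mul_nonneg (mul_nonneg (by positivity) (by linarith)) hμ
  nlinarith

end Bridge

section Good
open scoped Classical
open Finset

theorem map_induce_support (G : SimpleGraph V) :
    (G.induce G.support).map (Function.Embedding.subtype _) = G := by
  ext u v
  rw [SimpleGraph.map_adj]
  constructor
  · rintro ⟨a, b, h, rfl, rfl⟩
    exact h
  · intro h
    exact ⟨⟨u, v, h⟩, ⟨v, u, h.symm⟩, h, rfl, rfl⟩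

theorem deg_map {X : Type*} (K : SimpleGraph X) (f : X ↪ V) (x : X) :
    deg (K.map f) (f x) = deg K x := by
  unfold deg
  rw [← Set.ncard_image_of_injective _ f.injective]
  congr 1
  ext w
  simp only [SimpleGraph.mem_neighborSet, SimpleGraph.map_adj, Set.mem_image]
  constructor
  · rintro ⟨a, b, h, hx, rfl⟩
    rw [f.injective hx] at h
    exact ⟨b, h, rfl⟩
  · rintro ⟨b, h, rfl⟩
    exact ⟨x, b, h, rfl, rfl⟩

theorem ncard_edgeSet_induce_support (G : SimpleGraph V) :
    (G.induce G.support).edgeSet.ncard = G.edgeSet.ncard := by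
  conv_rhs => rw [← map_induce_support G]
  rw [SimpleGraph.edgeSet_map, Set.ncard_image_of_injective _ (Function.Embedding.injective _)]

variable [Fintype V]

theorem deg_eq_card (G : SimpleGraph V) (v : V) : deg G v = #{w | G.Adj v w} := by
  unfold deg
  rw [← Set.ncard_coe_finset]
  congr 1
  ext w
  simp

theorem deg_sdiff_eq_card (G G' : SimpleGraph V) (v : V) :
    deg (G \ G') v = #{w | G.Adj v w ∧ ¬ G'.Adj v w} := by
  rw [deg_eq_card]
  congr 1
  ext w
  simp only [mem_filter, SimpleGraph.sdiff_adj]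

/-- The vertices whose degree is not within a factor `1 ± δ` of `D`. -/
def atypSet (G : SimpleGraph V) (δ D : ℝ) : Finset V :=
  {v | (deg G v : ℝ) < (1 - δ) * D ∨ (1 + δ) * D < deg G v}

/-- The pseudorandom properties of a graph of average degree `D` from which resilience follows. -/
structure GoodGraph (G : SimpleGraph V) (ε c c₀ D δt : ℝ) (C : ℕ) : Prop where
  edges : D * Fintype.card V = 2 * G.edgeSet.ncard
  card_atyp : (#(atypSet G (ε / 8) D) : ℝ) ≤ c * Fintype.card V
  dense : ∀ X Y : Finset V, Disjoint X Y → c * Fintype.card V ≤ #X → c * Fintype.card V ≤ #Y →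
    (1 - ε / 4) * (D / Fintype.card V * (#X * #Y)) ≤ pairCount G X Y
  sparse : ∀ Z : Finset V, (#Z : ℝ) ≤ c₀ * Fintype.card V → (pairCount G Z Z : ℝ) ≤ D / 32 * #Z
  verySparse : ∀ Z : Finset V, #Z ≤ (8 * C + 1) * #(atypSet G (ε / 8) D) →
    pairCount G Z Z ≤ C * #Z
  tiny_adj : ∀ u v, (deg G u : ℝ) < 2 * δt * D → (deg G v : ℝ) < 2 * δt * D → ¬ G.Adj u v
  tiny_two : ∀ u v, (deg G u : ℝ) < 2 * δt * D → (deg G v : ℝ) < 2 * δt * D → u ≠ v →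
    ∀ a, G.Adj u a → G.Adj a v → False
  tiny_four : ∀ u v, (deg G u : ℝ) < 2 * δt * D → (deg G v : ℝ) < 2 * δt * D →
    ∀ a b c, [u, a, b, c, v].Nodup → G.Adj u a → G.Adj a b → G.Adj b c → G.Adj c v → False

theorem deg_sdiff_add {X : Type*} [Finite X] {K H : SimpleGraph X} (h : H ≤ K) (x : X) :
    deg (K \ H) x + deg H x = deg K x := by
  unfold deg
  rw [← Set.ncard_union_eq]
  · congr 1
    ext w
    simp only [Set.mem_union, SimpleGraph.mem_neighborSet, SimpleGraph.sdiff_adj]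
    constructor
    · rintro (h1 | h1)
      exacts [h1.1, h h1]
    · intro h1
      by_cases h2 : H.Adj x w
      exacts [Or.inr h2, Or.inl ⟨h1, h2⟩]
  · rw [Set.disjoint_left]
    intro w h1 h2
    simp only [SimpleGraph.mem_neighborSet, SimpleGraph.sdiff_adj] at h1 h2
    exact h1.2 h2

theorem density_mul_bounds {e w n D c : ℝ} (hD : 0 ≤ D) (hc : 0 < c) (hc' : c ≤ 1 / 4)
    (hn : 1 ≤ c * n) (hw : (1 - c) * n ≤ w) (hwn : w ≤ n) (h : D * n = 2 * e) :
    D ≤ w * (e / (w * (w - 1) / 2)) ∧ w * (e / (w * (w - 1) / 2)) ≤ (1 + 4 * c) * D := by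
  have hn0 : 4 ≤ n := by nlinarith
  have hw2 : 2 < w := by nlinarith
  have he : e = D * n / 2 := by linarith
  have h1 : w * (e / (w * (w - 1) / 2)) = D * n / (w - 1) := by
    rw [he]
    field_simp [show w ≠ 0 by linarith, show w - 1 ≠ 0 by linarith]
  rw [h1]
  constructor
  · rw [le_div_iff₀ (by linarith)]
    exact mul_le_mul_of_nonneg_left (by linarith) hD
  · rw [div_le_iff₀ (by linarith)]
    have h2 : n ≤ (1 + 4 * c) * (w - 1) := by nlinarith
    nlinarith [mul_le_mul_of_nonneg_left h2 hD]

set_option maxHeartbeats 1000000 in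
theorem GoodGraph.strongResilient {G : SimpleGraph V} {ε c c₀ D δt : ℝ} {C : ℕ}
    (h : GoodGraph G ε c c₀ D δt C) (hε : 0 < ε) (hε' : ε ≤ 1 / 2) (hD : 16 ≤ D) (hC : 0 < C)
    (hc : 0 < c) (hc' : c ≤ ε / 32) {c₁ : ℝ} (hc₁ : 0 < c₁) (hc₁₀ : c₁ ≤ c₀ / 2) (hc₁ε : c₁ ≤ ε / 4)
    (hcc₁ : c ≤ ε * c₁ / 64) (hn : 1 ≤ c * Fintype.card V) (hδ : 0 < δt) (hδ' : 2 * δt ≤ 1 / 2) :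
    StrongResilient (G.induce G.support) (1 / 2 - ε) δt 1 (ε / 4) (8 * C + 1)
      HasNearPerfectMatching := by
  intro H hH hT hA hO
  set K := G.induce G.support with hK
  let ι : G.support ↪ V := Function.Embedding.subtype _
  set n : ℝ := (Fintype.card V : ℝ) with hn_def
  have hKG : K.map ι = G := map_induce_support G
  have hdegK : ∀ x, deg K x = deg G (x : V) := fun x =>
    (deg_map K ι x).symm.trans (congrArg (fun L => deg L (x : V)) hKG)
  let W : Finset V := G.support.toFinset
  have hWc : (Nat.card G.support) = #W := by
    rw [Set.toFinset_card, Nat.card_eq_fintype_card]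
  have hWA : ∀ v, v ∉ W → v ∈ atypSet G (ε / 8) D := by
    intro v hv
    have h0 : deg G v = 0 := by
      unfold deg
      rw [Set.ncard_eq_zero]
      ext w
      simp only [SimpleGraph.mem_neighborSet, Set.mem_empty_iff_false, iff_false]
      intro hvw
      exact hv (Set.mem_toFinset.2 ⟨w, hvw⟩)
    refine mem_filter.2 ⟨mem_univ _, Or.inl ?_⟩
    rw [h0]
    push_cast
    nlinarith
  have hcardW : (1 - c) * n ≤ #W := by
    have h1 : Wᶜ ⊆ atypSet G (ε / 8) D := fun v hv => hWA v (mem_compl.1 hv)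
    have h2 : (#Wᶜ : ℝ) ≤ c * n := (Nat.cast_le.2 (card_le_card h1)).trans h.card_atyp
    have h3 : (#W : ℝ) + #Wᶜ = n := by
      rw [hn_def]; exact_mod_cast card_add_card_compl W
    linarith
  have hWn : (#W : ℝ) ≤ n := by rw [hn_def]; exact_mod_cast card_le_univ W
  have hW1 : 1 ≤ #W := by
    have : (0 : ℝ) < #W := by nlinarith
    exact_mod_cast this
  have hdens : D ≤ Nat.card G.support * density K ∧
      Nat.card G.support * density K ≤ (1 + 4 * c) * D := by
    unfold density
    rw [ncard_edgeSet_induce_support, hWc, Nat.cast_choose_two]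
    exact density_mul_bounds (by linarith) hc (by linarith) hn hcardW hWn h.edges
  set d := Nat.card G.support * density K with hd
  have hTs : ∀ x : G.support, x ∈ TINY K (density K) δt ↔ (deg G (x : V) : ℝ) < δt * d := by
    intro x
    rw [← hdegK, hd, ← mul_assoc]
    rfl
  have hAs : ∀ x : G.support, x ∈ ATYP K (density K) (ε / 4) ↔
      ((deg G (x : V) : ℝ) < (1 - ε / 4) * d ∨ (1 + ε / 4) * d < deg G (x : V)) := by
    intro x
    rw [← hdegK, hd, ← mul_assoc, ← mul_assoc]
    rfl
  have hd2 : d ≤ 2 * D := by nlinarith [hdens.2]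
  let T : Finset V := ((TINY K (density K) δt).toFinset).map ι
  let A : Finset V := ((ATYP K (density K) (ε / 4) ∪ TINY K (density K) δt).toFinset).map ι
  have hTmem : ∀ v ∈ T, (deg G v : ℝ) < 2 * δt * D := by
    intro v hv
    obtain ⟨x, hx, rfl⟩ := Finset.mem_map.1 hv
    have := (hTs x).1 (Set.mem_toFinset.1 hx)
    change (deg G (x : V) : ℝ) < _
    nlinarith
  have hAA : A ⊆ atypSet G (ε / 8) D := by
    intro v hv
    obtain ⟨x, hx, rfl⟩ := Finset.mem_map.1 hv
    refine mem_filter.2 ⟨mem_univ _, ?_⟩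
    change (deg G (x : V) : ℝ) < _ ∨ _ < (deg G (x : V) : ℝ)
    rcases Set.mem_toFinset.1 hx with h1 | h1
    · rcases (hAs x).1 h1 with h2 | h2
      · left
        have : (1 - ε / 4) * d ≤ (1 - ε / 4) * ((1 + 4 * c) * D) :=
          mul_le_mul_of_nonneg_left hdens.2 (by linarith)
        have h3 : (1 - ε / 4) * (1 + 4 * c) ≤ 1 - ε / 8 := by nlinarith
        nlinarith
      · right
        nlinarith [hdens.1]
    · left
      have := (hTs x).1 h1
      nlinarith
  obtain ⟨G', hG'⟩ : ∃ G' : SimpleGraph V, G' = (K \ H).map ι := ⟨_, rfl⟩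
  have hG'G : G' ≤ G := by
    rw [hG']
    exact (SimpleGraph.map_monotone ι sdiff_le).trans hKG.le
  have hdegG' : ∀ x : G.support, deg G' (x : V) = deg (K \ H) x := fun x => hG' ▸ deg_map _ ι x
  have hmemA : ∀ x : G.support, (x : V) ∈ A ↔
      x ∈ ATYP K (density K) (ε / 4) ∪ TINY K (density K) δt := by
    intro x
    change ι x ∈ _ ↔ _
    rw [Finset.mem_map' ι, Set.mem_toFinset]
  have hmemT : ∀ x : G.support, (x : V) ∈ T ↔ x ∈ TINY K (density K) δt := by
    intro x
    change ι x ∈ _ ↔ _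
    rw [Finset.mem_map' ι, Set.mem_toFinset]
  have hAW : A ⊆ W := by
    intro v hv
    obtain ⟨x, hx, rfl⟩ := Finset.mem_map.1 hv
    exact Set.mem_toFinset.2 x.2
  have hTA : T ⊆ A := by
    apply Finset.map_subset_map.2
    exact Set.toFinset_mono Set.subset_union_right
  have hsplit : ∀ x : G.support, (deg (K \ H) x : ℝ) + deg H x = deg G (x : V) := by
    intro x
    rw [← hdegK x]
    exact_mod_cast deg_sdiff_add hH x
  have hnorm : ∀ x : G.support, (x : V) ∉ A →
      (1 - ε / 4) * D ≤ deg G (x : V) ∧ (deg G (x : V) : ℝ) ≤ (1 + ε / 4) * ((1 + 4 * c) * D) ∧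
      (deg H x : ℝ) ≤ (1 / 2 - ε) * deg G (x : V) := by
    intro x hx
    rw [hmemA, Set.mem_union, not_or] at hx
    have h1 := hO x hx.2 hx.1
    have h2 := hx.1
    rw [hAs, not_or, not_lt, not_lt] at h2
    rw [hdegK] at h1
    refine ⟨?_, ?_, h1⟩
    · nlinarith [hdens.1]
    · nlinarith [hdens.2]
  have hR : RobustPair G G' W A T ε c c₀ D C := by
    refine
      { le := hG'G
        mem_of_adj := fun u v huv => Set.mem_toFinset.2 ⟨v, hG'G huv⟩
        card_W := hcardW
        card_A := (Nat.cast_le.2 (card_le_card hAA)).trans h.card_atyp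
        T_subset := hTA
        tiny := ?_
        atyp := ?_
        typ_del := ?_
        typ := ?_
        dense := h.dense
        sparse := h.sparse
        verySparse := fun Z hZ => h.verySparse Z (hZ.trans (Nat.mul_le_mul_left _ (card_le_card hAA)))
        tiny_adj := fun u hu v hv => h.tiny_adj u v (hTmem u hu) (hTmem v hv)
        tiny_two := fun u hu v hv => h.tiny_two u v (hTmem u hu) (hTmem v hv)
        tiny_four := fun u hu v hv => h.tiny_four u v (hTmem u hu) (hTmem v hv) }
    · intro v hv
      lift v to G.support using Set.mem_toFinset.1 (hAW (hTA hv))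
      have h1 := hT v ((hmemT v).1 hv)
      have h2 := hsplit v
      rw [hdegK] at h1
      push_cast at h1
      have h3 : (0 : ℝ) < deg G' (v : V) := by rw [hdegG']; linarith
      rw [deg_eq_card, Nat.cast_pos, card_pos] at h3
      obtain ⟨w, hw⟩ := h3
      exact ⟨w, (mem_filter.1 hw).2⟩
    · intro v hv hvT
      lift v to G.support using Set.mem_toFinset.1 (hAW hv)
      rw [hmemT] at hvT
      have h1 := hA v (((hmemA v).1 hv).resolve_right hvT) hvT
      have h2 := hsplit v
      rw [hdegK] at h1
      rw [← deg_eq_card, hdegG']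
      have : ((8 * C + 1 : ℕ) : ℝ) ≤ deg (K \ H) v := by linarith
      exact_mod_cast this
    · intro v hv hvA
      lift v to G.support using Set.mem_toFinset.1 hv
      obtain ⟨h1, h2, h3⟩ := hnorm v hvA
      have h4 := deg_sdiff_add hG'G (v : V)
      rw [← deg_sdiff_eq_card]
      have h6 : (deg (G \ G') (v : V) : ℝ) = deg H v := by
        have h7 := hsplit v
        rw [← hdegG'] at h7
        have : (deg (G \ G') (v : V) : ℝ) + deg G' (v : V) = deg G (v : V) := by exact_mod_cast h4
        linarith
      rw [h6]
      refine h3.trans ?_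
      have h8 : (1 + ε / 4) * (1 + 4 * c) ≤ 1 + ε / 2 := by nlinarith
      have h9 : (deg G (v : V) : ℝ) ≤ (1 + ε / 2) * D := by nlinarith
      have h10 : (1 / 2 - ε) * (deg G (v : V) : ℝ) ≤ (1 / 2 - ε) * ((1 + ε / 2) * D) :=
        mul_le_mul_of_nonneg_left h9 (by linarith)
      have h11 : (1 / 2 - ε) * (1 + ε / 2) ≤ 1 / 2 - ε / 2 := by nlinarith
      nlinarith
    · intro v hv hvA
      lift v to G.support using Set.mem_toFinset.1 hv
      obtain ⟨h1, h2, h3⟩ := hnorm v hvA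
      have h7 := hsplit v
      rw [← deg_eq_card, hdegG']
      nlinarith
  refine FewComponents.hasNearPerfectMatching fun S f hf => ?_
  let S' : Finset V := S.toFinset.map ι
  let f' : V → Set G.support := fun v => if hv : v ∈ G.support then f ⟨v, hv⟩ else ∅
  have hf'e : ∀ x : G.support, f' (x : V) = f x := fun x => by
    simp only [f', dif_pos x.2]
  have hS'mem : ∀ x : G.support, (x : V) ∈ S' ↔ x ∈ S := by
    intro x
    change ι x ∈ _ ↔ _
    rw [Finset.mem_map' ι, Set.mem_toFinset]
  have hS'W : S' ⊆ W := by
    intro v hv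
    obtain ⟨x, hx, rfl⟩ := Finset.mem_map.1 hv
    exact Set.mem_toFinset.2 x.2
  have key := hR.card_image_le hε hε' (by linarith) hC hc hc₁ hc₁₀ hc₁ε hcc₁ hn hS'W (f := f') (by
    intro u hu v hv huv
    obtain ⟨hu1, hu2⟩ := Finset.mem_sdiff.1 hu
    obtain ⟨hv1, hv2⟩ := Finset.mem_sdiff.1 hv
    lift u to G.support using Set.mem_toFinset.1 hu1
    lift v to G.support using Set.mem_toFinset.1 hv1
    rw [hf'e, hf'e]
    rw [hS'mem] at hu2 hv2
    refine hf u v hu2 hv2 ?_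
    obtain ⟨a, b, hab, ha, hb⟩ := (SimpleGraph.map_adj _ _ _ _).1 (hG' ▸ huv)
    rwa [Subtype.ext (a1 := a) (a2 := u) ha, Subtype.ext (a1 := b) (a2 := v) hb] at hab)
  have e1 : (f '' Sᶜ) = ↑((W \ S').image f') := by
    ext t
    simp only [Set.mem_image, Set.mem_compl_iff, coe_image, mem_coe, Finset.mem_sdiff]
    constructor
    · rintro ⟨x, hx, rfl⟩
      exact ⟨x, ⟨Set.mem_toFinset.2 x.2, fun hh => hx ((hS'mem x).1 hh)⟩, hf'e x⟩
    · rintro ⟨v, ⟨hv1, hv2⟩, rfl⟩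
      lift v to G.support using Set.mem_toFinset.1 hv1
      exact ⟨v, fun hh => hv2 ((hS'mem v).2 hh), (hf'e v).symm⟩
  have e2 : S.ncard = #S' := by
    rw [Finset.card_map, Set.ncard_eq_toFinset_card']
  rw [e1, Set.ncard_coe_finset, e2]
  exact key

end Good

section LocalBounds
open scoped Classical
open Finset

variable {n m : ℕ}

/-- The average degree of a graph with `n` vertices and `m` edges. -/
def aveDeg (n m : ℕ) : ℝ := 2 * m / n

theorem aveDeg_nonneg : 0 ≤ aveDeg n m := by unfold aveDeg; positivity

theorem aveDeg_mono {m' : ℕ} (h : m ≤ m') : aveDeg n m ≤ aveDeg n m' := by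
  unfold aveDeg; gcongr

theorem card_edgeType_pos (hn : 2 ≤ n) : 0 < Fintype.card (EdgeType n) := by
  rw [card_edgeType]; exact Nat.choose_pos hn

theorem card_slots_div (hn : 2 ≤ n) (hm : m ≤ Fintype.card (EdgeType n)) :
    (#(slots n m) : ℝ) / Fintype.card (EdgeType n) = aveDeg n m / (n - 1) := by
  have h2 : (2 : ℝ) ≤ n := by exact_mod_cast hn
  rw [card_slots hm, card_edgeType, Nat.cast_choose_two]
  unfold aveDeg
  field_simp

theorem hits_product {X Y : Finset (Fin n)} (h : Disjoint X Y) (σ : ProcessSpace n) :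
    hits (slots n m) (edgesOf (X ×ˢ Y)) σ = pairCount (processGraph σ m) X Y :=
  (properPairs_product h).hits_edgesOf m σ

theorem card_edgesOf_product {X Y : Finset (Fin n)} (h : Disjoint X Y) :
    (#(edgesOf (X ×ˢ Y)) : ℝ) = #X * #Y := by
  rw [(properPairs_product h).card_edgesOf, card_product]
  push_cast; rfl

theorem pr_pairCount_le (hn : 2 ≤ n) (hm : m ≤ Fintype.card (EdgeType n)) {θ : ℝ} (h0 : 0 ≤ θ)
    (h1 : θ ≤ 1) {X Y : Finset (Fin n)} (h : Disjoint X Y) :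
    pr (fun σ => (pairCount (processGraph σ m) X Y : ℝ) ≤ (1 - θ) * (aveDeg n m / n * (#X * #Y))) ≤
      Real.exp (-(θ ^ 2 * (aveDeg n m / n * (#X * #Y)) / 8)) := by
  have h2 : (2 : ℝ) ≤ n := by exact_mod_cast hn
  have hD := aveDeg_nonneg (n := n) (m := m)
  have hμ : 0 ≤ aveDeg n m / n * (#X * #Y) := by positivity
  simp only [← hits_product h]
  refine pr_hits_le_le_exp (card_edgeType_pos hn) _ _ h0 h1 hμ ?_
  rw [card_slots_div hn hm, card_edgesOf_product h]
  calc (1 - θ / 4) * (aveDeg n m / n * (#X * #Y)) ≤ 1 * (aveDeg n m / n * (#X * #Y)) := by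
        gcongr; linarith
    _ ≤ _ := by
        rw [one_mul]
        gcongr
        · linarith
        · linarith

theorem pr_cut_le (hn : 2 ≤ n) (hm : m ≤ Fintype.card (EdgeType n)) {θ : ℝ} (h0 : 0 ≤ θ)
    (h1 : θ ≤ 1) {X : Finset (Fin n)} (hX : (#X : ℝ) ≤ θ / 4 * n) :
    pr (fun σ => (pairCount (processGraph σ m) X Xᶜ : ℝ) ≤ (1 - θ) * (aveDeg n m * #X)) ≤
      Real.exp (-(θ ^ 2 * (aveDeg n m * #X) / 8)) := by
  have h2 : (2 : ℝ) ≤ n := by exact_mod_cast hn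
  have hD := aveDeg_nonneg (n := n) (m := m)
  have hc : (#X : ℝ) + #Xᶜ = n := by
    have := card_add_card_compl X
    rw [Fintype.card_fin] at this
    exact_mod_cast this
  simp only [← hits_product (disjoint_compl_right (a := X))]
  refine pr_hits_le_le_exp (card_edgeType_pos hn) _ _ h0 h1 (by positivity) ?_
  rw [card_slots_div hn hm, card_edgesOf_product disjoint_compl_right, div_mul_eq_mul_div,
    le_div_iff₀ (by linarith)]
  have h3 : (1 - θ / 4) * (n - 1) ≤ (#Xᶜ : ℝ) := by nlinarith
  calc _ = aveDeg n m * #X * ((1 - θ / 4) * (n - 1)) := by ring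
    _ ≤ aveDeg n m * #X * #Xᶜ := by gcongr
    _ = _ := by ring

theorem pr_le_cut (hn : 2 ≤ n) (hm : m ≤ Fintype.card (EdgeType n)) {θ : ℝ} (h0 : 0 ≤ θ)
    (h1 : θ ≤ 1) {X : Finset (Fin n)} (hX : X.Nonempty) :
    pr (fun σ => (1 + θ) * (aveDeg n m * #X) ≤ (pairCount (processGraph σ m) X Xᶜ : ℝ)) ≤
      Real.exp (-(θ ^ 2 * (aveDeg n m * #X) / 8)) := by
  have h2 : (2 : ℝ) ≤ n := by exact_mod_cast hn
  have hD := aveDeg_nonneg (n := n) (m := m)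
  have hc : (#X : ℝ) + #Xᶜ = n := by
    have := card_add_card_compl X
    rw [Fintype.card_fin] at this
    exact_mod_cast this
  have hX1 : (1 : ℝ) ≤ #X := by exact_mod_cast hX.card_pos
  simp only [← hits_product (disjoint_compl_right (a := X))]
  refine pr_le_hits_le_exp (card_edgeType_pos hn) _ _ h0 h1 (by positivity) ?_
  rw [card_slots_div hn hm, card_edgesOf_product disjoint_compl_right, div_mul_eq_mul_div,
    div_le_iff₀ (by linarith)]
  have h3 : (#Xᶜ : ℝ) ≤ (1 + θ / 4) * (n - 1) := by nlinarith
  calc _ = aveDeg n m * #X * #Xᶜ := by ring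
    _ ≤ aveDeg n m * #X * ((1 + θ / 4) * (n - 1)) := by gcongr
    _ = _ := by ring

theorem pr_lt_pairCount_self (hn : 2 ≤ n) (hm : m ≤ Fintype.card (EdgeType n)) (Z : Finset (Fin n))
    {x : ℝ} (hx : 0 ≤ x) (k : ℝ) :
    pr (fun σ => k < (pairCount (processGraph σ m) Z Z : ℝ)) ≤
      Real.exp (x * (aveDeg n m / n) * #Z ^ 2 - k / 2 * Real.log (1 + x)) := by
  have h2 : (2 : ℝ) ≤ n := by exact_mod_cast hn
  have hD := aveDeg_nonneg (n := n) (m := m)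
  have hF := (properPairs_upperPairs Z).card_edgesOf
  have h3 : 2 * (#(upperPairs Z) : ℝ) ≤ #Z ^ 2 := by exact_mod_cast two_mul_card_upperPairs_le Z
  have key := pr_le_hits_le (card_edgeType_pos hn) (slots n m) (edgesOf (upperPairs Z)) hx (k / 2)
  refine (pr_mono fun σ hσ => ?_).trans (key.trans (Real.exp_le_exp.2 ?_))
  · rw [(properPairs_upperPairs Z).hits_edgesOf]
    rw [pairCount_self_eq] at hσ
    push_cast at hσ
    linarith
  · rw [card_slots_div hn hm, hF]
    have h4 : aveDeg n m / (n - 1) ≤ 2 * (aveDeg n m / n) := by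
      rw [← mul_div_assoc, div_le_div_iff₀ (by linarith) (by linarith)]
      nlinarith
    have h5 : x * (aveDeg n m / (n - 1)) * #(upperPairs Z) ≤
        x * (2 * (aveDeg n m / n)) * #(upperPairs Z) := by gcongr
    have h6 : x * (aveDeg n m / n) * (2 * #(upperPairs Z)) ≤ x * (aveDeg n m / n) * #Z ^ 2 := by
      gcongr
    linarith

theorem sum_exp_neg_mul_card (a : ℝ) :
    ∑ Z : Finset (Fin n), Real.exp (-(a * #Z)) ≤ Real.exp (n * Real.exp (-a)) := by
  have h1 : ∑ Z : Finset (Fin n), Real.exp (-(a * #Z)) = (1 + Real.exp (-a)) ^ n := by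
    have := prod_one_add (s := (univ : Finset (Fin n))) (f := fun _ => Real.exp (-a))
    rw [prod_const, card_univ, Fintype.card_fin, powerset_univ] at this
    rw [this]
    refine sum_congr rfl fun Z _ => ?_
    rw [prod_const, ← Real.exp_nat_mul]
    congr 1; ring
  rw [h1, Real.exp_nat_mul]
  gcongr
  rw [add_comm]
  exact Real.add_one_le_exp _

theorem pr_exists_finset_le (B : Finset (Fin n) → ProcessSpace n → Prop) (a b : ℝ)
    (h : ∀ Z, pr (B Z) ≤ Real.exp (-b - a * #Z)) :
    pr (fun σ => ∃ Z, B Z σ) ≤ Real.exp (-b + n * Real.exp (-a)) := by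
  calc _ ≤ pr (fun σ => ∃ Z ∈ univ, B Z σ) := pr_mono fun σ ⟨Z, hZ⟩ => ⟨Z, mem_univ _, hZ⟩
    _ ≤ ∑ Z, pr (B Z) := pr_exists_le _ _
    _ ≤ ∑ Z : Finset (Fin n), Real.exp (-b) * Real.exp (-(a * #Z)) := sum_le_sum fun Z _ => by
        rw [← Real.exp_add]
        exact (h Z).trans_eq (by congr 1)
    _ ≤ _ := by
        rw [← mul_sum, Real.exp_add]
        gcongr
        exact sum_exp_neg_mul_card a

theorem pr_false {B : ProcessSpace n → Prop} (h : ∀ σ, ¬ B σ) : pr B = 0 := by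
  unfold pr avg; simp [h]

theorem pr_and_const_le (B : ProcessSpace n → Prop) (P : Prop) {b : ℝ} (hb : 0 ≤ b)
    (h : P → pr B ≤ b) : pr (fun σ => P ∧ B σ) ≤ b := by
  by_cases hP : P
  · simpa [hP] using h hP
  · rw [pr_false (by simp [hP])]; exact hb

/-- The pairs of consecutive vertices of a path. -/
def pathPairs {ℓ : ℕ} (t : Fin (ℓ + 1) → Fin n) : Finset (Fin n × Fin n) :=
  univ.image fun i : Fin ℓ => (t i.castSucc, t i.succ)

theorem properPairs_pathPairs {ℓ : ℕ} {t : Fin (ℓ + 1) → Fin n} (ht : t.Injective) :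
    ProperPairs (pathPairs t) where
  ne p hp := by
    obtain ⟨i, -, rfl⟩ := mem_image.1 hp
    exact fun h => i.castSucc_lt_succ.ne (ht h)
  inj p hp q hq hpq := by
    obtain ⟨i, -, rfl⟩ := mem_image.1 hp
    obtain ⟨j, -, rfl⟩ := mem_image.1 hq
    rw [Sym2.eq_iff] at hpq
    rcases hpq with ⟨h1, h2⟩ | ⟨h1, h2⟩
    · exact Prod.ext h1 h2
    · have h3 := congrArg Fin.val (ht h1)
      have h4 := congrArg Fin.val (ht h2)
      simp only [Fin.val_castSucc, Fin.val_succ] at h3 h4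
      omega

theorem card_pathPairs {ℓ : ℕ} {t : Fin (ℓ + 1) → Fin n} (ht : t.Injective) :
    #(pathPairs t) = ℓ := by
  unfold pathPairs
  rw [card_image_of_injective, card_univ, Fintype.card_fin]
  intro i j hij
  exact Fin.castSucc_injective _ (ht (Prod.ext_iff.1 hij).1)

theorem pr_path_le {m' ℓ : ℕ} (hn : 2 ≤ n) (hm : m ≤ Fintype.card (EdgeType n))
    (hm' : m' ≤ Fintype.card (EdgeType n)) (hℓ : 0 < ℓ) {t : Fin (ℓ + 1) → Fin n}
    (ht : t.Injective) {η : ℝ} (hη : 0 < η) (hη1 : η ≤ 1) {k : ℝ} :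
    pr (fun σ => (∀ i : Fin ℓ, (processGraph σ m').Adj (t i.castSucc) (t i.succ)) ∧
      (deg (processGraph σ m) (t 0) : ℝ) < k ∧ (deg (processGraph σ m) (t (Fin.last ℓ)) : ℝ) < k) ≤
    (η⁻¹ * (aveDeg n m' / (n - 1))) ^ ℓ *
      Real.exp (-((1 - η) * (aveDeg n m / (n - 1)) * (2 * (n - (ℓ + 1))))
        - 2 * k * Real.log η) := by
  set Q : Finset (Fin n) := univ.image t with hQ
  have hQc : #Q = ℓ + 1 := by
    rw [hQ, card_image_of_injective _ ht, card_univ, Fintype.card_fin]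
  have hQm : ∀ i, t i ∈ Q := fun i => mem_image_of_mem _ (mem_univ _)
  have hne : t 0 ≠ t (Fin.last ℓ) := fun h => by
    have := congrArg Fin.val (ht h)
    simp at this
    omega
  set X : Finset (Fin n) := {t 0, t (Fin.last ℓ)} with hX
  have hXQ : X ⊆ Q := by
    rw [hX, insert_subset_iff, singleton_subset_iff]; exact ⟨hQm _, hQm _⟩
  have hdis : Disjoint X Qᶜ := disjoint_compl_right.mono_left hXQ
  have hAF : Disjoint (edgesOf (pathPairs t)) (edgesOf (X ×ˢ Qᶜ)) := by
    rw [disjoint_left]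
    intro e h1 h2
    obtain ⟨-, p, hp, hpe⟩ := mem_filter.1 h1
    obtain ⟨-, q, hq, hqe⟩ := mem_filter.1 h2
    obtain ⟨i, -, rfl⟩ := mem_image.1 hp
    rw [mem_product, mem_compl] at hq
    rw [hpe, Sym2.eq_iff] at hqe
    rcases hqe with ⟨h3, h4⟩ | ⟨h3, h4⟩
    · exact hq.2 (h4 ▸ hQm _)
    · exact hq.2 (h3 ▸ hQm _)
  have key := pr_forall_mem_and_hits_le (card_edgeType_pos hn) (slots n m) (slots n m')
    (edgesOf (pathPairs t)) (edgesOf (X ×ˢ Qᶜ)) hAF (y := 1 - η) (by linarith) (by linarith) (2 * k)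
  rw [card_slots_div hn hm, card_slots_div hn hm', (properPairs_pathPairs ht).card_edgesOf,
    card_pathPairs ht, card_edgesOf_product hdis, _root_.sub_sub_cancel] at key
  have hXc : (#X : ℝ) = 2 := by rw [hX, card_pair hne]; norm_num
  have hQcc : (#Qᶜ : ℝ) = n - (ℓ + 1) := by
    have := card_add_card_compl Q
    rw [Fintype.card_fin, hQc] at this
    have h2 : ((ℓ + 1 + #Qᶜ : ℕ) : ℝ) = n := by exact_mod_cast this
    push_cast at h2
    linarith
  rw [hXc, hQcc] at key
  refine (pr_mono fun σ hσ => ⟨?_, ?_⟩).trans key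
  · intro e he
    obtain ⟨-, p, hp, hpe⟩ := mem_filter.1 he
    obtain ⟨i, -, rfl⟩ := mem_image.1 hp
    obtain ⟨h1, h2⟩ := processGraph_adj.1 (hσ.1 i)
    convert h2
  · rw [hits_product hdis, pairCount_eq_sum, hX, sum_pair hne]
    have h1 : ∀ v, #{y ∈ Qᶜ | (processGraph σ m).Adj v y} ≤ deg (processGraph σ m) v := fun v => by
      rw [deg_eq_card]
      exact card_le_card (filter_subset_filter _ (subset_univ _))
    have h2 : ((#{y ∈ Qᶜ | (processGraph σ m).Adj (t 0) y} : ℕ) : ℝ) ≤ _ :=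
      Nat.cast_le.2 (h1 (t 0))
    have h3 : ((#{y ∈ Qᶜ | (processGraph σ m).Adj (t (Fin.last ℓ)) y} : ℕ) : ℝ) ≤ _ :=
      Nat.cast_le.2 (h1 (t (Fin.last ℓ)))
    push_cast
    linarith [hσ.2.1, hσ.2.2]

end LocalBounds

section RareEvents
open scoped Classical
open Finset

/-- A sequence of events whose probability tends to `0`. -/
def Rare (B : ∀ n, ProcessSpace n → Prop) : Prop := Tendsto (fun n => pr (B n)) atTop (nhds 0)

theorem rare_of_le {B : ∀ n, ProcessSpace n → Prop} {b : ℕ → ℝ} (hb : Tendsto b atTop (nhds 0))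
    (h : ∀ᶠ n in atTop, pr (B n) ≤ b n) : Rare B :=
  squeeze_zero' (Eventually.of_forall fun _ => pr_nonneg _) h hb

theorem Rare.or {B B' : ∀ n, ProcessSpace n → Prop} (h : Rare B) (h' : Rare B') :
    Rare fun n σ => B n σ ∨ B' n σ :=
  rare_of_le (by simpa using Tendsto.add h h') (Eventually.of_forall fun _ => pr_or_le _ _)

theorem Rare.mono {B B' : ∀ n, ProcessSpace n → Prop} (h : Rare B')
    (hB : ∀ᶠ n in atTop, ∀ σ, B n σ → B' n σ) : Rare B :=
  rare_of_le h (hB.mono fun _ hn => pr_mono hn)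

theorem tendsto_log_natCast : Tendsto (fun n : ℕ => Real.log n) atTop atTop :=
  Real.tendsto_log_atTop.comp tendsto_natCast_atTop_atTop

theorem eventually_le_log (K : ℝ) : ∀ᶠ n : ℕ in atTop, K ≤ Real.log n :=
  tendsto_log_natCast.eventually_ge_atTop K

theorem tendsto_exp_neg_mul_log {a : ℝ} (ha : 0 < a) :
    Tendsto (fun n : ℕ => Real.exp (-(a * Real.log n))) atTop (nhds 0) :=
  Real.tendsto_exp_neg_atTop_nhds_zero.comp (tendsto_log_natCast.const_mul_atTop ha)

theorem eventually_mul_log_le_exp (K : ℝ) {s : ℝ} (hs : 0 < s) :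
    ∀ᶠ n : ℕ in atTop, K * Real.log n ≤ Real.exp (s * Real.log n) := by
  filter_upwards [eventually_le_log 0, eventually_le_log (2 * K / s ^ 2)] with n h0 h1
  have h2 := Real.quadratic_le_exp_of_nonneg (x := s * Real.log n) (by positivity)
  rw [div_le_iff₀ (by positivity)] at h1
  nlinarith [mul_le_mul_of_nonneg_right h1 h0, mul_nonneg hs.le h0]

theorem eventually_exp_log : ∀ᶠ n : ℕ in atTop, Real.exp (Real.log n) = n := by
  filter_upwards [eventually_gt_atTop 0] with n hn
  exact Real.exp_log (by exact_mod_cast hn)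

theorem rare_exists_edges {B : ∀ n, ℕ → ProcessSpace n → Prop} {P : ℕ → ℕ → Prop}
    (h : ∀ᶠ n in atTop, ∀ m ≤ Fintype.card (EdgeType n), P n m →
      pr (B n m) ≤ Real.exp (-(3 * Real.log n))) :
    Rare fun n σ => ∃ m ≤ Fintype.card (EdgeType n), P n m ∧ B n m σ := by
  refine rare_of_le (tendsto_exp_neg_mul_log zero_lt_one) ?_
  filter_upwards [h, eventually_exp_log, eventually_ge_atTop 2] with n hn hlog h2
  have h2' : (2 : ℝ) ≤ n := by exact_mod_cast h2
  calc _ ≤ pr (fun σ => ∃ m ∈ range (Fintype.card (EdgeType n) + 1), P n m ∧ B n m σ) :=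
        pr_mono fun σ ⟨m, hm, hB⟩ => ⟨m, mem_range.2 (Nat.lt_succ_of_le hm), hB⟩
    _ ≤ ∑ m ∈ range (Fintype.card (EdgeType n) + 1), pr (fun σ => P n m ∧ B n m σ) :=
        pr_exists_le _ _
    _ ≤ ∑ m ∈ range (Fintype.card (EdgeType n) + 1), Real.exp (-(3 * Real.log n)) :=
        sum_le_sum fun m hm => pr_and_const_le _ _ (Real.exp_pos _).le
          (hn m (Nat.le_of_lt_succ (mem_range.1 hm)))
    _ = (Fintype.card (EdgeType n) + 1) * Real.exp (-(3 * Real.log n)) := by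
        rw [sum_const, card_range, nsmul_eq_mul]; push_cast; rfl
    _ ≤ (n * n) * Real.exp (-(3 * Real.log n)) := by
        gcongr
        rw [card_edgeType, Nat.cast_choose_two]
        nlinarith
    _ = _ := by
        nth_rewrite 1 [← hlog]
        nth_rewrite 2 [← hlog]
        rw [← Real.exp_add, ← Real.exp_add]
        congr 1; ring

/-- The number of edges from which on the graphs of the process are considered. -/
def startTime (ε : ℝ) (n : ℕ) : ℕ := ⌈(1 + ε) / 4 * n * Real.log n⌉₊

variable {ε : ℝ} {n m : ℕ}

theorem le_aveDeg_of_startTime_le (hn : 0 < n) (h : startTime ε n ≤ m) :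
    (1 + ε) / 2 * Real.log n ≤ aveDeg n m := by
  have h0 : (0 : ℝ) < n := by exact_mod_cast hn
  have h1 : (1 + ε) / 4 * n * Real.log n ≤ m :=
    (Nat.le_ceil _).trans (Nat.cast_le.2 h)
  unfold aveDeg
  rw [le_div_iff₀ h0]
  nlinarith

theorem half_log_le_aveDeg (hε : 0 < ε) (hn : 0 < n) (h : startTime ε n ≤ m) :
    Real.log n / 2 ≤ aveDeg n m := by
  have h1 := le_aveDeg_of_startTime_le hn h
  have h2 : 0 ≤ Real.log n := Real.log_natCast_nonneg n
  nlinarith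

theorem startTime_le (hε : 0 < ε) (hε' : ε ≤ 1 / 2) (h : 2 ≤ Real.log n) (hn : 2 ≤ n) :
    (startTime ε n : ℝ) ≤ n * Real.log n := by
  have h0 : (2 : ℝ) ≤ n := by exact_mod_cast hn
  have h1 : 4 ≤ n * Real.log n := by nlinarith
  have h2 := Nat.ceil_lt_add_one (a := (1 + ε) / 4 * n * Real.log n) (by nlinarith)
  unfold startTime
  nlinarith

theorem aveDeg_mul_startTime_le (L : ℕ) (hε : 0 < ε) (hε' : ε ≤ 1 / 2) (h : 2 ≤ Real.log n)
    (hn : 2 ≤ n) : aveDeg n (L * startTime ε n) ≤ 2 * L * Real.log n := by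
  have h0 : (2 : ℝ) ≤ n := by exact_mod_cast hn
  have h1 := startTime_le hε hε' h hn
  unfold aveDeg
  rw [div_le_iff₀ (by linarith)]
  push_cast
  have := mul_le_mul_of_nonneg_left h1 (Nat.cast_nonneg (α := ℝ) L)
  nlinarith

theorem eventually_mul_startTime_le (L : ℕ) (hε : 0 < ε) (hε' : ε ≤ 1 / 2) :
    ∀ᶠ n : ℕ in atTop, L * startTime ε n ≤ Fintype.card (EdgeType n) := by
  filter_upwards [eventually_le_log 2, eventually_ge_atTop 2, eventually_exp_log,
    eventually_mul_log_le_exp (4 * L) zero_lt_one] with n h1 h2 h3 h4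
  rw [one_mul, h3] at h4
  have h0 : (2 : ℝ) ≤ n := by exact_mod_cast h2
  have h5 := startTime_le hε hε' h1 h2
  have h6 : ((L * startTime ε n : ℕ) : ℝ) ≤ (Fintype.card (EdgeType n) : ℕ) := by
    rw [card_edgeType, Nat.cast_choose_two]
    push_cast
    have := mul_le_mul_of_nonneg_left h5 (Nat.cast_nonneg (α := ℝ) L)
    nlinarith
  exact_mod_cast h6

theorem rare_not_dense (hε : 0 < ε) {θ c : ℝ} (h0 : 0 < θ) (h1 : θ ≤ 1) (hc : 0 < c) :
    Rare fun n σ => ∃ m ≤ Fintype.card (EdgeType n), startTime ε n ≤ m ∧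
      ∃ X Y : Finset (Fin n), (Disjoint X Y ∧ c * n ≤ #X ∧ c * n ≤ #Y) ∧
        (pairCount (processGraph σ m) X Y : ℝ) ≤ (1 - θ) * (aveDeg n m / n * (#X * #Y)) := by
  refine rare_exists_edges (B := fun n m σ => ∃ X Y : Finset (Fin n),
    (Disjoint X Y ∧ c * n ≤ #X ∧ c * n ≤ #Y) ∧
        (pairCount (processGraph σ m) X Y : ℝ) ≤ (1 - θ) * (aveDeg n m / n * (#X * #Y))) ?_
  set a := θ ^ 2 * c ^ 2 / 16 with ha
  have ha0 : 0 < a := by positivity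
  filter_upwards [eventually_ge_atTop 2, eventually_le_log 1, eventually_le_log (5 / a)]
    with n hn hl hl' m hm hsm
  have hn' : (2 : ℝ) ≤ n := by exact_mod_cast hn
  have hD := half_log_le_aveDeg hε (by omega) hsm
  have hb : ∀ p : Finset (Fin n) × Finset (Fin n), pr (fun σ : ProcessSpace n =>
      (Disjoint p.1 p.2 ∧ c * n ≤ #p.1 ∧ c * n ≤ #p.2) ∧
        (pairCount (processGraph σ m) p.1 p.2 : ℝ) ≤
          (1 - θ) * (aveDeg n m / n * (#p.1 * #p.2))) ≤ Real.exp (-(a * Real.log n * n)) := by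
    rintro ⟨X, Y⟩
    refine pr_and_const_le _ _ (Real.exp_pos _).le fun ⟨hXY, hX, hY⟩ => ?_
    refine (pr_pairCount_le hn hm h0.le h1 hXY).trans (Real.exp_le_exp.2 (neg_le_neg ?_))
    have e1 : Real.log n / 2 / n * ((c * n) * (c * n)) ≤ aveDeg n m / n * (#X * #Y) := by
      have hD0 := aveDeg_nonneg (n := n) (m := m)
      gcongr
    have e2 : Real.log n / 2 / n * ((c * n) * (c * n)) = c ^ 2 * Real.log n * n / 2 := by
      field_simp
    rw [e2] at e1
    have e3 := mul_le_mul_of_nonneg_left e1 (show 0 ≤ θ ^ 2 / 8 by positivity)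
    rw [ha]
    linarith
  calc _ ≤ pr (fun σ : ProcessSpace n => ∃ p ∈ (univ : Finset (Finset (Fin n) × Finset (Fin n))),
      (Disjoint p.1 p.2 ∧ c * n ≤ #p.1 ∧ c * n ≤ #p.2) ∧
        (pairCount (processGraph σ m) p.1 p.2 : ℝ) ≤ (1 - θ) * (aveDeg n m / n * (#p.1 * #p.2))) :=
        pr_mono fun σ ⟨X, Y, h⟩ => ⟨(X, Y), mem_univ _, h⟩
    _ ≤ ∑ p : Finset (Fin n) × Finset (Fin n), Real.exp (-(a * Real.log n * n)) :=
        (pr_exists_le _ _).trans (sum_le_sum fun p _ => hb p)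
    _ = 2 ^ n * 2 ^ n * Real.exp (-(a * Real.log n * n)) := by
        rw [sum_const, card_univ, Fintype.card_prod, Fintype.card_finset, Fintype.card_fin,
          nsmul_eq_mul]
        push_cast; rfl
    _ ≤ Real.exp n * Real.exp n * Real.exp (-(a * Real.log n * n)) := by
        have : (2 : ℝ) ^ n ≤ Real.exp n := by
          rw [← mul_one (n : ℝ), Real.exp_nat_mul]
          gcongr
          linarith [Real.add_one_le_exp 1]
        gcongr
    _ = Real.exp (n + n - a * Real.log n * n) := by
        rw [← Real.exp_add, ← Real.exp_add]; congr 1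
    _ ≤ _ := by
        apply Real.exp_le_exp.2
        rw [div_le_iff₀ ha0] at hl'
        have h3 : Real.log n ≤ n := (Real.log_le_sub_one_of_pos (by linarith)).trans (by linarith)
        nlinarith

theorem natCast_mul_exp_neg_two_mul_log_le (hn : 1 ≤ n) :
    (n : ℝ) * Real.exp (-(2 * Real.log n)) ≤ 1 := by
  have h0 : (1 : ℝ) ≤ n := by exact_mod_cast hn
  have h1 : (0 : ℝ) ≤ Real.log n := Real.log_nonneg h0
  nth_rewrite 1 [← Real.exp_log (show (0 : ℝ) < n by linarith)]
  rw [← Real.exp_add, Real.exp_le_one_iff]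
  linarith

theorem rare_not_sparse (hε : 0 < ε) {γ : ℝ} (hγ : 0 < γ) :
    Rare fun n σ => ∃ m ≤ Fintype.card (EdgeType n), startTime ε n ≤ m ∧
      ∃ Z : Finset (Fin n), (#Z : ℝ) ≤ Real.exp (-(52 / γ)) * n ∧
        γ * aveDeg n m * #Z < (pairCount (processGraph σ m) Z Z : ℝ) := by
  refine rare_exists_edges (B := fun n m σ => ∃ Z : Finset (Fin n),
    (#Z : ℝ) ≤ Real.exp (-(52 / γ)) * n ∧
      γ * aveDeg n m * #Z < (pairCount (processGraph σ m) Z Z : ℝ)) ?_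
  filter_upwards [eventually_ge_atTop 2, eventually_le_log 1] with n hn hl m hm hsm
  have hn' : (2 : ℝ) ≤ n := by exact_mod_cast hn
  have hD := half_log_le_aveDeg hε (by omega) hsm
  refine (pr_exists_finset_le _ (2 * Real.log n) (4 * Real.log n) fun Z => ?_).trans
    (Real.exp_le_exp.2 ?_)
  · refine pr_and_const_le _ _ (Real.exp_pos _).le fun hZ => ?_
    rcases Z.eq_empty_or_nonempty with rfl | hne
    · rw [pr_false (fun σ => by simp [pairCount])]
      exact (Real.exp_pos _).le
    have hz : (1 : ℝ) ≤ #Z := by exact_mod_cast hne.card_pos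
    have hzn : (#Z : ℝ) ≤ n := by
      have := card_le_univ Z
      rw [Fintype.card_fin] at this
      exact_mod_cast this
    have hx : (0 : ℝ) ≤ n / #Z - 1 := by
      rw [sub_nonneg, one_le_div (by linarith)]; exact hzn
    refine (pr_lt_pairCount_self hn hm Z hx _).trans (Real.exp_le_exp.2 ?_)
    have h1 : (n / #Z - 1) * (aveDeg n m / n) * #Z ^ 2 ≤ aveDeg n m * #Z := by
      have : (n / #Z - 1 : ℝ) * (aveDeg n m / n) * #Z ^ 2 =
          aveDeg n m * #Z - (aveDeg n m / n) * #Z ^ 2 := by field_simp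
      rw [this]
      have : 0 ≤ (aveDeg n m / n) * (#Z : ℝ) ^ 2 := by have := aveDeg_nonneg (n := n) (m := m); positivity
      linarith
    have h2 : 52 / γ ≤ Real.log (1 + (n / #Z - 1)) := by
      rw [add_sub_cancel, Real.le_log_iff_exp_le (by positivity), le_div_iff₀ (by linarith)]
      rw [Real.exp_neg, ← div_eq_inv_mul, le_div_iff₀ (Real.exp_pos _)] at hZ
      linarith
    have h3 := mul_le_mul_of_nonneg_left h2
      (show 0 ≤ γ * aveDeg n m * #Z / 2 / 2 by have := aveDeg_nonneg (n := n) (m := m); positivity)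
    have h4 : γ * aveDeg n m * #Z / 2 / 2 * (52 / γ) = 13 * (aveDeg n m * #Z) := by
      field_simp; ring
    have h5 : Real.log n / 2 * #Z ≤ aveDeg n m * #Z := by gcongr
    nlinarith
  · have := natCast_mul_exp_neg_two_mul_log_le (n := n) (by omega)
    linarith

/-- The number of edges between `X` and its complement is far from what is expected. -/
def BadCut (θ : ℝ) (m : ℕ) (X : Finset (Fin n)) (σ : ProcessSpace n) : Prop :=
  (pairCount (processGraph σ m) X Xᶜ : ℝ) ≤ (1 - θ) * (aveDeg n m * #X) ∨
    (1 + θ) * (aveDeg n m * #X) ≤ (pairCount (processGraph σ m) X Xᶜ : ℝ)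

theorem pr_badCut_le (hn : 2 ≤ n) (hm : m ≤ Fintype.card (EdgeType n)) {θ : ℝ} (h0 : 0 ≤ θ)
    (h1 : θ ≤ 1) {X : Finset (Fin n)} (hne : X.Nonempty) (hX : (#X : ℝ) ≤ θ / 4 * n) :
    pr (BadCut θ m X) ≤ Real.exp (1 - θ ^ 2 * (aveDeg n m * #X) / 8) := by
  refine (pr_or_le _ _).trans ?_
  have e1 := pr_cut_le hn hm h0 h1 hX
  have e2 := pr_le_cut hn hm h0 h1 hne
  have e3 : (2 : ℝ) ≤ Real.exp 1 := by linarith [Real.add_one_le_exp 1]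
  rw [sub_eq_add_neg (1 : ℝ) (θ ^ 2 * (aveDeg n m * #X) / 8), Real.exp_add]
  have e4 := mul_le_mul_of_nonneg_right e3 (Real.exp_pos (-(θ ^ 2 * (aveDeg n m * #X) / 8))).le
  linarith

theorem rare_badCut (hε : 0 < ε) {θ s : ℝ} (h0 : 0 < θ) (h1 : θ ≤ 1) (hs : s = θ ^ 2 / 64) :
    Rare fun n σ => ∃ m ≤ Fintype.card (EdgeType n), startTime ε n ≤ m ∧
      ∃ X : Finset (Fin n), #X = ⌈Real.exp ((1 - s) * Real.log n)⌉₊ ∧ BadCut θ m X σ := by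
  refine rare_exists_edges (B := fun n m σ => ∃ X : Finset (Fin n),
    #X = ⌈Real.exp ((1 - s) * Real.log n)⌉₊ ∧ BadCut θ m X σ) ?_
  have hs0 : 0 < s := by rw [hs]; positivity
  have hs1 : s < 1 := by rw [hs]; nlinarith
  filter_upwards [eventually_ge_atTop 2, eventually_le_log 1, eventually_le_log (2 / s),
    eventually_mul_log_le_exp (8 / θ) hs0, eventually_mul_log_le_exp 1 (sub_pos.2 hs1),
    eventually_exp_log] with n hn hl hl' h2 h3 h4 m hm hsm
  have hn' : (2 : ℝ) ≤ n := by exact_mod_cast hn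
  have hD := half_log_le_aveDeg hε (by omega) hsm
  rw [div_le_iff₀ hs0] at hl'
  set w := Real.exp ((1 - s) * Real.log n) with hw
  have hw1 : 1 ≤ w := by rw [hw, Real.one_le_exp_iff]; exact mul_nonneg (by linarith) (by linarith)
  set z := ⌈w⌉₊ with hz
  have hzw : w ≤ z := Nat.le_ceil _
  have hzw' : (z : ℝ) ≤ 2 * w := by
    have := Nat.ceil_lt_add_one (a := w) (by linarith)
    linarith
  have hwn : Real.exp (s * Real.log n) * w = n := by
    rw [hw, ← Real.exp_add, ← add_mul, add_sub_cancel, one_mul, h4]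
  have hzn : (z : ℝ) ≤ θ / 4 * n := by
    have h5 : 8 / θ ≤ Real.exp (s * Real.log n) := by
      have : 8 / θ * 1 ≤ 8 / θ * Real.log n := by gcongr
      linarith
    have h6 := mul_le_mul_of_nonneg_right h5 (show 0 ≤ w by linarith)
    rw [hwn, div_mul_eq_mul_div, div_le_iff₀ h0] at h6
    linarith
  refine (pr_exists_finset_le _ (s * Real.log n) (3 * (s * Real.log n) * z - 1) fun Z => ?_).trans
    (Real.exp_le_exp.2 ?_)
  · refine pr_and_const_le _ _ (Real.exp_pos _).le fun hZ => ?_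
    have hne : Z.Nonempty := by
      rw [← card_pos, hZ]
      exact Nat.ceil_pos.2 (by linarith)
    refine (pr_badCut_le hn hm h0.le h1 hne (by rw [hZ]; exact hzn)).trans (Real.exp_le_exp.2 ?_)
    rw [hZ]
    have h5 : Real.log n / 2 * z ≤ aveDeg n m * z := by gcongr
    have h6 := mul_le_mul_of_nonneg_left h5 (show 0 ≤ 8 * s by linarith)
    have h7 : θ ^ 2 = 64 * s := by rw [hs]; ring
    rw [h7]
    linarith
  · have h5 : (n : ℝ) * Real.exp (-(s * Real.log n)) = w := by
      rw [hw]
      nth_rewrite 1 [← h4]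
      rw [← Real.exp_add]
      congr 1
      ring
    rw [h5]
    nlinarith

theorem rare_badCut_singleton {L : ℕ} {θ : ℝ} (hε : 0 < ε) (h0 : 0 < θ) (h1 : θ ≤ 1)
    (hL : 80 ≤ θ ^ 2 * L) :
    Rare fun n σ => ∃ m ≤ Fintype.card (EdgeType n), L * startTime ε n ≤ m ∧
      ∃ X : Finset (Fin n), #X = 1 ∧ BadCut θ m X σ := by
  refine rare_exists_edges (B := fun n m σ => ∃ X : Finset (Fin n), #X = 1 ∧ BadCut θ m X σ) ?_
  filter_upwards [eventually_ge_atTop 2, eventually_le_log 2, eventually_ge_atTop ⌈4 / θ⌉₊,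
    eventually_exp_log] with n hn hl hn2 hlog m hm hsm
  have hn' : (2 : ℝ) ≤ n := by exact_mod_cast hn
  have hn2' : 1 ≤ θ / 4 * n := by
    have := Nat.ceil_le.1 hn2
    rw [div_le_iff₀ h0] at this
    linarith
  have hD : L / 2 * Real.log n ≤ aveDeg n m := by
    have e1 := half_log_le_aveDeg hε (n := n) (by omega) le_rfl
    have e2 := aveDeg_mono (n := n) hsm
    have e3 : aveDeg n (L * startTime ε n) = L * aveDeg n (startTime ε n) := by
      unfold aveDeg; push_cast; ring
    rw [e3] at e2
    have := mul_le_mul_of_nonneg_left e1 (Nat.cast_nonneg (α := ℝ) L)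
    linarith
  refine (pr_exists_finset_le _ (Real.log n) (4 * Real.log n - 1) fun Z => ?_).trans
    (Real.exp_le_exp.2 ?_)
  · refine pr_and_const_le _ _ (Real.exp_pos _).le fun hZ => ?_
    have hne : Z.Nonempty := by rw [← card_pos, hZ]; exact one_pos
    refine (pr_badCut_le hn hm h0.le h1 hne (by rw [hZ]; simpa using hn2')).trans
      (Real.exp_le_exp.2 ?_)
    rw [hZ]
    push_cast
    have h5 := mul_le_mul_of_nonneg_left hD (sq_nonneg θ)
    have h6 := mul_le_mul_of_nonneg_right hL (show 0 ≤ Real.log n / 2 by linarith)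
    linarith
  · rw [Real.exp_neg, hlog, mul_inv_cancel₀ (by linarith)]
    linarith

theorem rare_not_verySparse (hε : 0 < ε) (hε' : ε ≤ 1 / 2) {L C : ℕ} {s : ℝ} (hs : 0 < s)
    (hC : 48 ≤ C * s) :
    Rare fun n σ => ∃ Z : Finset (Fin n), (#Z : ℝ) ≤ Real.exp ((1 - s / 2) * Real.log n) ∧
      C * #Z < (pairCount (processGraph σ (L * startTime ε n)) Z Z : ℝ) := by
  refine rare_of_le (tendsto_exp_neg_mul_log zero_lt_one) ?_
  filter_upwards [eventually_ge_atTop 2, eventually_le_log 2, eventually_exp_log,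
    eventually_mul_startTime_le L hε hε',
    eventually_mul_log_le_exp (2 * L) (show 0 < s / 4 by linarith)] with n hn hl hlog hm hL
  have hn' : (2 : ℝ) ≤ n := by exact_mod_cast hn
  have hD := aveDeg_mul_startTime_le L hε hε' hl hn
  have hD0 := aveDeg_nonneg (n := n) (m := L * startTime ε n)
  refine (pr_exists_finset_le _ (2 * Real.log n) (3 * Real.log n) fun Z => ?_).trans
    (Real.exp_le_exp.2 ?_)
  · refine pr_and_const_le _ _ (Real.exp_pos _).le fun hZ => ?_
    rcases Z.eq_empty_or_nonempty with rfl | hne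
    · rw [pr_false (fun σ => by simp [pairCount])]
      exact (Real.exp_pos _).le
    have hz : (1 : ℝ) ≤ #Z := by exact_mod_cast hne.card_pos
    refine (pr_lt_pairCount_self hn hm Z (Real.exp_pos (s / 4 * Real.log n)).le _).trans
      (Real.exp_le_exp.2 ?_)
    have h1 : Real.exp (s / 4 * Real.log n) * (aveDeg n (L * startTime ε n) / n) * #Z ^ 2 ≤ #Z := by
      have e1 : Real.exp (s / 4 * Real.log n) * (aveDeg n (L * startTime ε n) / n) * #Z ≤
          Real.exp (s / 4 * Real.log n) * (Real.exp (s / 4 * Real.log n) / n) *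
            Real.exp ((1 - s / 2) * Real.log n) := by
        gcongr
        exact hD.trans hL
      have e2 : Real.exp (s / 4 * Real.log n) * (Real.exp (s / 4 * Real.log n) / n) *
            Real.exp ((1 - s / 2) * Real.log n) = 1 := by
        nth_rewrite 3 [← hlog]
        rw [← Real.exp_sub, ← Real.exp_add, ← Real.exp_add, Real.exp_eq_one_iff]
        ring
      rw [e2] at e1
      have := mul_le_mul_of_nonneg_right e1 (show (0 : ℝ) ≤ #Z by linarith)
      linarith
    have h2 : s / 4 * Real.log n ≤ Real.log (1 + Real.exp (s / 4 * Real.log n)) := by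
      rw [Real.le_log_iff_exp_le (by positivity)]
      linarith
    have h3 := mul_le_mul_of_nonneg_left h2 (show (0 : ℝ) ≤ C * #Z / 2 by positivity)
    have h4 := mul_le_mul_of_nonneg_right hC (show (0 : ℝ) ≤ #Z * Real.log n / 8 by positivity)
    nlinarith
  · have := natCast_mul_exp_neg_two_mul_log_le (n := n) (by omega)
    linarith

theorem rare_tiny_path (hε : 0 < ε) (hε' : ε ≤ 1 / 2) {L ℓ : ℕ} (hℓ : 0 < ℓ) (hℓ' : ℓ ≤ 4)
    {δ : ℝ} (hδ : 64 * δ * L * -Real.log (ε / 8) ≤ ε) :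
    Rare fun n σ => ∃ t : Fin (ℓ + 1) → Fin n, t.Injective ∧
      (∀ i : Fin ℓ, (processGraph σ (L * startTime ε n)).Adj (t i.castSucc) (t i.succ)) ∧
      (deg (processGraph σ (startTime ε n)) (t 0) : ℝ) < 4 * δ * L * Real.log n ∧
      (deg (processGraph σ (startTime ε n)) (t (Fin.last ℓ)) : ℝ) < 4 * δ * L * Real.log n := by
  refine rare_of_le (tendsto_exp_neg_mul_log (a := ε / 4) (by positivity)) ?_
  filter_upwards [eventually_ge_atTop 2, eventually_le_log 2, eventually_exp_log,
    eventually_mul_startTime_le L hε hε', eventually_mul_startTime_le 1 hε hε',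
    eventually_mul_log_le_exp ((ε / 8)⁻¹ * (4 * L)) (show 0 < ε / 16 by positivity),
    eventually_ge_atTop ⌈80 / ε⌉₊]
    with n hn hl hlog hM hm hL hnε
  rw [one_mul] at hm
  have hn' : (2 : ℝ) ≤ n := by exact_mod_cast hn
  have hnε' : 80 ≤ ε * n := by
    have := Nat.ceil_le.1 hnε
    rw [div_le_iff₀ hε] at this
    linarith
  have hD := aveDeg_mul_startTime_le L hε hε' hl hn
  have hD0 := aveDeg_nonneg (n := n) (m := L * startTime ε n)
  have hd := le_aveDeg_of_startTime_le (ε := ε) (n := n) (by omega) le_rfl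
  have hd0 := aveDeg_nonneg (n := n) (m := startTime ε n)
  have hℓr : (ℓ : ℝ) ≤ 4 := by exact_mod_cast hℓ'
  have hb : ∀ t : Fin (ℓ + 1) → Fin n, pr (fun σ : ProcessSpace n => t.Injective ∧
      (∀ i : Fin ℓ, (processGraph σ (L * startTime ε n)).Adj (t i.castSucc) (t i.succ)) ∧
      (deg (processGraph σ (startTime ε n)) (t 0) : ℝ) < 4 * δ * L * Real.log n ∧
      (deg (processGraph σ (startTime ε n)) (t (Fin.last ℓ)) : ℝ) < 4 * δ * L * Real.log n) ≤
      (Real.exp (ε / 16 * Real.log n) / n) ^ ℓ * Real.exp (-((1 + ε / 2) * Real.log n)) := by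
    intro t
    refine pr_and_const_le _ _ (by positivity) fun ht => ?_
    refine (pr_path_le hn hm hM hℓ ht (η := ε / 8) (by positivity) (by linarith)).trans ?_
    gcongr
    · have : (0 : ℝ) < n - 1 := by linarith
      positivity
    · calc (ε / 8)⁻¹ * (aveDeg n (L * startTime ε n) / (n - 1))
          ≤ (ε / 8)⁻¹ * (2 * L * Real.log n / (n / 2)) := by
            gcongr
            linarith
        _ = (ε / 8)⁻¹ * (4 * L) * Real.log n / n := by field_simp; ring
        _ ≤ _ := by gcongr
    · have h1 : (1 - ε / 16) * (n - 1) ≤ n - (ℓ + 1) := by nlinarith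
      have h2 : (1 - ε / 8) * (aveDeg n (startTime ε n) / (n - 1)) * (2 * ((1 - ε / 16) * (n - 1))) ≤
          (1 - ε / 8) * (aveDeg n (startTime ε n) / (n - 1)) * (2 * (n - (ℓ + 1))) := by
        have : 0 ≤ (1 - ε / 8) * (aveDeg n (startTime ε n) / (n - 1)) :=
          mul_nonneg (by linarith) (div_nonneg hd0 (by linarith))
        gcongr
      have h3 : (1 - ε / 8) * (aveDeg n (startTime ε n) / (n - 1)) * (2 * ((1 - ε / 16) * (n - 1))) =
          (1 - ε / 8) * (1 - ε / 16) * 2 * aveDeg n (startTime ε n) := by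
        have : (n : ℝ) - 1 ≠ 0 := by linarith
        field_simp
      have h4 : (1 - ε / 8) * (1 - ε / 16) * 2 * ((1 + ε) / 2 * Real.log n) ≤
          (1 - ε / 8) * (1 - ε / 16) * 2 * aveDeg n (startTime ε n) := by
        have : 0 ≤ (1 - ε / 8) * (1 - ε / 16) * 2 :=
          mul_nonneg (mul_nonneg (by linarith) (by linarith)) (by norm_num)
        gcongr
      have h5 : 1 + 5 / 8 * ε ≤ (1 - ε / 8) * (1 - ε / 16) * (1 + ε) := by
        nlinarith [mul_pos hε hε, pow_pos hε 3]
      have h6 := mul_le_mul_of_nonneg_right h5 (show 0 ≤ Real.log n by linarith)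
      have h7 := mul_le_mul_of_nonneg_right hδ (show 0 ≤ Real.log n / 8 by linarith)
      linarith
  calc _ ≤ pr (fun σ : ProcessSpace n => ∃ t ∈ (univ : Finset (Fin (ℓ + 1) → Fin n)), t.Injective ∧
      (∀ i : Fin ℓ, (processGraph σ (L * startTime ε n)).Adj (t i.castSucc) (t i.succ)) ∧
      (deg (processGraph σ (startTime ε n)) (t 0) : ℝ) < 4 * δ * L * Real.log n ∧
      (deg (processGraph σ (startTime ε n)) (t (Fin.last ℓ)) : ℝ) < 4 * δ * L * Real.log n) :=
        pr_mono fun σ ⟨t, h⟩ => ⟨t, mem_univ _, h⟩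
    _ ≤ ∑ t : Fin (ℓ + 1) → Fin n,
        (Real.exp (ε / 16 * Real.log n) / n) ^ ℓ * Real.exp (-((1 + ε / 2) * Real.log n)) :=
        (pr_exists_le _ _).trans (sum_le_sum fun t _ => hb t)
    _ = n ^ (ℓ + 1) * ((Real.exp (ε / 16 * Real.log n) / n) ^ ℓ *
          Real.exp (-((1 + ε / 2) * Real.log n))) := by
        rw [sum_const, card_univ, Fintype.card_fun, Fintype.card_fin, Fintype.card_fin,
          nsmul_eq_mul]
        push_cast; rfl
    _ = Real.exp (ε / 16 * Real.log n) ^ ℓ * (n * Real.exp (-((1 + ε / 2) * Real.log n))) := by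
        rw [div_pow, pow_succ]; field_simp
    _ = Real.exp (ℓ * (ε / 16 * Real.log n) + (Real.log n - (1 + ε / 2) * Real.log n)) := by
        rw [Real.exp_add, Real.exp_nat_mul, sub_eq_add_neg, Real.exp_add, hlog]
    _ ≤ _ := by
        apply Real.exp_le_exp.2
        have : (ℓ : ℝ) * (ε / 16 * Real.log n) ≤ 4 * (ε / 16 * Real.log n) := by gcongr
        linarith

end RareEvents

section Assembly
open scoped Classical
open Finset

theorem deg_mono [Fintype V] {G G' : SimpleGraph V} (h : G ≤ G') (v : V) : deg G v ≤ deg G' v := by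
  rw [deg_eq_card, deg_eq_card]
  exact card_le_card (monotone_filter_right _ fun w _ hw => h hw)

theorem pairCount_compl_add_self [Fintype V] [DecidableEq V] (G : SimpleGraph V) (X : Finset V) :
    pairCount G X Xᶜ + pairCount G X X = ∑ x ∈ X, deg G x := by
  rw [pairCount_eq_sum, pairCount_eq_sum, ← sum_add_distrib]
  refine sum_congr rfl fun x _ => ?_
  rw [deg_eq_card, ← card_union_of_disjoint (disjoint_filter_filter disjoint_compl_left),
    ← filter_union, union_comm, union_compl]

theorem card_atypSet_le [Fintype V] [DecidableEq V] {G : SimpleGraph V} {D θ : ℝ} {z : ℕ} (hD : 0 ≤ D) (hθ : 0 ≤ θ)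
    (hlo : ∀ X : Finset V, #X = z → (1 - θ) * (D * #X) < pairCount G X Xᶜ)
    (hhi : ∀ X : Finset V, #X = z → (pairCount G X Xᶜ : ℝ) < (1 + θ) * (D * #X))
    (hs : ∀ X : Finset V, #X = z → (pairCount G X X : ℝ) ≤ θ * D * #X) :
    #(atypSet G (2 * θ) D) ≤ 2 * (z - 1) := by
  have hsum : ∀ X : Finset V,
      (pairCount G X Xᶜ : ℝ) + pairCount G X X = ∑ x ∈ X, (deg G x : ℝ) := fun X => by
    exact_mod_cast pairCount_compl_add_self G X
  have h1 : #({v | (deg G v : ℝ) < (1 - 2 * θ) * D} : Finset V) < z := by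
    by_contra! h
    obtain ⟨X, hX, hXz⟩ := exists_subset_card_eq h
    have e1 := sum_le_card_nsmul X (fun x => (deg G x : ℝ)) _ fun x hx =>
      (mem_filter.1 (hX hx)).2.le
    rw [← hsum, nsmul_eq_mul] at e1
    have e2 := hlo X hXz
    have e3 : 0 ≤ θ * D * #X := by positivity
    have e4 : (0 : ℝ) ≤ pairCount G X X := by positivity
    nlinarith
  have h2 : #({v | (1 + 2 * θ) * D < deg G v} : Finset V) < z := by
    by_contra! h
    obtain ⟨X, hX, hXz⟩ := exists_subset_card_eq h
    have e1 := card_nsmul_le_sum X (fun x => (deg G x : ℝ)) _ fun x hx =>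
      (mem_filter.1 (hX hx)).2.le
    rw [← hsum, nsmul_eq_mul] at e1
    have e2 := hhi X hXz
    have e3 := hs X hXz
    nlinarith
  unfold atypSet
  rw [filter_or]
  refine (card_union_le _ _).trans ?_
  omega

variable {n m : ℕ}

theorem two_mul_ncard_edgeSet {σ : ProcessSpace n} (hn : 0 < n)
    (hm : m ≤ Fintype.card (EdgeType n)) :
    aveDeg n m * Fintype.card (Fin n) = 2 * (processGraph σ m).edgeSet.ncard := by
  have h1 : (processGraph σ m).edgeSet =
      (fun i => (σ i : Sym2 (Fin n))) '' (slots n m : Set (Fin (Fintype.card (EdgeType n)))) := by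
    unfold processGraph
    rw [SimpleGraph.edgeSet_fromEdgeSet]
    ext e
    simp only [Set.mem_sdiff, Set.mem_ofPred_eq, Set.mem_image, mem_coe, mem_slots]
    constructor
    · rintro ⟨h, -⟩
      exact h
    · rintro ⟨i, hi, rfl⟩
      exact ⟨⟨i, hi, rfl⟩, (σ i).2⟩
  have h2 : (fun i => (σ i : Sym2 (Fin n))).Injective := Subtype.val_injective.comp σ.injective
  rw [h1, Set.ncard_image_of_injective _ h2,
    Set.ncard_coe_finset, card_slots hm, Fintype.card_fin]
  unfold aveDeg
  have : (n : ℝ) ≠ 0 := by positivity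
  field_simp

theorem processGraph_of_card_le (σ : ProcessSpace n) (h : Fintype.card (EdgeType n) ≤ m) :
    processGraph σ m = processGraph σ (Fintype.card (EdgeType n)) := by
  ext u v
  rw [processGraph_adj, processGraph_adj]
  refine exists_congr fun _ => ?_
  rw [mem_slots, mem_slots]
  exact iff_of_true ((Fin.is_lt _).trans_le h) (Fin.is_lt _)

/-- An injective path `t` in `G'` both of whose ends have degree less than `τ` in `G`. -/
def TinyPath (G G' : SimpleGraph (Fin n)) (τ : ℝ) {ℓ : ℕ} (t : Fin (ℓ + 1) → Fin n) : Prop :=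
  t.Injective ∧ (∀ i : Fin ℓ, G'.Adj (t i.castSucc) (t i.succ)) ∧
    (deg G (t 0) : ℝ) < τ ∧ (deg G (t (Fin.last ℓ)) : ℝ) < τ

theorem goodGraph_processGraph {M m₀ z C : ℕ} {σ : ProcessSpace n} {ε c c₀ δt τ : ℝ} (hn : 0 < n)
    (hε : 0 < ε) (hε' : ε ≤ 1 / 2) (hm : m ≤ Fintype.card (EdgeType n)) (hm₀ : m₀ ≤ m)
    (hz : 1 ≤ z) (hzc₀ : z ≤ c₀ * n) (hzc : 2 * z ≤ c * n) (hδt : 0 ≤ δt) (hδt' : 2 * δt ≤ 1 / 2)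
    (hτ : 2 * δt * aveDeg n M ≤ τ)
    (dense : ∀ X Y : Finset (Fin n), Disjoint X Y → c * n ≤ #X → c * n ≤ #Y →
      (1 - ε / 4) * (aveDeg n m / n * (#X * #Y)) < pairCount (processGraph σ m) X Y)
    (sparse : ∀ Z : Finset (Fin n), (#Z : ℝ) ≤ c₀ * n →
      (pairCount (processGraph σ m) Z Z : ℝ) ≤ ε / 16 * aveDeg n m * #Z)
    (cut : ∀ X : Finset (Fin n), #X = z → ¬ BadCut (ε / 16) m X σ)
    (cut_one : M ≤ m → ∀ X : Finset (Fin n), #X = 1 → ¬ BadCut (ε / 16) m X σ)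
    (verySparse : ∀ Z : Finset (Fin n), #Z ≤ (8 * C + 1) * (2 * z) →
      pairCount (processGraph σ M) Z Z ≤ C * #Z)
    (tiny_one : ∀ t : Fin 2 → Fin n, ¬ TinyPath (processGraph σ m₀) (processGraph σ M) τ t)
    (tiny_two : ∀ t : Fin 3 → Fin n, ¬ TinyPath (processGraph σ m₀) (processGraph σ M) τ t)
    (tiny_four : ∀ t : Fin 5 → Fin n, ¬ TinyPath (processGraph σ m₀) (processGraph σ M) τ t) :
    GoodGraph (processGraph σ m) ε c c₀ (aveDeg n m) δt C := by
  have hD : 0 ≤ aveDeg n m := aveDeg_nonneg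
  have h8 : ε / 8 = 2 * (ε / 16) := by ring
  have hatyp : ∀ y : ℕ, (y : ℝ) ≤ z → (∀ X : Finset (Fin n), #X = y → ¬ BadCut (ε / 16) m X σ) →
      #(atypSet (processGraph σ m) (ε / 8) (aveDeg n m)) ≤ 2 * (y - 1) := by
    intro y hy h
    rw [h8]
    refine card_atypSet_le hD (by linarith) (fun X hX => ?_) (fun X hX => ?_) fun X hX => ?_
    · exact lt_of_not_ge fun h' => h X hX (Or.inl h')
    · exact lt_of_not_ge fun h' => h X hX (Or.inr h')
    · exact sparse X (by rw [hX]; linarith)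
  have hcard := hatyp z le_rfl cut
  have hempty : M ≤ m → atypSet (processGraph σ m) (ε / 8) (aveDeg n m) = ∅ := fun h => by
    rw [← card_eq_zero]
    simpa using hatyp 1 (by exact_mod_cast hz) (cut_one h)
  have htiny : ∀ v, (deg (processGraph σ m) v : ℝ) < 2 * δt * aveDeg n m →
      m ≤ M ∧ (deg (processGraph σ m₀) v : ℝ) < τ := by
    intro v hv
    have hmM : m ≤ M := by
      by_contra! h
      have e1 : v ∈ atypSet (processGraph σ m) (ε / 8) (aveDeg n m) := by
        refine mem_filter.2 ⟨mem_univ _, Or.inl (hv.trans_le ?_)⟩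
        gcongr
        linarith
      rw [hempty h.le] at e1
      exact notMem_empty _ e1
    refine ⟨hmM, ?_⟩
    have e1 : (deg (processGraph σ m₀) v : ℝ) ≤ deg (processGraph σ m) v := by
      exact_mod_cast deg_mono (processGraph_mono σ hm₀) v
    have e2 : 2 * δt * aveDeg n m ≤ 2 * δt * aveDeg n M := by
      have := aveDeg_mono (n := n) hmM
      gcongr
    linarith
  refine ⟨two_mul_ncard_edgeSet hn hm, ?_, ?_, ?_, ?_, ?_, ?_, ?_⟩
  · rw [Fintype.card_fin]
    have e1 : (#(atypSet (processGraph σ m) (ε / 8) (aveDeg n m)) : ℝ) ≤ 2 * z := by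
      exact_mod_cast hcard.trans (by omega)
    linarith
  · intro X Y hXY hX hY
    rw [Fintype.card_fin] at hX hY ⊢
    exact (dense X Y hXY hX hY).le
  · intro Z hZ
    rw [Fintype.card_fin] at hZ
    refine (sparse Z hZ).trans ?_
    have : ε / 16 * aveDeg n m ≤ aveDeg n m / 32 := by nlinarith
    gcongr
  · intro Z hZ
    rcases le_total m M with h | h
    · have e1 : pairCount (processGraph σ m) Z Z ≤ pairCount (processGraph σ M) Z Z :=
        card_le_card (monotone_filter_right _ fun p _ hp => processGraph_mono σ h hp)
      refine e1.trans (verySparse Z (hZ.trans ?_))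
      gcongr
      omega
    · rw [hempty h, card_empty, mul_zero, Nat.le_zero, card_eq_zero] at hZ
      simp [hZ, pairCount]
  · intro u v hu hv huv
    obtain ⟨h, hu⟩ := htiny u hu
    have hG := processGraph_mono σ h
    refine tiny_one ![u, v] ⟨?_, ?_, hu, (htiny v hv).2⟩
    · rw [← List.nodup_ofFn]
      simpa using huv.ne
    · intro i
      fin_cases i
      exact hG huv
  · intro u v hu hv huv a h1 h2
    obtain ⟨h, hu⟩ := htiny u hu
    have hG := processGraph_mono σ h
    refine tiny_two ![u, a, v] ⟨?_, ?_, hu, (htiny v hv).2⟩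
    · rw [← List.nodup_ofFn]
      simp [h1.ne, h2.ne, huv]
    · intro i
      fin_cases i
      exacts [hG h1, hG h2]
  · intro u v hu hv a b c hnd h1 h2 h3 h4
    obtain ⟨h, hu⟩ := htiny u hu
    have hG := processGraph_mono σ h
    refine tiny_four ![u, a, b, c, v] ⟨?_, ?_, hu, (htiny v hv).2⟩
    · rw [← List.nodup_ofFn]
      simpa using hnd
    · intro i
      fin_cases i
      exacts [hG h1, hG h2, hG h3, hG h4]

theorem StrongResilient.mono_left {G : SimpleGraph V} {α α' δt δa : ℝ} {Kt Ka : ℕ}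
    {P : SimpleGraph V → Prop} (h : StrongResilient G α' δt Kt δa Ka P) (hα : α ≤ α') :
    StrongResilient G α δt Kt δa Ka P := fun H hH h1 h2 h3 =>
  h H hH h1 h2 fun v hv hv' => (h3 v hv hv').trans (by gcongr)

set_option maxHeartbeats 1000000 in
theorem exists_rare_not_strongResilient {ε : ℝ} (hε : 0 < ε) (hε' : ε ≤ 1 / 2) :
    ∃ δt δa : ℝ, ∃ K : ℕ, 0 < δt ∧ 0 < δa ∧ 0 < K ∧
      Rare fun n σ => ∃ m, startTime ε n ≤ m ∧
        ¬ StrongResilient ((processGraph σ m).induce (processGraph σ m).support)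
          (1 / 2 - ε) δt 1 δa K HasNearPerfectMatching := by
  set θ := ε / 16 with hθ
  have hθ0 : 0 < θ := by positivity
  have hθ1 : θ ≤ 1 := by linarith
  obtain ⟨s, hs⟩ : ∃ s, s = θ ^ 2 / 64 := ⟨_, rfl⟩
  have hs0 : 0 < s := by rw [hs]; positivity
  have hs1 : s < 1 := by rw [hs]; nlinarith
  obtain ⟨L, hL⟩ := exists_nat_ge (80 / θ ^ 2)
  rw [div_le_iff₀' (by positivity)] at hL
  have hL0 : (0 : ℝ) < L := by
    by_contra! h
    nlinarith [sq_nonneg θ]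
  obtain ⟨C, hC⟩ := exists_nat_ge (48 / s)
  rw [div_le_iff₀ hs0] at hC
  have hC0 : (0 : ℝ) < C := by
    by_contra! h
    nlinarith
  obtain ⟨c₀, hc₀⟩ : ∃ c₀, c₀ = Real.exp (-(52 / θ)) := ⟨_, rfl⟩
  have hc₀0 : 0 < c₀ := hc₀ ▸ Real.exp_pos _
  obtain ⟨c₁, hc₁⟩ : ∃ c₁, c₁ = min (c₀ / 2) (ε / 4) := ⟨_, rfl⟩
  have hc₁0 : 0 < c₁ := by rw [hc₁]; positivity
  obtain ⟨c, hc⟩ : ∃ c, c = min (ε / 32) (ε * c₁ / 64) := ⟨_, rfl⟩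
  have hc0 : 0 < c := by rw [hc]; positivity
  have hlog : 0 < -Real.log (ε / 8) :=
    neg_pos.2 (Real.log_neg (by positivity) (by linarith))
  obtain ⟨δ, hδ⟩ : ∃ δ, δ = min (1 / 4) (ε / (64 * L * -Real.log (ε / 8))) := ⟨_, rfl⟩
  have hδ0 : 0 < δ := by rw [hδ]; positivity
  have hδ1 : δ ≤ 1 / 4 := hδ ▸ min_le_left _ _
  have hδL : 64 * δ * L * -Real.log (ε / 8) ≤ ε := by
    have h : δ ≤ ε / (64 * L * -Real.log (ε / 8)) := hδ ▸ min_le_right _ _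
    rw [le_div_iff₀ (by positivity)] at h
    linarith
  refine ⟨δ, ε / 4, 8 * C + 1, hδ0, by positivity, by omega, ?_⟩
  refine Rare.mono ((rare_not_dense hε (θ := ε / 4) (by positivity) (by linarith) hc0).or
    ((rare_not_sparse hε hθ0).or ((rare_badCut hε hθ0 hθ1 hs).or
    ((rare_badCut_singleton hε hθ0 hθ1 hL).or ((rare_not_verySparse hε hε' (L := L) hs0 hC).or
    ((rare_tiny_path hε hε' one_pos (by norm_num) hδL).or
    ((rare_tiny_path hε hε' two_pos (by norm_num) hδL).or
    (rare_tiny_path hε hε' four_pos le_rfl hδL)))))))) ?_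
  filter_upwards [eventually_ge_atTop 2, eventually_le_log 32, eventually_mul_startTime_le 1 hε hε',
    eventually_exp_log, eventually_mul_log_le_exp (2 / c₀) hs0,
    eventually_mul_log_le_exp (4 / c) hs0,
    eventually_mul_log_le_exp ((8 * C + 1) * 4) (half_pos hs0)]
    with n hn hl hN hexp hc₀n hcn hCn σ
  rw [one_mul] at hN
  rintro ⟨m', hm', hres⟩
  by_contra hgood
  obtain ⟨m, hm, hmN, hGm⟩ : ∃ m, startTime ε n ≤ m ∧ m ≤ Fintype.card (EdgeType n) ∧
      processGraph σ m' = processGraph σ m := by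
    rcases le_total m' (Fintype.card (EdgeType n)) with h | h
    · exact ⟨m', hm', h, rfl⟩
    · exact ⟨_, hN, le_rfl, processGraph_of_card_le σ h⟩
  rw [hGm] at hres
  simp only [not_or] at hgood
  obtain ⟨g1, g2, g3, g4, g5, g6, g7, g8⟩ := hgood
  set w := Real.exp ((1 - s) * Real.log n) with hw
  have hw1 : 1 ≤ w := by
    rw [hw, Real.one_le_exp_iff]
    exact mul_nonneg (by linarith) (by linarith)
  set z := ⌈w⌉₊ with hz
  have hz1 : 1 ≤ z := Nat.one_le_ceil_iff.2 (by linarith)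
  have hzw : (z : ℝ) ≤ 2 * w := by
    have := Nat.ceil_lt_add_one (a := w) (by linarith)
    linarith
  have hwn : Real.exp (s * Real.log n) * w = n := by
    rw [hw, ← Real.exp_add, ← add_mul, add_sub_cancel, one_mul, hexp]
  have hwn' : Real.exp (s / 2 * Real.log n) * w = Real.exp ((1 - s / 2) * Real.log n) := by
    rw [hw, ← Real.exp_add]
    congr 1
    ring
  have hscale : ∀ {a b : ℝ}, 0 ≤ a → a * Real.log n ≤ b → a * w ≤ b * w := fun ha h =>
    mul_le_mul_of_nonneg_right (by nlinarith) (by linarith)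
  have hzc₀ : z ≤ c₀ * n := by
    have h := hscale (by positivity) hc₀n
    rw [hwn, div_mul_eq_mul_div, div_le_iff₀ hc₀0] at h
    linarith
  have hzc : 2 * z ≤ c * n := by
    have h := hscale (by positivity) hcn
    rw [hwn, div_mul_eq_mul_div, div_le_iff₀ hc0] at h
    linarith
  have hzC : ((8 * C + 1) * (2 * z) : ℝ) ≤ Real.exp ((1 - s / 2) * Real.log n) := by
    have h := hscale (by positivity) hCn
    rw [hwn'] at h
    nlinarith
  have hz1' : (1 : ℝ) ≤ z := by exact_mod_cast hz1
  have hD := half_log_le_aveDeg hε (by omega) hm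
  have hM := aveDeg_mul_startTime_le L hε hε' (by linarith : 2 ≤ Real.log n) hn
  refine hres (GoodGraph.strongResilient (c := c) (c₀ := c₀) (D := aveDeg n m) ?_ hε hε'
    (by linarith) (by exact_mod_cast hC0) hc0 (hc ▸ min_le_left _ _) hc₁0 (hc₁ ▸ min_le_left _ _)
    (hc₁ ▸ min_le_right _ _) (hc ▸ min_le_right _ _)
    (by rw [Fintype.card_fin]; linarith) hδ0 (by linarith))
  refine goodGraph_processGraph (M := L * startTime ε n) (m₀ := startTime ε n) (z := z)
    (τ := 4 * δ * L * Real.log n) (by omega) hε hε' hmN hm hz1 hzc₀ hzc hδ0.le (by linarith)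
    (by nlinarith) ?_ ?_ ?_ ?_ ?_ ?_ ?_ ?_
  · intro X Y hXY hX hY
    exact lt_of_not_ge fun h => g1 ⟨m, hmN, hm, X, Y, ⟨hXY, hX, hY⟩, h⟩
  · intro Z hZ
    exact le_of_not_gt fun h => g2 ⟨m, hmN, hm, Z, hc₀ ▸ hZ, h⟩
  · exact fun X hX h => g3 ⟨m, hmN, hm, X, hX, h⟩
  · exact fun hMm X hX h => g4 ⟨m, hmN, hMm, X, hX, h⟩
  · intro Z hZ
    by_contra! h
    refine g5 ⟨Z, le_trans ?_ hzC, by exact_mod_cast h⟩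
    exact_mod_cast hZ
  · exact fun t ht => g6 ⟨t, ht⟩
  · exact fun t ht => g7 ⟨t, ht⟩
  · exact fun t ht => g8 ⟨t, ht⟩

theorem Rare.tendsto_processMeasure {B B' : ∀ n, ProcessSpace n → Prop} (h : Rare B)
    (hB : ∀ n σ, ¬ B n σ → B' n σ) :
    Tendsto (fun n => processMeasure n {σ | B' n σ}) atTop (nhds 1) := by
  simp only [processMeasure_eq]
  rw [← ENNReal.ofReal_one]
  refine (ENNReal.continuous_ofReal.tendsto _).comp ?_
  have h1 : Tendsto (fun n => 1 - pr (B n)) atTop (nhds 1) := by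
    simpa using tendsto_const_nhds.sub h
  refine tendsto_of_tendsto_of_tendsto_of_le_of_le h1 tendsto_const_nhds (fun n => ?_) fun n => ?_
  · rw [← pr_not]
    exact pr_mono (hB n)
  · have h2 := pr_not (B' n)
    have h3 := pr_nonneg fun σ => ¬ B' n σ
    linarith

end Assembly

theorem statement_12 (ε : ℝ) (hε : 0 < ε) :
    ∃ δt δa : ℝ, ∃ K : ℕ, 0 < δt ∧ 0 < δa ∧ 0 < K ∧
      Tendsto (fun n : ℕ =>
        processMeasure n {σ : ProcessSpace n |
          ∀ m : ℕ, (1 + ε) / 4 * n * Real.log n ≤ (m : ℝ) →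
            StrongResilient ((processGraph σ m).induce (processGraph σ m).support)
              (1 / 2 - ε) δt 1 δa K HasNearPerfectMatching})
        atTop (nhds 1) := by
  obtain ⟨δt, δa, K, h1, h2, h3, h⟩ := exists_rare_not_strongResilient (ε := min ε (1 / 2))
    (by positivity) (min_le_right _ _)
  refine ⟨δt, δa, K, h1, h2, h3, h.tendsto_processMeasure fun n σ hσ m hm => ?_⟩
  refine StrongResilient.mono_left (not_not.1 fun hres => hσ ⟨m, Nat.ceil_le.2 ?_, hres⟩)
    (by linarith [min_le_left ε (1 / 2)])
  refine le_trans ?_ hm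
  have := Real.log_natCast_nonneg n
  gcongr
  exact min_le_left _ _

end
end RGP
end
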